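/- Let d ≥ 2 and n ≥ 1 be integers and let γ be a real number with 1/2 ≤ γ < 1. Let V : ℝ^d → M_n(ℂ) be a continuous function whose values are Hermitian nonpositive matrices, such that x ↦ tr((−V(x))^{γ+d/2}) is Lebesgue integrable on ℝ^d. Let ψ_1, …, ψ_N : ℝ^d → ℂ^n be twice continuously differentiable, square-integrable functions forming an orthonormal family in L²(ℝ^d, ℂ^n), and let E_1, …, E_N > 0 satisfy −Δψ_j + Vψ_j = −E_j ψ_j on ℝ^d for each j, where Δ = ∑_{k=1}^d ∂²/∂x_k² acts componentwise. Then ∑_{j=1}^N E_j^γ ≤ 4 L^cl_{γ,d} ∫_{ℝ^d} tr((−V(x))^{γ+d/2}) dx, where L^cl_{γ,d} := Γ(γ+1)/(2^d π^{d/2} Γ(γ + d/2 + 1)). -/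

import Mathlib

open MeasureTheory Matrix
open scoped ComplexOrder

/-- The classical Lieb–Thirring constant `L^cl_{γ,d} = Γ(γ+1)/(2^d π^{d/2} Γ(γ+d/2+1))`. -/
noncomputable def Lcl (γ : ℝ) (d : ℕ) : ℝ :=
  Real.Gamma (γ + 1) / (2 ^ d * Real.pi ^ ((d : ℝ) / 2) * Real.Gamma (γ + d / 2 + 1))

/-- For a Hermitian matrix `A` (whose eigenvalues are nonnegative in our applications)
this is the trace of the power `A^p` defined by the functional calculus:
`tr(A^p) = ∑ λ_i(A)^p`. -/
noncomputable def traceRpow {n : ℕ} (A : Matrix (Fin n) (Fin n) ℂ)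
    (hA : A.IsHermitian) (p : ℝ) : ℝ :=
  ∑ i, hA.eigenvalues i ^ p

/-- The Laplacian `Δf = ∑_{k=1}^d ∂²f/∂x_k²` of a function `f : ℝ^d → ℂ`. -/
noncomputable def lap {d : ℕ} (f : EuclideanSpace ℝ (Fin d) → ℂ)
    (x : EuclideanSpace ℝ (Fin d)) : ℂ :=
  ∑ k : Fin d,
    fderiv ℝ (fun y => fderiv ℝ f y (EuclideanSpace.single k (1 : ℝ))) x
      (EuclideanSpace.single k (1 : ℝ))

namespace LiebThirring

/-- The real parts of the roots of the characteristic polynomial, with multiplicity. -/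
noncomputable def specR {n : Type*} [Fintype n] [DecidableEq n] (A : Matrix n n ℂ) : Multiset ℝ :=
  A.charpoly.roots.map Complex.re

/-- The trace `tr f(A)` of a function of a Hermitian matrix. -/
noncomputable def trF {n : Type*} [Fintype n] [DecidableEq n] (f : ℝ → ℝ) (A : Matrix n n ℂ) : ℝ :=
  ((specR A).map f).sum

/-- The number of eigenvalues that are at least `t`. -/
noncomputable def cnt {n : Type*} [Fintype n] [DecidableEq n] (A : Matrix n n ℂ) (t : ℝ) : ℕ :=
  ((specR A).filter (t ≤ ·)).card

/-- The quadratic form of a matrix. -/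
noncomputable def quad {n : Type*} [Fintype n] (A : Matrix n n ℂ) (v : n → ℂ) : ℝ :=
  (star v ⬝ᵥ (A *ᵥ v)).re

/-- The squared `ℓ²` norm. -/
noncomputable def nsq {n : Type*} [Fintype n] (v : n → ℂ) : ℝ := ∑ i, Complex.normSq (v i)

section
variable {n m : Type*} [Fintype n] [DecidableEq n] [Fintype m] [DecidableEq m]

lemma specR_eq {A : Matrix n n ℂ} (hA : A.IsHermitian) :
    specR A = Finset.univ.val.map hA.eigenvalues := by
  rw [specR, hA.roots_charpoly_eq_eigenvalues, Multiset.map_map]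
  congr 1

lemma trF_eq {A : Matrix n n ℂ} (hA : A.IsHermitian) (f : ℝ → ℝ) :
    trF f A = ∑ i, f (hA.eigenvalues i) := by
  rw [trF, specR_eq hA, Multiset.map_map]; rfl

lemma cnt_eq {A : Matrix n n ℂ} (hA : A.IsHermitian) (t : ℝ) :
    cnt A t = Fintype.card {i // t ≤ hA.eigenvalues i} := by
  rw [cnt, specR_eq hA, Multiset.filter_map, Multiset.card_map, Fintype.card_subtype]
  rfl

lemma specR_submatrix (A : Matrix n n ℂ) (e : m ≃ n) : specR (A.submatrix e e) = specR A := by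
  rw [specR, specR]
  congr 2
  exact Matrix.charpoly_reindex e.symm A

lemma trF_submatrix (f : ℝ → ℝ) (A : Matrix n n ℂ) (e : m ≃ n) :
    trF f (A.submatrix e e) = trF f A := by
  rw [trF, trF, specR_submatrix]

lemma nsq_eq (v : n → ℂ) : star v ⬝ᵥ v = (nsq v : ℂ) := by
  simp [dotProduct, nsq, Complex.normSq_eq_conj_mul_self]

lemma nsq_nonneg (v : n → ℂ) : 0 ≤ nsq v := Finset.sum_nonneg fun _ _ => Complex.normSq_nonneg _

lemma nsq_eq_zero {v : n → ℂ} (h : nsq v = 0) : v = 0 := by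
  rw [nsq, Finset.sum_eq_zero_iff_of_nonneg fun _ _ => Complex.normSq_nonneg _] at h
  ext i; simpa using h i (Finset.mem_univ _)

/-- Coordinates with respect to an eigenbasis. -/
noncomputable def eigCoord {A : Matrix n n ℂ} (hA : A.IsHermitian) : (n → ℂ) ≃ₗ[ℂ] (n → ℂ) :=
  LinearEquiv.ofLinearMap (Matrix.toLin' (star (hA.eigenvectorUnitary : Matrix n n ℂ)))
    (Matrix.toLin' (hA.eigenvectorUnitary : Matrix n n ℂ))
    (by rw [← Matrix.toLin'_mul]; simp) (by rw [← Matrix.toLin'_mul]; simp)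

lemma spectral_mul {A : Matrix n n ℂ} (hA : A.IsHermitian) :
    A = (hA.eigenvectorUnitary : Matrix n n ℂ) * diagonal (fun i => (hA.eigenvalues i : ℂ)) *
      (hA.eigenvectorUnitary : Matrix n n ℂ)ᴴ := by
  have := hA.spectral_theorem
  rw [Unitary.conjStarAlgAut_apply] at this
  exact this

lemma unitary_mul_star {A : Matrix n n ℂ} (hA : A.IsHermitian) :
    (hA.eigenvectorUnitary : Matrix n n ℂ) * (hA.eigenvectorUnitary : Matrix n n ℂ)ᴴ = 1 :=
  Unitary.coe_mul_star_self _

lemma star_mul_unitary {A : Matrix n n ℂ} (hA : A.IsHermitian) :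
    (hA.eigenvectorUnitary : Matrix n n ℂ)ᴴ * (hA.eigenvectorUnitary : Matrix n n ℂ) = 1 :=
  Unitary.coe_star_mul_self _

lemma nsq_eigCoord {A : Matrix n n ℂ} (hA : A.IsHermitian) (v : n → ℂ) :
    nsq (eigCoord hA v) = nsq v := by
  have : star (eigCoord hA v) ⬝ᵥ (eigCoord hA v) = star v ⬝ᵥ v := by
    simp only [eigCoord, LinearEquiv.coe_ofLinearMap, Matrix.toLin'_apply]
    rw [star_mulVec, ← dotProduct_mulVec, mulVec_mulVec, star_eq_conjTranspose,
      conjTranspose_conjTranspose, unitary_mul_star, one_mulVec]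
  rw [nsq_eq, nsq_eq] at this
  exact_mod_cast this

lemma quad_eigCoord {A : Matrix n n ℂ} (hA : A.IsHermitian) (v : n → ℂ) :
    quad A v = ∑ i, hA.eigenvalues i * Complex.normSq (eigCoord hA v i) := by
  have : star v ⬝ᵥ (A *ᵥ v) = star (eigCoord hA v) ⬝ᵥ
      (diagonal (fun i => (hA.eigenvalues i : ℂ)) *ᵥ (eigCoord hA v)) := by
    simp only [eigCoord, LinearEquiv.coe_ofLinearMap, Matrix.toLin'_apply]
    rw [star_mulVec, ← dotProduct_mulVec, mulVec_mulVec, star_eq_conjTranspose,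
      conjTranspose_conjTranspose, mulVec_mulVec, ← spectral_mul]
  rw [quad, this]
  simp only [dotProduct, mulVec_diagonal, Complex.re_sum, Pi.star_apply, RCLike.star_def]
  refine Finset.sum_congr rfl fun i _ => ?_
  rw [mul_left_comm, ← Complex.normSq_eq_conj_mul_self, ← Complex.ofReal_mul, Complex.ofReal_re]

/-- Min-max principle, lower bound for the number of large eigenvalues. -/
lemma finrank_le_cnt {A : Matrix n n ℂ} (hA : A.IsHermitian) {F : Type*} [AddCommGroup F]
    [Module ℂ F] [FiniteDimensional ℂ F] (f : F →ₗ[ℂ] (n → ℂ)) (hf : Function.Injective f) (t : ℝ)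
    (h : ∀ x, t * nsq (f x) ≤ quad A (f x)) : Module.finrank ℂ F ≤ cnt A t := by
  classical
  rw [cnt_eq hA]
  let g : F →ₗ[ℂ] ({i // t ≤ hA.eigenvalues i} → ℂ) :=
    (LinearMap.funLeft ℂ ℂ Subtype.val).comp ((eigCoord hA).toLinearMap.comp f)
  have hg : Function.Injective g := by
    rw [← LinearMap.ker_eq_bot, LinearMap.ker_eq_bot']
    intro x hx
    have h0 : ∀ i, t ≤ hA.eigenvalues i → eigCoord hA (f x) i = 0 := fun i hi =>
      congrFun hx ⟨i, hi⟩
    have h1 := h x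
    rw [quad_eigCoord hA, ← nsq_eigCoord hA, nsq, Finset.mul_sum] at h1
    have h2 : ∀ i, eigCoord hA (f x) i = 0 := by
      by_contra! hne
      obtain ⟨i, hi⟩ := hne
      refine absurd h1 (not_le.2 (Finset.sum_lt_sum (fun j _ => ?_) ⟨i, Finset.mem_univ _, ?_⟩))
      · by_cases hj : t ≤ hA.eigenvalues j
        · simp [h0 j hj]
        · exact mul_le_mul_of_nonneg_right (not_le.1 hj).le (Complex.normSq_nonneg _)
      · have : ¬ t ≤ hA.eigenvalues i := fun hh => hi (h0 i hh)
        exact mul_lt_mul_of_pos_right (not_le.1 this) (Complex.normSq_pos.2 hi)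
    have h3 : eigCoord hA (f x) = 0 := funext h2
    rw [LinearEquiv.map_eq_zero_iff] at h3
    exact hf (by rw [h3, map_zero])
  simpa using LinearMap.finrank_le_finrank_of_injective hg

/-- Min-max principle: the spectral subspace. -/
lemma exists_submodule_cnt {A : Matrix n n ℂ} (hA : A.IsHermitian) (t : ℝ) :
    ∃ W : Submodule ℂ (n → ℂ), Module.finrank ℂ W = cnt A t ∧
      ∀ v ∈ W, t * nsq v ≤ quad A v := by
  classical
  let g : ({i // t ≤ hA.eigenvalues i} → ℂ) →ₗ[ℂ] (n → ℂ) :=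
    (eigCoord hA).symm.toLinearMap.comp (Function.ExtendByZero.linearMap ℂ Subtype.val)
  have hg : Function.Injective g := by
    refine (eigCoord hA).symm.injective.comp ?_
    intro x y hxy
    ext i
    have := congrFun hxy i
    rwa [Function.ExtendByZero.linearMap_apply, Function.ExtendByZero.linearMap_apply,
      Subtype.val_injective.extend_apply, Subtype.val_injective.extend_apply] at this
  refine ⟨LinearMap.range g, ?_, ?_⟩
  · rw [LinearMap.finrank_range_of_inj hg, cnt_eq hA]; simp
  · rintro _ ⟨x, rfl⟩
    rw [quad_eigCoord hA, ← nsq_eigCoord hA, nsq, Finset.mul_sum]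
    refine Finset.sum_le_sum fun i _ => ?_
    by_cases hi : t ≤ hA.eigenvalues i
    · exact mul_le_mul_of_nonneg_right hi (Complex.normSq_nonneg _)
    · have : eigCoord hA (g x) i = 0 := by
        simp only [g, LinearMap.comp_apply, LinearEquiv.coe_coe, LinearEquiv.apply_symm_apply,
          Function.ExtendByZero.linearMap_apply]
        rw [Function.extend_apply' _ _ _ (by rintro ⟨a, rfl⟩; exact hi a.2)]
        rfl
      simp [this]

lemma cnt_mono {A B : Matrix n n ℂ} (hA : A.IsHermitian) (hB : B.IsHermitian)
    (h : ∀ v, quad A v ≤ quad B v) (t : ℝ) : cnt A t ≤ cnt B t := by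
  obtain ⟨W, hW, hW'⟩ := exists_submodule_cnt hA t
  rw [← hW]
  exact finrank_le_cnt hB W.subtype W.injective_subtype t fun x =>
    (hW' x x.2).trans (h x)

end

/-- Comparison of sums from comparison of counting functions. -/
lemma multiset_sum_le_of_count {f : ℝ → ℝ} (hf : Monotone f) (hf0 : ∀ x ≤ 0, f x = 0)
    (s u : Multiset ℝ)
    (h : ∀ t > 0, (s.filter (t ≤ ·)).card ≤ (u.filter (t ≤ ·)).card) :
    (s.map f).sum ≤ (u.map f).sum := by
  have hfn : ∀ x, 0 ≤ f x := fun x => by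
    rcases le_total x 0 with hx | hx
    · exact (hf0 x hx).ge
    · rw [← hf0 0 le_rfl]; exact hf hx
  induction hk : s.card generalizing s u with
  | zero =>
    rw [Multiset.card_eq_zero.1 hk]
    simpa using Multiset.sum_nonneg (by simpa using fun a _ => hfn a)
  | succ k ih =>
    have hne : s.toFinset.Nonempty := by
      rw [Multiset.toFinset_nonempty]; rintro rfl; simp at hk
    obtain ⟨a, ha, hmax⟩ := s.toFinset.exists_max_image id hne
    rw [Multiset.mem_toFinset] at ha
    obtain ⟨s', rfl⟩ := Multiset.exists_cons_of_mem ha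
    have hmax' : ∀ x ∈ s', x ≤ a := fun x hx => hmax x (by simp [hx])
    rcases le_or_gt a 0 with ha0 | ha0
    · have : ((a ::ₘ s').map f).sum = 0 := by
        refine Multiset.sum_eq_zero ?_
        intro y hy
        obtain ⟨x, hx, rfl⟩ := Multiset.mem_map.1 hy
        refine hf0 x ?_
        rcases Multiset.mem_cons.1 hx with rfl | hx
        · exact ha0
        · exact (hmax' x hx).trans ha0
      rw [this]
      exact Multiset.sum_nonneg (by simpa using fun a _ => hfn a)
    · have h1 := h a ha0
      rw [Multiset.filter_cons_of_pos _ le_rfl, Multiset.card_cons] at h1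
      obtain ⟨b, hb⟩ := Multiset.card_pos_iff_exists_mem.1 (lt_of_lt_of_le (Nat.succ_pos _) h1)
      rw [Multiset.mem_filter] at hb
      obtain ⟨u', rfl⟩ := Multiset.exists_cons_of_mem hb.1
      rw [Multiset.map_cons, Multiset.sum_cons, Multiset.map_cons, Multiset.sum_cons]
      refine add_le_add (hf hb.2) (ih s' u' (fun t ht => ?_) (by simpa using hk))
      rcases le_or_gt t a with hta | hta
      · have := h t ht
        rw [Multiset.filter_cons_of_pos _ hta, Multiset.filter_cons_of_pos _ (hta.trans hb.2)] at this
        simpa using this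
      · rw [Multiset.filter_eq_nil.2 fun x hx hx' => absurd (hmax' x hx) (not_le.2 (hta.trans_le hx'))]
        simp

section
variable {n m : Type*} [Fintype n] [DecidableEq n] [Fintype m] [DecidableEq m]

lemma trF_le_of_cnt {f : ℝ → ℝ} (hf : Monotone f) (hf0 : ∀ x ≤ 0, f x = 0)
    {A : Matrix n n ℂ} {B : Matrix m m ℂ} (h : ∀ t > 0, cnt A t ≤ cnt B t) : trF f A ≤ trF f B :=
  multiset_sum_le_of_count hf hf0 _ _ h

lemma trF_mono {f : ℝ → ℝ} (hf : Monotone f) (hf0 : ∀ x ≤ 0, f x = 0)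
    {A B : Matrix n n ℂ} (hA : A.IsHermitian) (hB : B.IsHermitian)
    (h : ∀ v, quad A v ≤ quad B v) : trF f A ≤ trF f B :=
  trF_le_of_cnt hf hf0 fun t _ => cnt_mono hA hB h t

lemma monotone_posPow {γ : ℝ} (hγ : 0 ≤ γ) : Monotone fun x : ℝ => (max x 0) ^ γ := fun _ _ hxy =>
  Real.rpow_le_rpow (le_max_right _ _) (max_le_max_right 0 hxy) hγ

lemma posPow_of_nonpos {γ : ℝ} (hγ : 0 < γ) (x : ℝ) (hx : x ≤ 0) : (max x 0) ^ γ = 0 := by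
  rw [max_eq_right hx, Real.zero_rpow hγ.ne']

lemma trace_eq_trF {A : Matrix n n ℂ} (hA : A.IsHermitian) : A.trace.re = trF id A := by
  rw [trF_eq hA, hA.trace_eq_sum_eigenvalues]; simp

lemma trace_mul_le_trF {A Q : Matrix n n ℂ} (hA : A.IsHermitian) (hQ : Q.PosSemidef)
    (hQ1 : (1 - Q).PosSemidef) (t : ℝ) :
    (Q * A).trace.re - t * Q.trace.re ≤ trF (fun x => max (x - t) 0) A := by
  set U : Matrix n n ℂ := hA.eigenvectorUnitary.1 with hU
  have h1 : (Q * A).trace = ((Uᴴ * Q * U) * diagonal (fun i => (hA.eigenvalues i : ℂ))).trace := by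
    conv_lhs => rw [spectral_mul hA]
    rw [← hU, ← mul_assoc, trace_mul_comm, ← mul_assoc, ← mul_assoc]
  have h1' : Q.trace = (Uᴴ * Q * U).trace := by
    rw [trace_mul_comm, ← mul_assoc, hU, unitary_mul_star, one_mul]
  have h2 : (Uᴴ * Q * U).PosSemidef := hQ.conjTranspose_mul_mul_same U
  have h3 : (1 - Uᴴ * Q * U).PosSemidef := by
    have := hQ1.conjTranspose_mul_mul_same U
    rwa [mul_sub, sub_mul, mul_one, hU, star_mul_unitary] at this
  rw [h1, h1', trace, trace, Complex.re_sum, Complex.re_sum, trF_eq hA, Finset.mul_sum,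
    ← Finset.sum_sub_distrib]
  refine Finset.sum_le_sum fun i _ => ?_
  rw [diag_apply, diag_apply, mul_diagonal]
  have h4 := h2.diag_nonneg (i := i)
  have h5 := h3.diag_nonneg (i := i)
  rw [Matrix.sub_apply, one_apply_eq] at h5
  set c := (Uᴴ * Q * U) i i
  rw [Complex.le_def] at h4 h5
  simp at h4 h5
  rw [Complex.re_mul_ofReal]
  rcases le_total (hA.eigenvalues i - t) 0 with h | h
  · rw [max_eq_right h]; nlinarith
  · rw [max_eq_left h]; nlinarith

lemma exists_trace_mul_eq_trF {A : Matrix n n ℂ} (hA : A.IsHermitian) (t : ℝ) :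
    ∃ Q : Matrix n n ℂ, Q.PosSemidef ∧ (1 - Q).PosSemidef ∧
      (Q * A).trace.re - t * Q.trace.re = trF (fun x => max (x - t) 0) A := by
  set U : Matrix n n ℂ := hA.eigenvectorUnitary.1 with hU
  have h : Uᴴ * U = 1 := star_mul_unitary hA
  let p : n → ℂ := fun i => if t ≤ hA.eigenvalues i then 1 else 0
  refine ⟨U * diagonal p * Uᴴ, ?_, ?_, ?_⟩
  · refine PosSemidef.mul_mul_conjTranspose_same (PosSemidef.diagonal fun i => ?_) U
    simp only [p, Pi.zero_apply]; split_ifs <;> simp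
  · have : 1 - U * diagonal p * Uᴴ = U * diagonal (1 - p) * Uᴴ := by
      have h1 : diagonal (1 - p) = 1 - diagonal p := by
        rw [← diagonal_one, diagonal_sub]; rfl
      rw [h1, mul_sub, sub_mul, mul_one, hU, unitary_mul_star]
    rw [this]
    refine PosSemidef.mul_mul_conjTranspose_same (PosSemidef.diagonal fun i => ?_) U
    simp only [p, Pi.zero_apply, Pi.sub_apply, Pi.one_apply]; split_ifs <;> simp
  · conv_lhs => rw [spectral_mul hA]
    rw [← hU]
    have : U * diagonal p * Uᴴ * (U * diagonal (fun i => (hA.eigenvalues i : ℂ)) * Uᴴ) =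
        U * (diagonal p * diagonal (fun i => (hA.eigenvalues i : ℂ))) * Uᴴ := by
      calc _ = U * diagonal p * (Uᴴ * U) * diagonal (fun i => (hA.eigenvalues i : ℂ)) * Uᴴ := by
            simp only [mul_assoc]
        _ = _ := by rw [h, mul_one]; simp only [mul_assoc]
    rw [this, trace_mul_comm, ← mul_assoc, h, one_mul, diagonal_mul_diagonal,
      trace_mul_comm (U * diagonal p), ← mul_assoc, h, one_mul,
      trace_diagonal, trace_diagonal, trF_eq hA, Complex.re_sum, Complex.re_sum, Finset.mul_sum,
      ← Finset.sum_sub_distrib]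
    refine Finset.sum_congr rfl fun i _ => ?_
    simp only [p]
    split_ifs with h
    · simp [max_eq_left (sub_nonneg.2 h)]
    · simp [max_eq_right (sub_nonpos.2 (not_le.1 h).le)]

/-- Removing a slab from the positive part of the trace. -/
lemma trF_slab {A : Matrix n n ℂ} (hA : A.IsHermitian) {t s : ℝ} (hts : t ≤ s) :
    trF (fun x => max (x - s) 0) A + (s - t) * cnt A s ≤ trF (fun x => max (x - t) 0) A := by
  rw [trF_eq hA, trF_eq hA, cnt_eq hA, Fintype.card_subtype, Finset.card_filter]
  push_cast
  rw [Finset.mul_sum, ← Finset.sum_add_distrib]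
  refine Finset.sum_le_sum fun i _ => ?_
  split_ifs with h
  · rw [max_eq_left (by linarith), max_eq_left (by linarith)]; linarith
  · rw [max_eq_right (by linarith)]; simp

end

section
variable {n m : Type*} [Fintype n] [DecidableEq n] [Fintype m] [DecidableEq m]

lemma quad_add (A B : Matrix n n ℂ) (v : n → ℂ) : quad (A + B) v = quad A v + quad B v := by
  simp [quad, add_mulVec, dotProduct_add]

lemma quad_sub (A B : Matrix n n ℂ) (v : n → ℂ) : quad (A - B) v = quad A v - quad B v := by
  simp [quad, sub_mulVec, dotProduct_sub]

lemma quad_smul (r : ℝ) (A : Matrix n n ℂ) (v : n → ℂ) : quad (r • A) v = r * quad A v := by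
  simp [quad, smul_mulVec, dotProduct_smul]

lemma quad_one (v : n → ℂ) : quad 1 v = nsq v := by
  rw [quad, one_mulVec, nsq_eq, Complex.ofReal_re]

lemma quad_conj (A : Matrix m m ℂ) (B : Matrix m n ℂ) (v : n → ℂ) :
    quad (Bᴴ * A * B) v = quad A (B *ᵥ v) := by
  rw [quad, quad, ← mulVec_mulVec, ← mulVec_mulVec, dotProduct_mulVec, ← star_mulVec]

lemma nsq_mulVec (B : Matrix m n ℂ) (v : n → ℂ) : nsq (B *ᵥ v) = quad (Bᴴ * B) v := by
  rw [← quad_one, ← quad_conj, Matrix.mul_one]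

lemma PosSemidef_quad {A : Matrix n n ℂ} (hA : A.PosSemidef) (v : n → ℂ) : 0 ≤ quad A v :=
  (Complex.le_def.1 (hA.dotProduct_mulVec_nonneg v)).1

lemma quad_im {A : Matrix n n ℂ} (hA : A.IsHermitian) (v : n → ℂ) :
    (star v ⬝ᵥ (A *ᵥ v)).im = 0 := by
  have : star (star v ⬝ᵥ (A *ᵥ v)) = star v ⬝ᵥ (A *ᵥ v) := by
    have h : star v ᵥ* A = star (A *ᵥ v) := by rw [star_mulVec, hA.eq]
    conv_rhs => rw [dotProduct_mulVec, h, star_dotProduct]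
  exact Complex.conj_eq_iff_im.1 this

lemma exists_factor {A : Matrix n n ℂ} (hA : A.PosSemidef) : ∃ B : Matrix n n ℂ, A = Bᴴ * B := by
  refine ⟨diagonal (fun i => ((Real.sqrt (hA.1.eigenvalues i) : ℝ) : ℂ)) *
    (hA.1.eigenvectorUnitary.1)ᴴ, ?_⟩
  conv_lhs => rw [spectral_mul hA.1]
  rw [conjTranspose_mul, diagonal_conjTranspose, conjTranspose_conjTranspose, mul_assoc, mul_assoc,
    ← mul_assoc (diagonal _) (diagonal _), diagonal_mul_diagonal]
  congr 3
  ext i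
  simp [← Complex.ofReal_mul, Real.mul_self_sqrt (hA.eigenvalues_nonneg i)]

lemma two_re_dotProduct_le (a w : n → ℂ) {t : ℝ} (ht : 0 < t) :
    2 * (star a ⬝ᵥ w).re ≤ t * nsq a + nsq w / t := by
  rw [nsq, nsq, dotProduct, Complex.re_sum, Finset.mul_sum, Finset.mul_sum, Finset.sum_div,
    ← Finset.sum_add_distrib]
  refine Finset.sum_le_sum fun i _ => ?_
  have h : 2 * (star a i * w i).re * t ≤ t ^ 2 * Complex.normSq (a i) + Complex.normSq (w i) := by
    simp only [Pi.star_apply, RCLike.star_def, Complex.mul_re, Complex.conj_re, Complex.conj_im,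
      Complex.normSq_apply]
    nlinarith [sq_nonneg (t * (a i).re - (w i).re), sq_nonneg (t * (a i).im - (w i).im)]
  rw [show t * Complex.normSq (a i) + Complex.normSq (w i) / t =
    (t ^ 2 * Complex.normSq (a i) + Complex.normSq (w i)) / t by field_simp, le_div_iff₀ ht]
  exact h

end

section chain
variable {ι : Type*} [Fintype ι] [DecidableEq ι] {L : ℕ}
open scoped Kronecker

/-- The truncated shift on `Fin L`. -/
noncomputable def shiftM (L : ℕ) : Matrix (Fin L) (Fin L) ℂ :=
  of fun i j => if (i : ℕ) + 1 = j then 1 else 0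

/-- The adjacency matrix of the path with `L` vertices. -/
noncomputable def pathJ (L : ℕ) : Matrix (Fin L) (Fin L) ℂ := shiftM L + (shiftM L)ᴴ

/-- `1 ⊗ X`. -/
noncomputable def ten (ι : Type*) [Fintype ι] [DecidableEq ι] (X : Matrix (Fin L) (Fin L) ℂ) :
    Matrix (ι × Fin L) (ι × Fin L) ℂ := (1 : Matrix ι ι ℂ) ⊗ₖ X

/-- The discrete Schrödinger operator (with the sign changed) on a path with matrix potential. -/
noncomputable def chain (b : Fin L → Matrix ι ι ℂ) : Matrix (ι × Fin L) (ι × Fin L) ℂ :=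
  ten ι (pathJ L - (2 : ℝ) • 1) + blockDiagonal b

lemma ten_mul (X Y : Matrix (Fin L) (Fin L) ℂ) : ten ι (X * Y) = ten ι X * ten ι Y := by
  rw [ten, ten, ten, ← mul_kronecker_mul, one_mul]

lemma ten_add (X Y : Matrix (Fin L) (Fin L) ℂ) : ten ι (X + Y) = ten ι X + ten ι Y :=
  kronecker_add _ _ _

lemma ten_sub (X Y : Matrix (Fin L) (Fin L) ℂ) : ten ι (X - Y) = ten ι X - ten ι Y := by
  ext; simp [ten, mul_sub]

lemma ten_smul (r : ℝ) (X : Matrix (Fin L) (Fin L) ℂ) : ten ι (r • X) = r • ten ι X :=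
  kronecker_smul _ _ _

lemma ten_one : ten ι (1 : Matrix (Fin L) (Fin L) ℂ) = 1 := one_kronecker_one

lemma ten_conjTranspose (X : Matrix (Fin L) (Fin L) ℂ) : ten ι Xᴴ = (ten ι X)ᴴ := by
  rw [ten, ten, conjTranspose_kronecker, conjTranspose_one]

lemma ten_posSemidef {X : Matrix (Fin L) (Fin L) ℂ} (hX : X.PosSemidef) : (ten ι X).PosSemidef :=
  PosSemidef.one.kronecker hX

lemma shiftM_sq : ((shiftM L)ᴴ * shiftM L) =
    diagonal fun i : Fin L => if (i : ℕ) = 0 then 0 else 1 := by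
  ext i j
  simp only [mul_apply, shiftM, conjTranspose_apply, of_apply, diagonal_apply, RCLike.star_def]
  rcases Nat.eq_zero_or_pos (i : ℕ) with hi | hi
  · rw [Finset.sum_eq_zero fun x _ => by rw [if_neg (by omega)]; simp]
    simp [hi]
  · have hk : (i : ℕ) - 1 < L := by omega
    rw [Finset.sum_eq_single (⟨(i : ℕ) - 1, hk⟩ : Fin L)]
    · simp only [Fin.ext_iff]
      rw [if_pos (by omega)]
      by_cases hij : (i : ℕ) = j
      · rw [if_pos (by omega), if_pos hij, if_neg (by omega)]; simp
      · rw [if_neg (by omega), if_neg hij]; simp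
    · intro k _ hk
      rw [if_neg (by rw [ne_eq, Fin.ext_iff] at hk; simp at hk; omega)]; simp
    · simp

lemma isHermitian_pathJ : (pathJ L).IsHermitian := by
  rw [pathJ, IsHermitian, conjTranspose_add, conjTranspose_conjTranspose, add_comm]

lemma isHermitian_tri : (pathJ L - (2 : ℝ) • 1 : Matrix (Fin L) (Fin L) ℂ).IsHermitian := by
  refine isHermitian_pathJ.sub ?_
  rw [IsHermitian, conjTranspose_smul]; simp

lemma isHermitian_ten {X : Matrix (Fin L) (Fin L) ℂ} (hX : X.IsHermitian) :
    (ten ι X).IsHermitian := by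
  rw [IsHermitian, ← ten_conjTranspose, hX.eq]

lemma isHermitian_blockDiagonal {b : Fin L → Matrix ι ι ℂ} (hb : ∀ i, (b i).IsHermitian) :
    (blockDiagonal b).IsHermitian := by
  rw [IsHermitian, blockDiagonal_conjTranspose]; congr 1; ext1 i; exact hb i

lemma isHermitian_chain {b : Fin L → Matrix ι ι ℂ} (hb : ∀ i, (b i).IsHermitian) :
    (chain b).IsHermitian :=
  (isHermitian_ten isHermitian_tri).add (isHermitian_blockDiagonal hb)

lemma quad_ten_pathJ_le {z : ℝ} (v : ι × Fin L → ℂ) :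
    nsq (ten ι (1 - z • shiftM L) *ᵥ v) ≤ (1 + z ^ 2) * nsq v - z * quad (ten ι (pathJ L)) v := by
  have h : ((1 - z • shiftM L)ᴴ * (1 - z • shiftM L)) + (z ^ 2) •
      diagonal (fun i : Fin L => if (i : ℕ) = 0 then (1 : ℂ) else 0) =
      (1 + z ^ 2) • 1 - z • pathJ L := by
    have h1 : (1 - z • shiftM L)ᴴ = 1 - z • (shiftM L)ᴴ := by
      rw [conjTranspose_sub, conjTranspose_smul]; simp
    have h2 : diagonal (fun i : Fin L => if (i : ℕ) = 0 then (1 : ℂ) else 0) =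
        1 - (shiftM L)ᴴ * shiftM L := by
      rw [shiftM_sq, ← diagonal_one, diagonal_sub]
      congr 1; ext i; split_ifs <;> simp
    rw [h1, h2, pathJ, sub_mul, mul_sub, mul_sub]
    simp only [mul_one, one_mul, smul_mul_assoc, mul_smul_comm]
    module
  rw [nsq_mulVec, ← ten_conjTranspose, ← ten_mul, eq_sub_of_add_eq h, ten_sub, ten_sub, ten_smul,
    ten_smul, ten_smul, ten_one, quad_sub, quad_sub, quad_smul, quad_smul, quad_smul, quad_one]
  have h3 : 0 ≤ quad (ten ι (diagonal (fun i : Fin L => if (i : ℕ) = 0 then (1 : ℂ) else 0))) v :=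
    PosSemidef_quad (ten_posSemidef (PosSemidef.diagonal fun i => by
      simp only [Pi.zero_apply]; split_ifs <;> simp)) v
  nlinarith [mul_nonneg (sq_nonneg z) h3]

end chain

section
variable {L : ℕ}

/-- The matrix `z^{|i-j|}`. -/
noncomputable def powDist (L : ℕ) (z : ℝ) : Matrix (Fin L) (Fin L) ℂ :=
  of fun i j => ((z ^ (((i : ℤ) - j).natAbs) : ℝ) : ℂ)

/-- The upper triangular matrix `z^{j-i}`. -/
noncomputable def powUpper (L : ℕ) (z : ℝ) : Matrix (Fin L) (Fin L) ℂ :=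
  of fun i j => if (i : ℕ) ≤ j then ((z ^ ((j : ℕ) - i) : ℝ) : ℂ) else 0

lemma sub_shift_mul_apply (z : ℝ) (X : Matrix (Fin L) (Fin L) ℂ) (i j : Fin L) :
    ((1 - z • shiftM L) * X) i j =
      X i j - if h : (i : ℕ) + 1 < L then z * X ⟨i + 1, h⟩ j else 0 := by
  rw [sub_mul, one_mul, Matrix.sub_apply, smul_mul_assoc, Matrix.smul_apply, mul_apply]
  congr 1
  split_ifs with h
  · rw [Finset.sum_eq_single (⟨i + 1, h⟩ : Fin L)]
    · simp [shiftM]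
    · intro k _ hk
      rw [ne_eq, Fin.ext_iff] at hk
      simp only [shiftM, of_apply]
      rw [if_neg (by simp at hk; omega), zero_mul]
    · simp
  · rw [Finset.sum_eq_zero fun k _ => ?_, smul_zero]
    simp only [shiftM, of_apply]
    rw [if_neg (by omega), zero_mul]

lemma sub_shift_mul_powUpper (z : ℝ) : (1 - z • shiftM L) * powUpper L z = 1 := by
  ext i j
  rw [sub_shift_mul_apply, one_apply]
  simp only [powUpper, of_apply, Fin.ext_iff]
  rcases lt_trichotomy (i : ℕ) j with h | h | h
  · rw [if_pos h.le, dif_pos (by omega), if_pos (by omega), if_neg (by omega),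
      show (j : ℕ) - i = (j - (i + 1)) + 1 by omega, pow_succ]
    push_cast; ring
  · rw [if_pos h.le, if_pos h]
    split_ifs with h1 h2
    · omega
    · simp [h]
    · simp [h]
  · rw [if_neg (by omega), if_neg (by omega)]
    split_ifs with h1 h2
    · omega
    · simp
    · omega
    · simp

lemma powUpper_mul_sub_shift (z : ℝ) : powUpper L z * (1 - z • shiftM L) = 1 :=
  mul_eq_one_comm.1 (sub_shift_mul_powUpper z)

lemma sub_shift_mul_powDist (z : ℝ) : (1 - z • shiftM L) * powDist L z =
    diagonal (fun i : Fin L => if (i : ℕ) + 1 = L then 1 else ((1 - z ^ 2 : ℝ) : ℂ)) *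
      (powUpper L z)ᴴ := by
  ext i j
  rw [sub_shift_mul_apply, diagonal_mul, conjTranspose_apply]
  simp only [powUpper, powDist, of_apply]
  have hj := j.2
  rcases lt_or_ge (i : ℕ) j with h | h
  · rw [dif_pos (by omega), if_neg (by omega : ¬ (j : ℕ) ≤ i),
      show ((i : ℤ) - j).natAbs = ((j : ℕ) - (i + 1)) + 1 by omega,
      show (((i : ℕ) + 1 : ℕ) - (j : ℤ)).natAbs = ((j : ℕ) - (i + 1)) by omega, pow_succ]
    push_cast; simp; ring
  · rw [if_pos (by omega : (j : ℕ) ≤ i), show ((i : ℤ) - j).natAbs = (i : ℕ) - j by omega]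
    split_ifs with h1 h2 h2
    · omega
    · rw [show (((i : ℕ) + 1 : ℕ) - (j : ℤ)).natAbs = ((i : ℕ) - j) + 1 by omega, pow_succ]
      push_cast; simp; ring
    · simp
    · omega

lemma powDist_eq (z : ℝ) : powDist L z = powUpper L z *
    diagonal (fun i : Fin L => if (i : ℕ) + 1 = L then 1 else ((1 - z ^ 2 : ℝ) : ℂ)) *
      (powUpper L z)ᴴ := by
  rw [mul_assoc, ← sub_shift_mul_powDist, ← mul_assoc, powUpper_mul_sub_shift, one_mul]

lemma powDist_sub_posSemidef (z : ℝ) :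
    (powDist L z - (1 - z ^ 2) • (powUpper L z * (powUpper L z)ᴴ)).PosSemidef := by
  have : powDist L z - (1 - z ^ 2) • (powUpper L z * (powUpper L z)ᴴ) = powUpper L z *
      diagonal (fun i : Fin L => if (i : ℕ) + 1 = L then ((z ^ 2 : ℝ) : ℂ) else 0) *
      (powUpper L z)ᴴ := by
    have h : diagonal (fun i : Fin L => if (i : ℕ) + 1 = L then 1 else ((1 - z ^ 2 : ℝ) : ℂ)) =
        diagonal (fun i : Fin L => if (i : ℕ) + 1 = L then ((z ^ 2 : ℝ) : ℂ) else 0) +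
        (1 - z ^ 2 : ℝ) • 1 := by
      ext i j
      by_cases hij : i = j
      · subst hij; simp; split_ifs <;> simp
      · simp [hij]
    rw [powDist_eq, h, mul_add, add_mul, mul_smul_comm, smul_mul_assoc, mul_one, add_sub_cancel_right]
  rw [this]
  refine PosSemidef.mul_mul_conjTranspose_same (PosSemidef.diagonal fun i => ?_) _
  simp only [Pi.zero_apply]
  split_ifs
  · exact Complex.zero_le_real.2 (sq_nonneg z)
  · exact le_rfl

lemma powDist_posSemidef {z : ℝ} (hz0 : 0 ≤ z) (hz : z ≤ 1) : (powDist L z).PosSemidef := by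
  have h := (powDist_sub_posSemidef (L := L) z).add
    ((posSemidef_self_mul_conjTranspose (powUpper L z)).smul
      (show (0 : ℝ) ≤ 1 - z ^ 2 by nlinarith))
  rwa [sub_add_cancel] at h

end

section birman
variable {ι : Type*} [Fintype ι] [DecidableEq ι] {L : ℕ}

/-- The Birman–Schwinger type operator. -/
noncomputable def bsOp (β : Fin L → Matrix ι ι ℂ) (z : ℝ) : Matrix (ι × Fin L) (ι × Fin L) ℂ :=
  blockDiagonal β * ten ι (powDist L z) * (blockDiagonal β)ᴴ

lemma bsOp_posSemidef (β : Fin L → Matrix ι ι ℂ) {z : ℝ} (hz0 : 0 ≤ z) (hz : z ≤ 1) :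
    (bsOp β z).PosSemidef :=
  (ten_posSemidef (powDist_posSemidef hz0 hz)).mul_mul_conjTranspose_same _

lemma cnt_chain_le_bsOp (β : Fin L → Matrix ι ι ℂ) {z : ℝ} (hz0 : 0 < z) (hz : z < 1) :
    cnt (chain fun k => (β k)ᴴ * β k) (z + 1 / z - 2) ≤ cnt (bsOp β z) (1 / z - z) := by
  set 𝔅 := blockDiagonal β with h𝔅
  have hbd : blockDiagonal (fun k => (β k)ᴴ * β k) = 𝔅ᴴ * 𝔅 := by
    rw [h𝔅, blockDiagonal_conjTranspose, ← blockDiagonal_mul]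
  have hH : (chain fun k => (β k)ᴴ * β k).IsHermitian :=
    isHermitian_chain fun k => isHermitian_conjTranspose_mul_self (β k)
  obtain ⟨W, hW, hW'⟩ := exists_submodule_cnt hH (z + 1 / z - 2)
  rw [← hW]
  have key : ∀ v ∈ W, nsq (ten ι (1 - z • shiftM L) *ᵥ v) ≤ z * nsq (𝔅 *ᵥ v) := by
    intro v hv
    have h1 := hW' v hv
    rw [chain, hbd, quad_add, ten_sub, ten_smul, ten_one, quad_sub, quad_smul, quad_one,
      ← nsq_mulVec] at h1
    have h2 := quad_ten_pathJ_le (z := z) v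
    have h3 : z * ((z + 1 / z - 2) * nsq v) ≤
        z * (quad (ten ι (pathJ L)) v - 2 * nsq v + nsq (𝔅 *ᵥ v)) :=
      mul_le_mul_of_nonneg_left h1 hz0.le
    have h4 : z * ((z + 1 / z - 2) * nsq v) = (z ^ 2 + 1 - 2 * z) * nsq v := by field_simp
    rw [h4] at h3
    linarith
  refine finrank_le_cnt (bsOp_posSemidef β hz0.le hz.le).1 (𝔅.mulVecLin.comp W.subtype) ?_ _ ?_
  · rw [← LinearMap.ker_eq_bot, LinearMap.ker_eq_bot']
    rintro ⟨v, hv⟩ hx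
    have h0 : 𝔅 *ᵥ v = 0 := hx
    have h1 := key v hv
    rw [h0] at h1
    have h2 : nsq (ten ι (1 - z • shiftM L) *ᵥ v) = 0 :=
      le_antisymm (by simpa [nsq] using h1) (nsq_nonneg _)
    have h3 := nsq_eq_zero h2
    have h4 : ten ι (powUpper L z) *ᵥ (ten ι (1 - z • shiftM L) *ᵥ v) = v := by
      rw [mulVec_mulVec, ← ten_mul, powUpper_mul_sub_shift, ten_one, one_mulVec]
    rw [h3, mulVec_zero] at h4
    exact Subtype.ext h4.symm
  · rintro ⟨v, hv⟩
    have h1 := key v hv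
    change (1 / z - z) * nsq (𝔅 *ᵥ v) ≤ quad (bsOp β z) (𝔅 *ᵥ v)
    have h2 : quad (bsOp β z) (𝔅 *ᵥ v) = quad (ten ι (powDist L z)) (𝔅ᴴ *ᵥ (𝔅 *ᵥ v)) := by
      rw [← quad_conj (ten ι (powDist L z)), h𝔅, conjTranspose_conjTranspose, bsOp]
    set x := 𝔅ᴴ *ᵥ (𝔅 *ᵥ v) with hx
    have h3 : (1 - z ^ 2) * nsq ((ten ι (powUpper L z))ᴴ *ᵥ x) ≤ quad (ten ι (powDist L z)) x := by
      have h := PosSemidef_quad (ten_posSemidef (ι := ι) (powDist_sub_posSemidef (L := L) z)) x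
      rw [ten_sub, ten_smul, ten_mul, ten_conjTranspose, quad_sub, quad_smul] at h
      rw [nsq_mulVec, conjTranspose_conjTranspose]
      linarith
    have h4 : (star ((ten ι (powUpper L z))ᴴ *ᵥ x) ⬝ᵥ (ten ι (1 - z • shiftM L) *ᵥ v)).re =
        nsq (𝔅 *ᵥ v) := by
      rw [star_mulVec, conjTranspose_conjTranspose, ← dotProduct_mulVec, mulVec_mulVec, ← ten_mul,
        powUpper_mul_sub_shift, ten_one, one_mulVec, hx, star_mulVec, conjTranspose_conjTranspose,
        ← dotProduct_mulVec, nsq_eq, Complex.ofReal_re]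
    have h5 := two_re_dotProduct_le ((ten ι (powUpper L z))ᴴ *ᵥ x)
      (ten ι (1 - z • shiftM L) *ᵥ v) hz0
    rw [h4] at h5
    have h6 : nsq (ten ι (1 - z • shiftM L) *ᵥ v) / z ≤ nsq (𝔅 *ᵥ v) := by
      rw [div_le_iff₀ hz0]; linarith
    rw [h2]
    refine le_trans ?_ h3
    have h7 : nsq (𝔅 *ᵥ v) ≤ z * nsq ((ten ι (powUpper L z))ᴴ *ᵥ x) := by linarith
    have h8 : (1 / z - z) = (1 - z ^ 2) / z := by field_simp
    rw [h8, div_mul_eq_mul_div, div_le_iff₀ hz0, mul_assoc]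
    refine mul_le_mul_of_nonneg_left ?_ (by nlinarith)
    linarith

/-- Monotonicity of the slabs of the Birman–Schwinger type operator. -/
lemma trF_bsOp_mono (β : Fin L → Matrix ι ι ℂ) {z w : ℝ} (hz0 : 0 ≤ z) (hzw : z ≤ w) (hw0 : 0 < w)
    (hw : w ≤ 1) (t : ℝ) :
    trF (fun x => max (x - t) 0) (bsOp β z) ≤ trF (fun x => max (x - t) 0) (bsOp β w) := by
  obtain ⟨Q, hQ, hQ1, hQt⟩ := exists_trace_mul_eq_trF (bsOp_posSemidef β hz0 (hzw.trans hw)).1 t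
  rw [← hQt]
  set C : Matrix (ι × Fin L) (ι × Fin L) ℂ :=
    (powDist L (z / w)).submatrix Prod.snd Prod.snd with hC
  have hzw0 : 0 ≤ z / w := by positivity
  have hzw1 : z / w ≤ 1 := by rwa [div_le_one hw0]
  have hCp : C.PosSemidef := (powDist_posSemidef hzw0 hzw1).submatrix _
  have hCs : ∀ p q, C p q = C q p := by
    intro p q
    simp only [hC, powDist, submatrix_apply, of_apply]
    rw [← Int.natAbs_neg, neg_sub]
  have hC1 : ∀ p, C p p = 1 := by intro p; simp [hC, powDist]
  have hbs : ∀ p q, bsOp β z p q = C p q * bsOp β w p q := by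
    have h : ∀ u : ℝ, ∀ p q, bsOp β u p q =
        (powDist L u p.2 q.2) * (β p.2 * (β q.2)ᴴ) p.1 q.1 := by
      intro u p q
      rw [bsOp, mul_apply, mul_apply, Finset.mul_sum, Fintype.sum_prod_type]
      refine Finset.sum_congr rfl fun i _ => ?_
      rw [Finset.sum_eq_single q.2]
      · rw [mul_apply, Fintype.sum_prod_type, Finset.sum_eq_single i, Finset.sum_eq_single p.2]
        · simp [ten, blockDiagonal_apply]; ring
        · intro k _ hk; simp [blockDiagonal_apply, hk.symm]
        · simp
        · intro j _ hj; simp [ten, hj]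
        · simp
      · intro k _ hk; simp [blockDiagonal_apply, hk.symm]
      · simp
    intro p q
    rw [h z, h w, ← mul_assoc]
    congr 1
    simp only [hC, powDist, submatrix_apply, of_apply]
    rw [← Complex.ofReal_mul, ← mul_pow, div_mul_cancel₀ _ hw0.ne']
  have h1 : (Q * bsOp β z).trace = ((C ⊙ Q) * bsOp β w).trace := by
    simp only [trace, diag_apply, mul_apply, hadamard_apply]
    refine Finset.sum_congr rfl fun i _ => Finset.sum_congr rfl fun j _ => ?_
    rw [hbs, hCs j i]; ring
  have h2 : Q.trace = (C ⊙ Q).trace := by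
    simp [trace, hC1]
  rw [h1, h2]
  refine trace_mul_le_trF (bsOp_posSemidef β hw0.le hw).1 (hCp.hadamard hQ) ?_ t
  have h3 : 1 - C ⊙ Q = C ⊙ (1 - Q) := by
    ext i j
    rw [hadamard_apply, Matrix.sub_apply, Matrix.sub_apply, hadamard_apply, mul_sub]
    by_cases hij : i = j
    · subst hij; simp [hC1]
    · simp [hij]
  rw [h3]
  exact hCp.hadamard hQ1

lemma trF_bsOp_zero (β : Fin L → Matrix ι ι ℂ) {z : ℝ} (hz0 : 0 ≤ z) (hz : z ≤ 1) :
    trF (fun x => max (x - 0) 0) (bsOp β z) = ∑ k, ((β k)ᴴ * β k).trace.re := by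
  have hp := bsOp_posSemidef β hz0 hz
  have h1 : trF (fun x => max (x - 0) 0) (bsOp β z) = (bsOp β z).trace.re := by
    rw [trace_eq_trF hp.1, trF_eq hp.1, trF_eq hp.1]
    refine Finset.sum_congr rfl fun i _ => ?_
    simp [hp.eigenvalues_nonneg i]
  rw [h1, bsOp, trace_mul_comm, ← mul_assoc, blockDiagonal_conjTranspose, ← blockDiagonal_mul,
    trace, Complex.re_sum, Fintype.sum_prod_type_right]
  refine Finset.sum_congr rfl fun k _ => ?_
  rw [trace, Complex.re_sum]
  refine Finset.sum_congr rfl fun i _ => ?_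
  rw [diag_apply, diag_apply, mul_apply, Fintype.sum_prod_type, Finset.sum_eq_single i,
    Finset.sum_eq_single k]
  · simp [ten, powDist]
  · intro l _ hl; simp [blockDiagonal_apply, hl.symm]
  · simp
  · intro j _ hj; simp [ten, hj]
  · simp

end birman

/-- The abstract form of the Hundertmark–Laptev–Weidl induction. -/
lemma sum_le_of_family {T : ℝ → ℝ → ℝ} {c : ℝ → ℝ → ℕ} {g : ℝ → ℝ} (hg0 : ∀ e > 0, 0 ≤ g e)
    (hT0 : ∀ e > 0, ∀ t, 0 ≤ T e t) (hT : ∀ e e' t, 0 < e → e ≤ e' → T e' t ≤ T e t)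
    (hTc : ∀ e > 0, ∀ t s, t ≤ s → T e s + (s - t) * c e s ≤ T e t) (k : ℕ) :
    ∀ s : Multiset ℝ, s.card = k → (∀ e ∈ s, 0 < e) →
    (∀ e ∈ s, (s.filter (e ≤ ·)).card ≤ c e (g e)) → ∀ e > 0, (∀ e' ∈ s, e ≤ e') → ∀ t ≥ 0,
    (s.map g).sum ≤ s.card * t + T e t := by
  induction k with
  | zero =>
    intro s hk _ _ e he _ t ht
    rw [Multiset.card_eq_zero.1 hk]
    simpa using hT0 e he t
  | succ k ih =>
    intro s hk hs hc e he hes t ht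
    have hne : s.toFinset.Nonempty := by
      rw [Multiset.toFinset_nonempty]; rintro rfl; simp at hk
    obtain ⟨a, ha, hmin⟩ := s.toFinset.exists_min_image id hne
    simp only [id] at hmin
    rw [Multiset.mem_toFinset] at ha
    have hca := hc a ha
    rw [Multiset.filter_eq_self.2 fun x hx => hmin x (Multiset.mem_toFinset.2 hx)] at hca
    have ha0 := hs a ha
    have hTa := hT e a t he (hes a ha)
    obtain ⟨s', rfl⟩ := Multiset.exists_cons_of_mem ha
    have hk' : s'.card = k := by simpa using hk
    have ih' := ih s' hk' (fun x hx => hs x (Multiset.mem_cons_of_mem hx)) (fun x hx =>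
      le_trans (Multiset.card_le_card (Multiset.filter_le_filter _ (Multiset.le_cons_self _ _)))
        (hc x (Multiset.mem_cons_of_mem hx))) a ha0
      (fun x hx => hmin x (by simp [hx]))
    rw [Multiset.map_cons, Multiset.sum_cons, Multiset.card_cons]
    rcases le_or_gt (g a) t with h | h
    · have := ih' t ht
      push_cast
      linarith
    · have h1 := ih' (g a) (hg0 a ha0)
      have h2 := hTc a ha0 t (g a) h.le
      have h3 : ((s'.card + 1 : ℕ) : ℝ) ≤ c a (g a) := by
        rw [Multiset.card_cons] at hca; exact_mod_cast hca
      have h4 : (g a - t) * ((s'.card + 1 : ℕ) : ℝ) ≤ (g a - t) * c a (g a) :=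
        mul_le_mul_of_nonneg_left h3 (by linarith)
      push_cast at h4 ⊢
      nlinarith

/-- The Joukowski parameter: the solution `z ∈ (0, 1]` of `z + 1 / z = 2 + e`. -/
noncomputable def jou (e : ℝ) : ℝ := Real.exp (-Real.arcosh (1 + e / 2))

lemma jou_pos (e : ℝ) : 0 < jou e := Real.exp_pos _

lemma jou_le_one {e : ℝ} (he : 0 ≤ e) : jou e ≤ 1 :=
  Real.exp_le_one_iff.2 (neg_nonpos.2 (Real.arcosh_nonneg (by linarith)))

lemma jou_lt_one {e : ℝ} (he : 0 < e) : jou e < 1 :=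
  Real.exp_lt_one_iff.2 (neg_lt_zero.2 (Real.arcosh_pos (by linarith)))

lemma jou_anti {e e' : ℝ} (he : 0 ≤ e) (h : e ≤ e') : jou e' ≤ jou e :=
  Real.exp_le_exp.2 (neg_le_neg ((Real.arcosh_le_arcosh (by linarith) (by linarith)).2
    (by linarith)))

lemma jou_add {e : ℝ} (he : 0 ≤ e) : jou e + 1 / jou e - 2 = e := by
  have h := Real.cosh_arcosh (show 1 ≤ 1 + e / 2 by linarith)
  rw [Real.cosh_eq] at h
  rw [jou, one_div, ← Real.exp_neg, neg_neg]; linarith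

lemma jou_sub {e : ℝ} (he : 0 ≤ e) : 1 / jou e - jou e = Real.sqrt (e ^ 2 + 4 * e) := by
  have h := Real.sinh_arcosh (show 1 ≤ 1 + e / 2 by linarith)
  rw [Real.sinh_eq] at h
  have h2 : Real.sqrt (e ^ 2 + 4 * e) = 2 * Real.sqrt ((1 + e / 2) ^ 2 - 1) := by
    rw [show e ^ 2 + 4 * e = 2 ^ 2 * ((1 + e / 2) ^ 2 - 1) by ring, Real.sqrt_mul (by norm_num),
      Real.sqrt_sq (by norm_num)]
  rw [jou, one_div, ← Real.exp_neg, neg_neg, h2, ← h]; ring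

section
variable {ι : Type*} [Fintype ι] [DecidableEq ι] {L : ℕ}

lemma trF_eq_filter {f : ℝ → ℝ} (hf0 : ∀ x ≤ 0, f x = 0) {n : Type*} [Fintype n] [DecidableEq n]
    (A : Matrix n n ℂ) : trF f A = (((specR A).filter (0 < ·)).map f).sum := by
  rw [trF]
  conv_lhs => rw [← Multiset.filter_add_not (0 < ·) (specR A)]
  rw [Multiset.map_add, Multiset.sum_add, add_eq_left]
  refine Multiset.sum_eq_zero fun y hy => ?_
  obtain ⟨x, hx, rfl⟩ := Multiset.mem_map.1 hy
  exact hf0 x (not_lt.1 (Multiset.mem_filter.1 hx).2)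

lemma trF_half_chain_le (b : Fin L → Matrix ι ι ℂ) (hb : ∀ k, (b k).PosSemidef) :
    trF (fun x => (max x 0) ^ (1 / 2 : ℝ)) (chain b) ≤ 1 / 2 * ∑ k, (b k).trace.re := by
  choose β hβ using fun k => exists_factor (hb k)
  obtain rfl : b = fun k => (β k)ᴴ * β k := funext hβ
  set A := chain fun k => (β k)ᴴ * β k
  set s := (specR A).filter (0 < ·) with hs
  have hmain : (s.map fun e => Real.sqrt (e ^ 2 + 4 * e)).sum ≤ ∑ k, ((β k)ᴴ * β k).trace.re := by
    have key := sum_le_of_family (T := fun e t => trF (fun x => max (x - t) 0) (bsOp β (jou e)))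
      (c := fun e t => cnt (bsOp β (jou e)) t) (g := fun e => Real.sqrt (e ^ 2 + 4 * e))
      (fun e _ => Real.sqrt_nonneg _)
      (fun e he t => by
        change 0 ≤ trF _ _
        rw [trF_eq (bsOp_posSemidef β (jou_pos e).le (jou_le_one he.le)).1]
        exact Finset.sum_nonneg fun _ _ => le_max_right _ _)
      (fun e e' t he hee => trF_bsOp_mono β (jou_pos _).le (jou_anti he.le hee) (jou_pos _)
        (jou_le_one he.le) t)
      (fun e he t u htu => trF_slab (bsOp_posSemidef β (jou_pos e).le (jou_le_one he.le)).1 htu)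
      s.card s rfl (fun e he => (Multiset.mem_filter.1 he).2)
      (fun e he => by
        have he0 : 0 < e := (Multiset.mem_filter.1 he).2
        have h := cnt_chain_le_bsOp β (jou_pos e) (jou_lt_one he0)
        rw [jou_add he0.le, jou_sub he0.le] at h
        refine le_trans (Multiset.card_le_card ?_) h
        exact Multiset.filter_le_filter _ (Multiset.filter_le _ _))
    have hex : ∃ e > 0, ∀ e' ∈ s, e ≤ e' := by
      by_cases hne : s.toFinset.Nonempty
      · obtain ⟨a, ha, hmin⟩ := s.toFinset.exists_min_image id hne
        exact ⟨a, (Multiset.mem_filter.1 (Multiset.mem_toFinset.1 ha)).2,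
          fun x hx => hmin x (Multiset.mem_toFinset.2 hx)⟩
      · rw [Multiset.toFinset_nonempty, not_not] at hne
        exact ⟨1, one_pos, by simp [hne]⟩
    obtain ⟨e, he, hee⟩ := hex
    have := key e he hee 0 le_rfl
    rwa [mul_zero, zero_add, trF_bsOp_zero β (jou_pos e).le (jou_le_one he.le)] at this
  rw [trF_eq_filter (posPow_of_nonpos (by norm_num)), ← hs]
  have h2 : (s.map fun x => (max x 0) ^ (1 / 2 : ℝ)).sum ≤
      (s.map fun e => 1 / 2 * Real.sqrt (e ^ 2 + 4 * e)).sum := by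
    refine Multiset.sum_map_le_sum_map _ _ fun e he => ?_
    have he0 : 0 < e := (Multiset.mem_filter.1 he).2
    rw [max_eq_left he0.le, ← Real.sqrt_eq_rpow]
    have : 2 * Real.sqrt e ≤ Real.sqrt (e ^ 2 + 4 * e) := by
      refine Real.le_sqrt_of_sq_le ?_
      rw [mul_pow, Real.sq_sqrt he0.le]; nlinarith
    linarith
  refine h2.trans ?_
  rw [Multiset.sum_map_mul_left]
  linarith

end

section spectralPowers
variable {n : Type*} [Fintype n] [DecidableEq n]
open Polynomial

lemma eval_charpoly_eq_prod (M : Matrix n n ℂ) (x : ℂ) :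
    M.charpoly.eval x = (M.charpoly.roots.map fun η => x - η).prod := by
  conv_lhs => rw [(IsAlgClosed.splits M.charpoly).eq_prod_roots_of_monic M.charpoly_monic]
  rw [eval_multiset_prod, Multiset.map_map]
  simp

lemma card_roots_charpoly (M : Matrix n n ℂ) : M.charpoly.roots.card = Fintype.card n := by
  rw [← M.charpoly_natDegree_eq_dim]
  exact (splits_iff_card_roots.1 (IsAlgClosed.splits _))

lemma det_aeval_prod (M : Matrix n n ℂ) (s : Multiset ℂ) :
    (aeval M (s.map fun a => X - C a).prod).det =
      (M.charpoly.roots.map fun η => ((s.map fun a => X - C a).prod).eval η).prod := by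
  induction s using Multiset.induction_on with
  | empty => simp
  | cons a s ih =>
    simp only [Multiset.map_cons, Multiset.prod_cons, map_mul, det_mul, ih, eval_mul,
      Multiset.prod_map_mul]
    congr 1
    have h1 : (aeval M) (X - C a) = -(scalar n a - M) := by
      simp [Matrix.algebraMap_eq_diagonal, Matrix.scalar_apply]
    rw [h1, det_neg, ← eval_charpoly, eval_charpoly_eq_prod, ← card_roots_charpoly M,
      show (-1 : ℂ) ^ M.charpoly.roots.card = (M.charpoly.roots.map fun _ => (-1 : ℂ)).prod by
        rw [Multiset.map_const', Multiset.prod_replicate], ← Multiset.prod_map_mul]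
    simp

lemma det_aeval (M : Matrix n n ℂ) (g : ℂ[X]) :
    (aeval M g).det = (M.charpoly.roots.map fun η => g.eval η).prod := by
  have h := (IsAlgClosed.splits g).eq_prod_roots
  rw [h, map_mul, aeval_C, ← Algebra.smul_def, det_smul, det_aeval_prod]
  simp only [eval_mul, eval_C, Multiset.prod_map_mul]
  rw [Multiset.map_const', Multiset.prod_replicate, card_roots_charpoly]

lemma trace_pow_eq (M : Matrix n n ℂ) (k : ℕ) :
    (M ^ k).trace = (M.charpoly.roots.map fun η => η ^ k).sum := by
  have h : (M ^ k).charpoly =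
      ((M.charpoly.roots.map fun η => η ^ k).map fun a => X - C a).prod := by
    refine Polynomial.funext fun x => ?_
    have h1 := det_aeval M (C x - X ^ k)
    rw [eval_charpoly]
    have h2 : scalar n x - M ^ k = aeval M (C x - X ^ k) := by
      simp [Matrix.algebraMap_eq_diagonal, Matrix.scalar_apply]
    rw [h2, h1, eval_multiset_prod, Multiset.map_map, Multiset.map_map]
    simp
  rw [trace_eq_sum_roots_charpoly, h, roots_multiset_prod_X_sub_C]

lemma det_one_sub_smul (M : Matrix n n ℂ) (z : ℂ) :
    (1 - z • M).det = (M.charpoly.roots.map fun η => 1 - z * η).prod := by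
  have h := det_aeval M (1 - C z * X)
  simpa [Algebra.smul_def] using h

end spectralPowers

section accretive
variable {n : Type*} [Fintype n] [DecidableEq n]

lemma one_le_norm_sub_I (x : ℝ) : 1 ≤ ‖(x : ℂ) - Complex.I‖ := by
  have := Complex.abs_im_le_norm ((x : ℂ) - Complex.I)
  simpa using this

lemma det_le_norm_det_sub {A P : Matrix n n ℂ} (hA : A.IsHermitian) (hP : P.PosDef) :
    P.det.re ≤ ‖(A - Complex.I • P).det‖ := by
  obtain ⟨B, hB⟩ := exists_factor hP.posSemidef
  have hdet : P.det = (Complex.normSq B.det : ℂ) := by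
    rw [hB, det_mul, det_conjTranspose, Complex.normSq_eq_conj_mul_self]; rfl
  have hB0 : IsUnit B.det := by
    rw [isUnit_iff_ne_zero]
    intro h0
    have := hP.det_pos
    rw [hdet, h0] at this
    simp at this
  set A' := (B⁻¹)ᴴ * A * B⁻¹ with hA'
  have hA'h : A'.IsHermitian := isHermitian_conjTranspose_mul_mul _ hA
  have h1 : A - Complex.I • P = Bᴴ * (A' - Complex.I • 1) * B := by
    rw [mul_sub, sub_mul, hA', ← mul_assoc, ← mul_assoc, ← conjTranspose_mul,
      nonsing_inv_mul _ hB0, mul_assoc _ B⁻¹, nonsing_inv_mul _ hB0, hB]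
    simp
  have h2 : (A' - Complex.I • 1).det = ((-1) ^ Fintype.card n) *
      ∏ i, (Complex.I - (hA'h.eigenvalues i : ℂ)) := by
    have := eval_charpoly A' Complex.I
    rw [hA'h.charpoly_eq, Polynomial.eval_prod] at this
    rw [show A' - Complex.I • 1 = -(scalar n Complex.I - A') by
      rw [neg_sub, smul_one_eq_diagonal]; rfl, det_neg, ← this]
    simp
  rw [h1, det_mul, det_mul, det_conjTranspose, hdet, Complex.ofReal_re, norm_mul, norm_mul,
    norm_star, h2, norm_mul, norm_prod, Complex.normSq_eq_norm_sq]
  have h3 : 1 ≤ ∏ i, ‖Complex.I - (hA'h.eigenvalues i : ℂ)‖ :=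
    Finset.one_le_prod fun i _ => by rw [norm_sub_rev]; exact one_le_norm_sub_I _
  have h4 : ‖((-1 : ℂ)) ^ Fintype.card n‖ = 1 := by simp
  rw [h4, one_mul]
  nlinarith [mul_le_mul_of_nonneg_left h3 (sq_nonneg ‖B.det‖)]

lemma det_re_eq_prod {A : Matrix n n ℂ} (hA : A.IsHermitian) :
    A.det.re = ∏ i, hA.eigenvalues i := by
  rw [hA.det_eq_prod_eigenvalues]
  rw [← Complex.ofReal_re (∏ i, hA.eigenvalues i)]
  push_cast; rfl

lemma det_add_sq_ge {P : Matrix n n ℂ} (hP : P.PosDef) {s : ℝ} (hs : 0 < s) :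
    ((4 * s) ^ Fintype.card n) * P.det.re ≤ (P + s • (1 : Matrix n n ℂ)).det.re ^ 2 := by
  have h : (P + s • (1 : Matrix n n ℂ)).det = ((∏ i, (hP.1.eigenvalues i + s) : ℝ) : ℂ) := by
    have := eval_charpoly P (-s : ℂ)
    rw [hP.1.charpoly_eq, Polynomial.eval_prod] at this
    rw [show P + s • (1 : Matrix n n ℂ) = -(scalar n (-s : ℂ) - P) by
      ext i j; simp [Matrix.scalar_apply, diagonal_apply, one_apply]; split_ifs <;> simp, det_neg, ← this]
    simp only [Polynomial.eval_sub, Polynomial.eval_X, Polynomial.eval_C]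
    rw [← Finset.card_univ, ← Finset.prod_const, ← Finset.prod_mul_distrib]
    push_cast
    refine Finset.prod_congr rfl fun i _ => ?_
    simp only [RCLike.ofReal, Complex.coe_algebraMap]
    ring
  rw [h, Complex.ofReal_re, det_re_eq_prod hP.1, ← Finset.card_univ, ← Finset.prod_const,
    ← Finset.prod_mul_distrib, ← Finset.prod_pow]
  refine Finset.prod_le_prod (fun i _ => ?_) fun i _ => ?_
  · have := hP.eigenvalues_pos i; positivity
  · nlinarith [sq_nonneg (hP.1.eigenvalues i - s)]

end accretive

section elimination
variable {ι : Type*} [Fintype ι] [DecidableEq ι] {L : ℕ}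

/-- Block tridiagonal matrix with diagonal blocks `c` and off-diagonal blocks `-1`. -/
noncomputable def blockTri (c : Fin L → Matrix ι ι ℂ) : Matrix (ι × Fin L) (ι × Fin L) ℂ :=
  blockDiagonal c - ten ι (pathJ L)

/-- Splitting off the first site. -/
def firstSite (ι : Type*) (L : ℕ) : ι ⊕ ι × Fin L ≃ ι × Fin (L + 1) where
  toFun := Sum.elim (fun i => (i, 0)) (fun p => (p.1, p.2.succ))
  invFun p := Fin.cases (Sum.inl p.1) (fun k => Sum.inr (p.1, k)) p.2
  left_inv := by rintro (i | ⟨i, k⟩) <;> rfl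
  right_inv := by
    rintro ⟨i, k⟩
    refine Fin.cases ?_ (fun k => ?_) k <;> rfl

/-- The coupling of the first site to the second one. -/
noncomputable def coupling (ι : Type*) [DecidableEq ι] (L : ℕ) : Matrix ι (ι × Fin L) ℂ :=
  of fun i p => if i = p.1 ∧ (p.2 : ℕ) = 0 then -1 else 0

lemma ten_apply (X : Matrix (Fin L) (Fin L) ℂ) (p q : ι × Fin L) :
    ten ι X p q = if p.1 = q.1 then X p.2 q.2 else 0 := by
  simp [ten, one_apply]

lemma pathJ_apply (i j : Fin L) :
    pathJ L i j = if (i : ℕ) + 1 = j ∨ (j : ℕ) + 1 = i then 1 else 0 := by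
  simp only [pathJ, shiftM, Matrix.add_apply, conjTranspose_apply, of_apply]
  split_ifs <;> first | (exfalso; omega) | simp

lemma blockTri_submatrix (c : Fin (L + 1) → Matrix ι ι ℂ) :
    (blockTri c).submatrix (firstSite ι L) (firstSite ι L) =
      fromBlocks (c 0) (coupling ι L) (coupling ι L)ᵀ (blockTri fun k => c k.succ) := by
  ext (i | ⟨i, k⟩) (j | ⟨j, l⟩)
  · simp [blockTri, firstSite, blockDiagonal_apply, ten_apply, pathJ_apply]
  · simp only [blockTri, firstSite, blockDiagonal_apply, ten_apply, pathJ_apply, coupling,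
      submatrix_apply, fromBlocks_apply₁₂, Matrix.sub_apply, of_apply, Equiv.coe_fn_mk, Sum.elim_inl,
      Sum.elim_inr, Fin.val_succ, Fin.coe_ofNat_eq_mod, Nat.zero_mod]
    rw [if_neg (Fin.succ_ne_zero _).symm, ite_and]
    by_cases h : i = j <;> by_cases h' : (l : ℕ) = 0 <;> simp [h, h'] <;> omega
  · simp only [blockTri, firstSite, blockDiagonal_apply, ten_apply, pathJ_apply, coupling,
      submatrix_apply, fromBlocks_apply₂₁, Matrix.sub_apply, of_apply, Equiv.coe_fn_mk, Sum.elim_inl,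
      Sum.elim_inr, Fin.val_succ, Fin.coe_ofNat_eq_mod, Nat.zero_mod, transpose_apply]
    rw [if_neg (Fin.succ_ne_zero _), ite_and]
    by_cases h : j = i <;> by_cases h' : (k : ℕ) = 0 <;> simp [h, h', Ne.symm] <;> first | omega | (intro e; exact absurd e.symm h) | skip
  · simp [blockTri, firstSite, blockDiagonal_apply, ten_apply, pathJ_apply]

lemma coupling_mul (X : Matrix ι ι ℂ) :
    (coupling ι L)ᵀ * X * coupling ι L =
      blockDiagonal fun k : Fin L => if (k : ℕ) = 0 then X else 0 := by
  ext ⟨i, k⟩ ⟨j, l⟩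
  simp only [mul_apply, transpose_apply, coupling, of_apply, blockDiagonal_apply, ite_and]
  by_cases h : (k : ℕ) = 0 <;> by_cases h' : (l : ℕ) = 0
  · have : k = l := Fin.ext (by omega)
    simp [h, h', this]
  · have : k ≠ l := fun e => by subst e; omega
    simp [h, h', this]
  · have : k ≠ l := fun e => by subst e; omega
    simp [h, h', this]
  · simp [h, h']

lemma det_blockTri_succ (c : Fin (L + 1) → Matrix ι ι ℂ) (h : IsUnit (c 0).det) :
    (blockTri c).det = (c 0).det *
      (blockTri fun k : Fin L => c k.succ - if (k : ℕ) = 0 then (c 0)⁻¹ else 0).det := by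
  letI := (c 0).invertibleOfIsUnitDet h
  rw [← det_submatrix_equiv_self (firstSite ι L), blockTri_submatrix, det_fromBlocks₁₁,
    invOf_eq_nonsing_inv, coupling_mul]
  congr 2
  simp only [blockTri]
  rw [sub_right_comm, ← blockDiagonal_sub]
  rfl

lemma norm_det_blockTri_ge {s : ℝ} (hs : 0 < s) : ∀ (L : ℕ) (h : Fin (L + 1) → Matrix ι ι ℂ)
    (_ : ∀ k, (h k).IsHermitian) (P : Matrix ι ι ℂ) (_ : P.PosDef),
    ((4 * s) ^ Fintype.card ι) * P.det.re ≤ ‖(blockTri fun k => h k -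
      (if (k : ℕ) = 0 then Complex.I • P else 0) -
      if (k : ℕ) = L then (Complex.I * s) • (1 : Matrix ι ι ℂ) else 0).det‖ ^ 2
  | 0, h, hh, P, hP => by
    have hP' : (P + s • (1 : Matrix ι ι ℂ)).PosDef := hP.add (PosDef.one.smul hs)
    have h1 := det_add_sq_ge hP hs
    have h2 := det_le_norm_det_sub (hh 0) hP'
    have h0 : 0 ≤ (P + s • (1 : Matrix ι ι ℂ)).det.re := (Complex.lt_def.1 hP'.det_pos).1.le
    refine h1.trans (pow_le_pow_left₀ h0 (h2.trans_eq ?_) 2)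
    rw [← det_submatrix_equiv_self (Equiv.prodUnique ι (Fin 1)).symm (blockTri _)]
    congr 2
    ext i j
    simp [blockTri, blockDiagonal_apply, ten_apply, pathJ_apply, smul_add]
    by_cases hij : i = j <;> simp [hij] <;> ring
  | L + 1, h, hh, P, hP => by
    have hdet := det_le_norm_det_sub (hh 0) hP
    have hpos : 0 < P.det.re := (Complex.lt_def.1 hP.det_pos).1
    set Z := h 0 - Complex.I • P with hZ
    have hZu : IsUnit Z.det := isUnit_iff_ne_zero.2 (norm_pos_iff.1 (hpos.trans_le hdet))
    have hZu' : IsUnit Zᴴ.det := by rw [det_conjTranspose]; exact hZu.star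
    have hZi : Z⁻¹ = Z⁻¹ * h 0 * (Z⁻¹)ᴴ + Complex.I • (Z⁻¹ * P * (Z⁻¹)ᴴ) := by
      have : Zᴴ = h 0 + Complex.I • P := by
        rw [hZ, conjTranspose_sub, conjTranspose_smul, (hh 0).eq, hP.1.eq]; simp
      rw [← smul_mul_assoc, ← mul_smul_comm, ← add_mul, ← mul_add, ← this,
        conjTranspose_nonsing_inv, mul_assoc, mul_nonsing_inv _ hZu', mul_one]
    have hP' : (Z⁻¹ * P * (Z⁻¹)ᴴ).PosDef := by
      have := hP.conjTranspose_mul_mul_same (B := (Z⁻¹)ᴴ) (by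
        refine mulVec_injective_of_isUnit ?_
        rw [isUnit_iff_isUnit_det, det_conjTranspose]
        exact ((isUnit_nonsing_inv_det_iff).2 hZu).star)
      rwa [conjTranspose_conjTranspose] at this
    have hP'd : (Z⁻¹ * P * (Z⁻¹)ᴴ).det.re * ‖Z.det‖ ^ 2 = P.det.re := by
      rw [det_mul, det_mul, det_conjTranspose, det_nonsing_inv, Ring.inverse_eq_inv']
      have h1 : Z.det⁻¹ * P.det * star Z.det⁻¹ =
          ((‖Z.det‖ ^ 2)⁻¹ : ℝ) * P.det := by
        rw [mul_right_comm, RCLike.star_def, Complex.mul_conj, Complex.normSq_eq_norm_sq, norm_inv,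
          inv_pow]
      rw [h1, Complex.re_ofReal_mul]
      have : ‖Z.det‖ ≠ 0 := norm_ne_zero_iff.2 hZu.ne_zero
      field_simp
    have ih := norm_det_blockTri_ge hs L
      (fun k => h k.succ - if (k : ℕ) = 0 then Z⁻¹ * h 0 * (Z⁻¹)ᴴ else 0) (fun k => by
        refine (hh _).sub ?_
        split_ifs
        · have := isHermitian_conjTranspose_mul_mul (Z⁻¹)ᴴ (hh 0)
          rwa [conjTranspose_conjTranspose] at this
        · exact isHermitian_zero) _ hP'
    rw [det_blockTri_succ _ (by simpa [hZ] using hZu), norm_mul, mul_pow ‖_‖ ‖_‖, ← hP'd]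
    have h3 := mul_le_mul_of_nonneg_right ih (sq_nonneg ‖Z.det‖)
    rw [mul_assoc] at h3
    refine h3.trans_eq ?_
    rw [mul_comm]
    congr 3
    · simp [hZ]
    · congr 2
      funext k
      rw [if_neg (show ¬((0 : Fin (L + 2)) : ℕ) = L + 1 by simp), sub_zero,
        if_pos (show ((0 : Fin (L + 2)) : ℕ) = 0 by simp), ← hZ]
      simp only [Fin.val_succ, Nat.add_right_cancel_iff, Nat.succ_ne_zero,
        if_false, sub_zero]
      split_ifs with h0 h1 h1
      · conv_rhs => rw [hZi]
        abel
      · conv_rhs => rw [hZi]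
        abel
      · abel
      · abel

end elimination

section companion
variable {ι : Type*} [Fintype ι] [DecidableEq ι] {L : ℕ}

/-- The degree of a vertex in the path, minus one. -/
def endDeg (L : ℕ) (k : Fin L) : ℝ :=
  1 - (if (k : ℕ) = 0 then 1 else 0) - (if (k : ℕ) + 1 = L then 1 else 0)

/-- The diagonal matrix of `endDeg`. -/
noncomputable def endM (L : ℕ) : Matrix (Fin L) (Fin L) ℂ := diagonal fun k => (endDeg L k : ℂ)

/-- Block Jacobi matrix. -/
noncomputable def jacobi (b : Fin L → Matrix ι ι ℂ) : Matrix (ι × Fin L) (ι × Fin L) ℂ :=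
  ten ι (pathJ L) + blockDiagonal b

/-- Linearization of the quadratic pencil `1 - z J + z² C`. -/
noncomputable def companion (b : Fin L → Matrix ι ι ℂ) :
    Matrix ((ι × Fin L) ⊕ (ι × Fin L)) ((ι × Fin L) ⊕ (ι × Fin L)) ℂ :=
  fromBlocks (jacobi b) (-ten ι (endM L)) 1 0

lemma ten_diagonal (f : Fin L → ℂ) :
    ten ι (diagonal f) = blockDiagonal fun k => f k • (1 : Matrix ι ι ℂ) := by
  ext ⟨i, k⟩ ⟨j, l⟩
  simp only [ten_apply, diagonal_apply, blockDiagonal_apply, Matrix.smul_apply, one_apply]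
  by_cases h : i = j <;> by_cases h' : k = l <;> simp [h, h']

lemma det_one_sub_companion (b : Fin L → Matrix ι ι ℂ) (z : ℂ) :
    (1 - z • companion b).det = (1 - z • jacobi b + z ^ 2 • ten ι (endM L)).det := by
  have : 1 - z • companion b = fromBlocks (1 - z • jacobi b) (z • ten ι (endM L)) (-(z • 1)) 1 := by
    rw [companion, fromBlocks_smul, ← fromBlocks_one, sub_eq_add_neg, fromBlocks_neg,
      fromBlocks_add]
    congr 1 <;> simp [sub_eq_add_neg]
  rw [this, det_fromBlocks_one₂₂]
  congr 1
  simp [smul_smul, pow_two]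

/-- The pencil on the unit circle. -/
noncomputable def circlePencil (b : Fin L → Matrix ι ι ℂ) (z : ℂ) :
    Matrix (ι × Fin L) (ι × Fin L) ℂ :=
  blockTri fun k => (star z + z * endDeg L k) • (1 : Matrix ι ι ℂ) - b k

lemma circlePencil_eq (b : Fin L → Matrix ι ι ℂ) (z : ℂ) :
    circlePencil b z = star z • 1 - jacobi b + z • ten ι (endM L) := by
  have h : (blockDiagonal fun k => (star z + z * endDeg L k) • (1 : Matrix ι ι ℂ)) =
      star z • 1 + z • ten ι (endM L) := by
    rw [endM, ten_diagonal, ← blockDiagonal_one, ← blockDiagonal_smul, ← blockDiagonal_smul,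
      ← blockDiagonal_add]
    congr 1
    funext k
    simp only [add_smul, mul_smul, Pi.add_apply, Pi.smul_apply, Pi.one_apply]
  rw [circlePencil, blockTri, jacobi]
  have h2 := blockDiagonal_sub (fun k => (star z + z * endDeg L k) • (1 : Matrix ι ι ℂ)) b
  rw [h] at h2
  rw [← Pi.sub_def, h2]
  abel

lemma norm_det_companion (b : Fin L → Matrix ι ι ℂ) {z : ℂ} (hz : ‖z‖ = 1) :
    ‖(1 - z • companion b).det‖ = ‖(circlePencil b z).det‖ := by
  have hzz : z * star z = 1 := by
    rw [RCLike.star_def, Complex.mul_conj, Complex.normSq_eq_norm_sq, hz]; simp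
  have : 1 - z • jacobi b + z ^ 2 • ten ι (endM L) = z • circlePencil b z := by
    rw [circlePencil_eq, smul_add, smul_sub, smul_smul, smul_smul, hzz, one_smul, pow_two]
  rw [det_one_sub_companion, this, det_smul, norm_mul, norm_pow, hz, one_pow, one_mul]

lemma circlePencil_conjTranspose {b : Fin L → Matrix ι ι ℂ} (hb : ∀ k, (b k).IsHermitian) (z : ℂ)
    (hz : ‖z‖ = 1) : ‖(circlePencil b (star z)).det‖ = ‖(circlePencil b z).det‖ := by
  have hzz : star z * z = 1 := by
    rw [mul_comm, RCLike.star_def, Complex.mul_conj, Complex.normSq_eq_norm_sq, hz]; simp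
  have hzz' : z * star z = 1 := by rw [mul_comm]; exact hzz
  rw [← norm_star (circlePencil b z).det, ← det_conjTranspose]
  congr 2
  rw [circlePencil_eq, circlePencil_eq, conjTranspose_add, conjTranspose_sub, conjTranspose_smul,
    conjTranspose_smul, jacobi, conjTranspose_add, (isHermitian_ten isHermitian_pathJ).eq,
    (isHermitian_blockDiagonal hb).eq, (isHermitian_ten (X := endM L) ?_).eq]
  · simp
  · rw [IsHermitian, endM, diagonal_conjTranspose]
    congr 1; ext k; simp

lemma norm_det_circlePencil_ge_of_pos {b : Fin (L + 1) → Matrix ι ι ℂ}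
    (hb : ∀ k, (b k).IsHermitian) {z : ℂ} (hz : 0 < z.im) :
    (2 * z.im) ^ Fintype.card ι ≤ ‖(circlePencil b z).det‖ := by
  have hr : ∀ r : ℝ, (r • (1 : Matrix ι ι ℂ)).IsHermitian := fun r => by
    rw [IsHermitian, conjTranspose_smul]; simp
  have h := norm_det_blockTri_ge hz L (fun k => (2 * z.re - (if (k : ℕ) = 0 then z.re else 0) -
    (if (k : ℕ) = L then z.re else 0)) • (1 : Matrix ι ι ℂ) - b k)
    (fun k => (hr _).sub (hb k)) (z.im • 1) (PosDef.one.smul hz)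
  have h2 : (circlePencil b z) = blockTri fun k => (2 * z.re - (if (k : ℕ) = 0 then z.re else 0) -
    (if (k : ℕ) = L then z.re else 0)) • (1 : Matrix ι ι ℂ) - b k -
    (if (k : ℕ) = 0 then Complex.I • (z.im • (1 : Matrix ι ι ℂ)) else 0) -
    (if (k : ℕ) = L then (Complex.I * z.im) • (1 : Matrix ι ι ℂ) else 0) := by
    rw [circlePencil]
    congr 1
    funext k
    have hz' : z = z.re + z.im * Complex.I := (Complex.re_add_im z).symm
    have hsz : star z = z.re - z.im * Complex.I := by
      apply Complex.ext <;> simp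
    have e : ∀ r : ℝ, r • (1 : Matrix ι ι ℂ) = (r : ℂ) • 1 := fun r => (Complex.coe_smul r _).symm
    rw [e, e, smul_smul, hsz, endDeg]
    nth_rewrite 3 [hz']
    simp only [Nat.add_right_cancel_iff]
    split_ifs <;> push_cast <;> module
  have hd : (z.im • (1 : Matrix ι ι ℂ)).det.re = z.im ^ Fintype.card ι := by
    rw [← Complex.coe_smul, det_smul, det_one, mul_one, ← Complex.ofReal_pow, Complex.ofReal_re]
  rw [← h2, hd] at h
  refine le_of_sq_le_sq ?_ (norm_nonneg _)
  refine le_trans (le_of_eq ?_) h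
  rw [← mul_pow, ← pow_mul, mul_comm _ 2, pow_mul]
  congr 1; ring

lemma norm_det_companion_ge {b : Fin (L + 1) → Matrix ι ι ℂ}
    (hb : ∀ k, (b k).IsHermitian) {z : ℂ} (hz : ‖z‖ = 1) (hi : z.im ≠ 0) :
    ‖1 - z ^ 2‖ ^ Fintype.card ι ≤ ‖(1 - z • companion b).det‖ := by
  have h0 : ‖1 - z ^ 2‖ = 2 * |z.im| := by
    have h1 : 1 - z ^ 2 = z * (-(2 * z.im) * Complex.I) := by
      have hzz : z * star z = 1 := by
        rw [RCLike.star_def, Complex.mul_conj, Complex.normSq_eq_norm_sq, hz]; simp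
      rw [← hzz, pow_two, ← mul_sub]
      congr 1
      apply Complex.ext <;> simp; ring
    rw [h1, norm_mul, hz, norm_mul, norm_neg, norm_mul]; simp
  rw [h0, norm_det_companion b hz]
  rcases lt_or_gt_of_ne hi with h | h
  · rw [← circlePencil_conjTranspose hb z hz, abs_of_neg h]
    have := norm_det_circlePencil_ge_of_pos hb (z := star z) (by simpa using h)
    simpa using this
  · rw [abs_of_pos h]
    exact norm_det_circlePencil_ge_of_pos hb h

end companion

section traces
variable {ι : Type*} [Fintype ι] [DecidableEq ι] {L : ℕ}

lemma trace_ten_mul_blockDiagonal (X : Matrix (Fin L) (Fin L) ℂ) (b : Fin L → Matrix ι ι ℂ) :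
    (ten ι X * blockDiagonal b).trace = ∑ k, X k k * (b k).trace := by
  simp only [trace, diag_apply, mul_apply, Fintype.sum_prod_type, ten_apply, blockDiagonal_apply,
    ite_mul, zero_mul, mul_ite, mul_zero]
  simp only [Finset.sum_ite_eq, Finset.mem_univ, if_true, Finset.sum_ite_eq',
    Finset.sum_ite_irrel, Finset.sum_const_zero]
  rw [Finset.sum_comm]
  simp [Finset.mul_sum]

lemma trace_ten (X : Matrix (Fin L) (Fin L) ℂ) :
    (ten ι X).trace = Fintype.card ι * X.trace := by
  rw [ten, trace_kronecker, trace_one]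

lemma pathJ_diag (k : Fin L) : pathJ L k k = 0 := by
  rw [pathJ_apply, if_neg (by omega)]

lemma pathJ_mul_self_diag (k : Fin L) : (pathJ L * pathJ L) k k = (endDeg L k : ℂ) + 1 := by
  have h1 : (shiftM L * shiftM L) k k = 0 := by
    rw [mul_apply]
    refine Finset.sum_eq_zero fun j _ => ?_
    simp only [shiftM, of_apply]
    by_cases h : (k : ℕ) + 1 = j
    · rw [if_neg (show ¬ ((j : ℕ) + 1 = k) by omega), mul_zero]
    · rw [if_neg h, zero_mul]
  have h2 : ((shiftM L)ᴴ * (shiftM L)ᴴ) k k = 0 := by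
    rw [← conjTranspose_mul, conjTranspose_apply, h1, star_zero]
  have h3 : (shiftM L * (shiftM L)ᴴ) k k = if (k : ℕ) + 1 = L then 0 else 1 := by
    simp only [mul_apply, shiftM, conjTranspose_apply, of_apply]
    split_ifs with h
    · refine Finset.sum_eq_zero fun j _ => ?_
      rw [if_neg (by omega), zero_mul]
    · rw [Finset.sum_eq_single (⟨k + 1, by omega⟩ : Fin L)]
      · simp
      · intro j _ hj
        rw [if_neg (by rw [ne_eq, Fin.ext_iff] at hj; simp at hj; omega), zero_mul]
      · simp
  have h4 : ((shiftM L)ᴴ * shiftM L) k k = if (k : ℕ) = 0 then 0 else 1 := by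
    rw [shiftM_sq, diagonal_apply_eq]
  rw [pathJ, add_mul, mul_add, mul_add, Matrix.add_apply, Matrix.add_apply, Matrix.add_apply, h1,
    h2, h3, h4, endDeg]
  split_ifs <;> push_cast <;> ring

lemma trace_pathJ_pow_three : (pathJ L * pathJ L * pathJ L).trace = 0 := by
  set D : Matrix (Fin L) (Fin L) ℂ := diagonal fun k => (-1) ^ (k : ℕ)
  have hD : D * D = 1 := by
    rw [diagonal_mul_diagonal, ← diagonal_one]
    congr 1; ext k; rw [← pow_add, ← two_mul, pow_mul]; simp
  have hJ : D * pathJ L * D = -pathJ L := by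
    ext i j
    rw [mul_diagonal, diagonal_mul, Matrix.neg_apply, pathJ_apply]
    split_ifs with h
    · rcases h with h | h
      · rw [← h, mul_one, pow_succ, ← mul_assoc, ← mul_pow]; simp
      · rw [← h, mul_one, pow_succ, mul_right_comm, ← mul_pow]; simp
    · simp
  have h : D * (pathJ L * pathJ L * pathJ L) * D = -(pathJ L * pathJ L * pathJ L) := by
    calc _ = (D * pathJ L * D) * (D * pathJ L * D) * (D * pathJ L * D) := by
          have e : ∀ X Y Z : Matrix (Fin L) (Fin L) ℂ, D * X * D * (D * Y * D) * (D * Z * D) =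
              D * (X * ((D * D) * (Y * ((D * D) * Z)))) * D := fun X Y Z => by
            simp only [mul_assoc]
          rw [e, hD, one_mul, one_mul, mul_assoc (pathJ L)]
      _ = _ := by rw [hJ]; simp
  have h2 := congrArg trace h
  rw [trace_mul_cycle, hD, one_mul, trace_neg] at h2
  linear_combination h2 / 2

lemma sum_endDeg (hL : 0 < L) : ∑ k : Fin L, endDeg L k = L - 2 := by
  obtain ⟨L, rfl⟩ : ∃ L', L = L' + 1 := ⟨L - 1, by omega⟩
  simp only [endDeg, Finset.sum_sub_distrib]
  have h1 : ∑ k : Fin (L + 1), (if (k : ℕ) = 0 then (1 : ℝ) else 0) = 1 := by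
    rw [Fin.sum_univ_succ]; simp
  have h2 : ∑ k : Fin (L + 1), (if (k : ℕ) + 1 = L + 1 then (1 : ℝ) else 0) = 1 := by
    rw [Fin.sum_univ_castSucc, Finset.sum_eq_zero fun k _ => if_neg (by
      have := k.2; simp only [Fin.val_castSucc]; omega)]
    simp
  rw [h1, h2]
  simp
  ring

lemma trace_fromBlocks' {m n : Type*} [Fintype m] [Fintype n] (A : Matrix m m ℂ)
    (B : Matrix m n ℂ) (C : Matrix n m ℂ) (D : Matrix n n ℂ) :
    (fromBlocks A B C D).trace = A.trace + D.trace := by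
  simp [trace]

variable (b : Fin L → Matrix ι ι ℂ)

lemma trace_companion : (companion b).trace = ∑ k, (b k).trace := by
  rw [companion, trace_fromBlocks', jacobi, trace_add, trace_ten, trace_blockDiagonal]
  simp [trace, pathJ_diag]

lemma trace_jacobi_sq : (jacobi b * jacobi b).trace =
    Fintype.card ι * ∑ k, ((endDeg L k : ℂ) + 1) + ∑ k, (b k * b k).trace := by
  have h0 : (ten ι (pathJ L) * blockDiagonal b).trace = 0 := by
    rw [trace_ten_mul_blockDiagonal]; simp [pathJ_diag]
  rw [jacobi, add_mul, mul_add, mul_add, trace_add, trace_add, trace_add,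
    trace_mul_comm (blockDiagonal b) (ten ι _), h0, ← ten_mul, trace_ten, ← blockDiagonal_mul,
    trace_blockDiagonal]
  simp [trace, pathJ_mul_self_diag]

lemma trace_ten_endM : (ten ι (endM L)).trace = Fintype.card ι * ∑ k, (endDeg L k : ℂ) := by
  rw [trace_ten, endM, trace_diagonal]

lemma trace_companion_sq (hL : 0 < L) :
    (companion b ^ 2).trace = 2 * Fintype.card ι + ∑ k, (b k * b k).trace := by
  rw [pow_two, companion, fromBlocks_multiply, trace_fromBlocks', trace_add, trace_add, mul_one,
    one_mul, zero_mul, trace_jacobi_sq, trace_neg, trace_ten_endM, trace_zero,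
    Finset.sum_add_distrib]
  have h : ∑ k : Fin L, (endDeg L k : ℂ) = L - 2 := by
    exact_mod_cast congrArg (fun r : ℝ => (r : ℂ)) (sum_endDeg hL)
  rw [h]
  simp
  ring

lemma trace_jacobi_cube : (jacobi b * jacobi b * jacobi b).trace =
    3 * ∑ k, ((endDeg L k : ℂ) + 1) * (b k).trace + ∑ k, (b k * b k * b k).trace := by
  set T := ten ι (pathJ L) with hT
  set B := blockDiagonal b with hB
  have h1 : (T * T * T).trace = 0 := by
    rw [hT, ← ten_mul, ← ten_mul, trace_ten, trace_pathJ_pow_three, mul_zero]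
  have h2 : (T * T * B).trace = ∑ k, ((endDeg L k : ℂ) + 1) * (b k).trace := by
    rw [hT, ← ten_mul, hB, trace_ten_mul_blockDiagonal]
    simp [pathJ_mul_self_diag]
  have h3 : (T * (B * B)).trace = 0 := by
    rw [hB, ← blockDiagonal_mul, hT, trace_ten_mul_blockDiagonal]; simp [pathJ_diag]
  have h4 : (B * B * B).trace = ∑ k, (b k * b k * b k).trace := by
    rw [hB, ← blockDiagonal_mul, ← blockDiagonal_mul, trace_blockDiagonal]
  have e : (jacobi b * jacobi b * jacobi b).trace = (T * T * T).trace + 3 * (T * T * B).trace +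
      3 * (T * (B * B)).trace + (B * B * B).trace := by
    have e1 : (T * B * T).trace = (T * T * B).trace := by rw [trace_mul_cycle]
    have e2 : (B * T * T).trace = (T * T * B).trace := by rw [mul_assoc, trace_mul_comm]
    have e3 : (T * B * B).trace = (T * (B * B)).trace := by rw [mul_assoc]
    have e4 : (B * T * B).trace = (T * (B * B)).trace := by rw [trace_mul_cycle, trace_mul_comm]
    have e5 : (B * B * T).trace = (T * (B * B)).trace := by rw [trace_mul_comm]
    simp only [jacobi, ← hT, ← hB, add_mul, mul_add, trace_add, e1, e2, e3, e4, e5]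
    ring
  rw [e, h1, h2, h3, h4]
  ring

lemma trace_jacobi_mul_endM : (jacobi b * ten ι (endM L)).trace =
    ∑ k, (endDeg L k : ℂ) * (b k).trace := by
  rw [jacobi, add_mul, trace_add, ← ten_mul, trace_ten, trace_mul_comm (blockDiagonal b),
    trace_ten_mul_blockDiagonal]
  simp [trace, endM, mul_diagonal, pathJ_diag]

lemma trace_companion_cube :
    (companion b ^ 3).trace = 3 * ∑ k, (b k).trace + ∑ k, (b k * b k * b k).trace := by
  set J := jacobi b with hJ
  set C := ten ι (endM L) with hC
  have e : (companion b ^ 3).trace = (J * J * J).trace - 3 * (J * C).trace := by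
    rw [pow_succ, pow_two, companion, fromBlocks_multiply, fromBlocks_multiply, trace_fromBlocks',
      ← hJ, ← hC]
    simp only [mul_one, one_mul, zero_mul, mul_zero, add_zero, zero_add, neg_mul, mul_neg,
      add_mul, trace_add, trace_neg, trace_mul_comm C J]
    ring
  rw [e, hJ, hC, trace_jacobi_cube, trace_jacobi_mul_endM]
  simp only [add_mul, one_mul, Finset.sum_add_distrib]
  ring

end traces

section jensen
open Real intervalIntegral

/-- Trigonometric weight `(1 - cos² θ)(1 + cos θ)` written as a trigonometric polynomial. -/
noncomputable def wt (θ : ℝ) : ℝ := 1 / 2 + cos θ / 4 - cos (2 * θ) / 2 - cos (3 * θ) / 4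

lemma wt_nonneg (θ : ℝ) : 0 ≤ wt θ := by
  have : wt θ = (1 - cos θ ^ 2) * (1 + cos θ) := by
    rw [wt, cos_two_mul, cos_three_mul]; ring
  rw [this]
  have h1 := neg_one_le_cos θ
  have h2 := cos_le_one θ
  exact mul_nonneg (by nlinarith) (by linarith)

lemma wt_le (θ : ℝ) : wt θ ≤ 2 := by
  have : wt θ = (1 - cos θ ^ 2) * (1 + cos θ) := by
    rw [wt, cos_two_mul, cos_three_mul]; ring
  rw [this]
  have h1 := neg_one_le_cos θ
  have h2 := cos_le_one θ
  nlinarith [sq_nonneg (cos θ), mul_nonneg (sq_nonneg (cos θ)) (by linarith : 0 ≤ 1 + cos θ)]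

lemma continuous_wt : Continuous wt := by unfold wt; fun_prop

/-- Fourier coefficients of `wt`. -/
noncomputable def wtCoeff (k : ℕ) : ℂ :=
  if k = 0 then 1 / 2 else if k = 1 then 1 / 8 else if k = 2 then -1 / 4 else
  if k = 3 then -1 / 8 else 0

lemma integral_exp_int (n : ℤ) :
    ∫ θ in (0 : ℝ)..2 * π, Complex.exp (n * Complex.I * θ) = if n = 0 then 2 * (π : ℂ) else 0 := by
  split_ifs with h
  · simp [h]
  · have h0 : (n : ℂ) * Complex.I ≠ 0 := by simp [h]
    rw [integral_exp_mul_complex h0]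
    have : (n : ℂ) * Complex.I * ((2 * π : ℝ) : ℂ) = n * (2 * π * Complex.I) := by
      push_cast; ring
    rw [this, Complex.exp_int_mul_two_pi_mul_I]
    simp

lemma wt_eq_sum (θ : ℝ) : (wt θ : ℂ) =
    ∑ j ∈ Finset.Icc (-3 : ℤ) 3, wtCoeff j.natAbs * Complex.exp (j * Complex.I * θ) := by
  rw [show Finset.Icc (-3 : ℤ) 3 = {-3, -2, -1, 0, 1, 2, 3} by decide]
  simp [wtCoeff, wt, Complex.cos]
  ring_nf

lemma integral_wt_mul_exp (k : ℕ) :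
    ∫ θ in (0 : ℝ)..2 * π, (wt θ : ℂ) * Complex.exp (k * Complex.I * θ) =
      2 * π * wtCoeff k := by
  have h : ∀ θ : ℝ, (wt θ : ℂ) * Complex.exp (k * Complex.I * θ) =
      ∑ j ∈ Finset.Icc (-3 : ℤ) 3, wtCoeff j.natAbs *
        Complex.exp (((j + k : ℤ) : ℂ) * Complex.I * θ) := fun θ => by
    rw [wt_eq_sum, Finset.sum_mul]
    refine Finset.sum_congr rfl fun j _ => ?_
    rw [mul_assoc, ← Complex.exp_add]
    congr 2; push_cast; ring
  simp_rw [h]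
  rw [integral_finset_sum fun j _ => Continuous.intervalIntegrable (by fun_prop) _ _]
  simp_rw [intervalIntegral.integral_const_mul, integral_exp_int]
  simp only [mul_ite, mul_zero]
  have h2 : ∀ j : ℤ, (j + (k : ℤ) = 0) ↔ j = -k := fun j => by omega
  simp_rw [h2]
  rw [Finset.sum_ite_eq']
  split_ifs with hk
  · simp [mul_comm]
  · have : 3 < k := by simp at hk; omega
    rw [wtCoeff, if_neg (by omega), if_neg (by omega), if_neg (by omega), if_neg (by omega),
      mul_zero]

/-- The polynomial appearing in the sum rule. -/
noncomputable def sumP (η : ℂ) : ℂ := -η / 8 + η ^ 2 / 8 + η ^ 3 / 24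

lemma integral_wt_mul_log_of_lt {η : ℂ} (hη : ‖η‖ < 1) :
    ∫ θ in (0 : ℝ)..2 * π, wt θ * Real.log ‖1 - Complex.exp (Complex.I * θ) * η‖ =
      2 * π * (sumP η).re := by
  have hn : ∀ θ : ℝ, ‖Complex.exp (Complex.I * θ) * η‖ < 1 := fun θ => by
    rw [norm_mul, mul_comm Complex.I, Complex.norm_exp_ofReal_mul_I, one_mul]; exact hη
  have key : HasSum (fun k : ℕ => ∫ θ in (0 : ℝ)..2 * π,
      (wt θ : ℂ) * ((Complex.exp (Complex.I * θ) * η) ^ k / k))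
      (∫ θ in (0 : ℝ)..2 * π, (wt θ : ℂ) * -Complex.log (1 - Complex.exp (Complex.I * θ) * η)) := by
    refine hasSum_integral_of_dominated_convergence (fun k _ => 2 * ‖η‖ ^ k) (fun k => ?_)
      (fun k => ?_) ?_ ?_ ?_
    · refine Continuous.aestronglyMeasurable ?_
      have := continuous_wt
      fun_prop
    · refine Filter.Eventually.of_forall fun θ _ => ?_
      rw [norm_mul, norm_div, norm_pow, norm_mul, mul_comm Complex.I,
        Complex.norm_exp_ofReal_mul_I, one_mul, Complex.norm_real, Real.norm_of_nonneg (wt_nonneg θ)]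
      refine mul_le_mul (wt_le θ) ?_ (by positivity) (by norm_num)
      rcases Nat.eq_zero_or_pos k with rfl | hk
      · simp
      · refine div_le_self (by positivity) ?_
        exact_mod_cast hk
    · exact Filter.Eventually.of_forall fun θ _ =>
        (summable_geometric_of_lt_one (norm_nonneg _) hη).mul_left 2
    · exact intervalIntegrable_const
    · exact Filter.Eventually.of_forall fun θ _ =>
        (Complex.hasSum_taylorSeries_neg_log (hn θ)).mul_left _
  have hterm : ∀ k : ℕ, (∫ θ in (0 : ℝ)..2 * π,
      (wt θ : ℂ) * ((Complex.exp (Complex.I * θ) * η) ^ k / k)) =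
      2 * π * wtCoeff k * (η ^ k / k) := fun k => by
    rw [← integral_wt_mul_exp, ← intervalIntegral.integral_mul_const]
    refine integral_congr fun θ _ => ?_
    rw [mul_pow, ← Complex.exp_nat_mul, mul_div_assoc, mul_assoc, mul_assoc]
  simp_rw [hterm] at key
  have hfin : HasSum (fun k : ℕ => 2 * π * wtCoeff k * (η ^ k / k)) (-(2 * π * sumP η)) := by
    have := hasSum_sum_of_ne_finset_zero (L := SummationFilter.unconditional ℕ) (f := fun k : ℕ => 2 * π * wtCoeff k * (η ^ k / k))
      (s := Finset.range 4) (fun k hk => by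
        have : 3 < k := by simp at hk; omega
        rw [wtCoeff, if_neg (by omega), if_neg (by omega), if_neg (by omega), if_neg (by omega),
          mul_zero, zero_mul])
    convert this using 1
    simp [Finset.sum_range_succ, wtCoeff, sumP]
    ring
  have h := key.unique hfin
  simp only [mul_neg, intervalIntegral.integral_neg, neg_inj] at h
  have h2 := congrArg Complex.re h
  have hint : IntervalIntegrable (fun θ : ℝ =>
      (wt θ : ℂ) * Complex.log (1 - Complex.exp (Complex.I * θ) * η)) volume 0 (2 * π) := by
    refine Continuous.intervalIntegrable ?_ _ _
    refine (Complex.continuous_ofReal.comp continuous_wt).mul ?_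
    refine Continuous.clog (by fun_prop) fun θ => ?_
    refine Complex.mem_slitPlane_of_norm_lt_one (z := -(Complex.exp (Complex.I * θ) * η)) ?_
    rw [norm_neg]; exact hn θ
  have h3 := Complex.reCLM.intervalIntegral_comp_comm hint
  simp only [Complex.reCLM_apply, Complex.re_ofReal_mul, Complex.log_re] at h3
  rw [h3, h2]
  rw [show 2 * (π : ℂ) * sumP η = ((2 * π : ℝ) : ℂ) * sumP η by push_cast; ring,
    Complex.re_ofReal_mul]

lemma ae_exp_mul_ne_one (η : ℂ) :
    ∀ᵐ θ : ℝ, Complex.exp (Complex.I * θ) * η ≠ 1 := by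
  rw [ae_iff]
  refine Set.Countable.measure_zero ?_ _
  simp only [ne_eq, not_not]
  by_cases h : ∃ θ₀ : ℝ, Complex.exp (Complex.I * θ₀) * η = 1
  · obtain ⟨θ₀, h0⟩ := h
    refine (Set.countable_range fun n : ℤ => θ₀ + n * (2 * π)).mono fun θ hθ => ?_
    have hθ : Complex.exp (Complex.I * θ) * η = 1 := hθ
    have hη : η ≠ 0 := by rintro rfl; simp at hθ
    have h1 : Complex.exp (Complex.I * θ) = Complex.exp (Complex.I * θ₀) :=
      mul_right_cancel₀ hη (hθ.trans h0.symm)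
    obtain ⟨n, hn⟩ := Complex.exp_eq_exp_iff_exists_int.1 h1
    refine ⟨n, ?_⟩
    have h2 : Complex.I * (θ : ℂ) = Complex.I * ((θ₀ + n * (2 * π) : ℝ) : ℂ) := by
      rw [hn]; push_cast; ring
    exact_mod_cast (mul_left_cancel₀ Complex.I_ne_zero h2).symm
  · convert Set.countable_empty
    ext θ
    simp only [Set.mem_setOf_eq, Set.mem_empty_iff_false, iff_false]
    exact fun hθ => h ⟨θ, hθ⟩

lemma log_norm_one_sub_inv {η : ℂ} (hη : η ≠ 0) (θ : ℝ) :
    Real.log ‖1 - Complex.exp (Complex.I * θ) * η‖ =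
      Real.log (‖η‖ * ‖1 - Complex.exp (Complex.I * θ) * (starRingEnd ℂ) η⁻¹‖) := by
  congr 1
  have h1 : (starRingEnd ℂ) (Complex.exp (Complex.I * θ)) = Complex.exp (-(Complex.I * θ)) := by
    rw [← Complex.exp_conj]; simp
  have h2 : Complex.exp (Complex.I * θ) * Complex.exp (-(Complex.I * θ)) = 1 := by
    rw [← Complex.exp_add]; simp
  have h3 : ‖1 - Complex.exp (Complex.I * θ) * (starRingEnd ℂ) η⁻¹‖ =
      ‖1 - Complex.exp (-(Complex.I * θ)) * η⁻¹‖ := by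
    rw [← RCLike.norm_conj, map_sub, map_mul, map_one, h1, Complex.conj_conj]
  rw [h3, ← norm_mul]
  have h4 : η * (1 - Complex.exp (-(Complex.I * θ)) * η⁻¹) =
      -(Complex.exp (-(Complex.I * θ)) * (1 - Complex.exp (Complex.I * θ) * η)) := by
    linear_combination -η * h2 - Complex.exp (-(Complex.I * θ)) * mul_inv_cancel₀ hη
  rw [h4, norm_neg, norm_mul, show -(Complex.I * θ) = ((-θ : ℝ) : ℂ) * Complex.I by push_cast; ring,
    Complex.norm_exp_ofReal_mul_I, one_mul]

lemma intervalIntegrable_log_norm (η : ℂ) : IntervalIntegrable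
    (fun θ : ℝ => Real.log ‖1 - Complex.exp (Complex.I * θ) * η‖) volume 0 (2 * π) := by
  have h : CircleIntegrable (fun z => Real.log ‖1 - z * η‖) 0 1 :=
    MeromorphicOn.circleIntegrable_log_norm (fun z _ => by fun_prop)
  refine h.congr ?_
  intro θ _
  simp only [circleMap, zero_add, Complex.ofReal_one, one_mul, mul_comm Complex.I]

lemma intervalIntegrable_wt_mul_log_norm (η : ℂ) : IntervalIntegrable
    (fun θ : ℝ => wt θ * Real.log ‖1 - Complex.exp (Complex.I * θ) * η‖) volume 0 (2 * π) :=
  (intervalIntegrable_log_norm η).continuousOn_mul continuous_wt.continuousOn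

lemma abs_log_norm_le {u : ℂ} (hu : ‖u‖ = 1) (h1 : u ≠ 1) {r : ℝ} (hr0 : 0 ≤ r) (hr1 : r ≤ 1) :
    |Real.log ‖1 - r * u‖| ≤ |Real.log ‖1 - u‖| + Real.log 2 := by
  have hpos : 0 < ‖1 - u‖ := norm_pos_iff.2 (sub_ne_zero.2 h1.symm)
  have h2 : 1 - r ≤ ‖1 - r * u‖ := by
    have := norm_sub_norm_le (1 : ℂ) (r * u)
    rwa [norm_mul, hu, norm_one, mul_one, Complex.norm_real, Real.norm_of_nonneg hr0] at this
  have h3 : ‖1 - u‖ ≤ 2 * ‖1 - r * u‖ := by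
    have h4 : ‖1 - u‖ ≤ ‖1 - r * u‖ + ‖(r - 1) * u‖ := by
      refine (congrArg norm ?_).trans_le (norm_add_le _ _)
      ring
    rw [norm_mul, hu, mul_one, ← Complex.ofReal_one, ← Complex.ofReal_sub, Complex.norm_real,
      Real.norm_of_nonpos (by linarith)] at h4
    simp only [Complex.ofReal_one] at h4
    linarith
  have hpos' : 0 < ‖1 - r * u‖ := by linarith
  have h5 : ‖1 - r * u‖ ≤ 2 := by
    refine (norm_sub_le _ _).trans ?_
    rw [norm_mul, hu, norm_one, mul_one, Complex.norm_real, Real.norm_of_nonneg hr0]; linarith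
  rw [abs_le]
  constructor
  · have := Real.log_le_log hpos h3
    rw [Real.log_mul two_ne_zero hpos'.ne'] at this
    have := neg_abs_le (Real.log ‖1 - u‖)
    linarith
  · have := Real.log_le_log hpos' h5
    have := abs_nonneg (Real.log ‖1 - u‖)
    linarith

lemma integral_wt_mul_log_of_eq {η : ℂ} (hη : ‖η‖ = 1) :
    ∫ θ in (0 : ℝ)..2 * π, wt θ * Real.log ‖1 - Complex.exp (Complex.I * θ) * η‖ =
      2 * π * (sumP η).re := by
  have hr : Filter.Tendsto (fun n : ℕ => (1 : ℝ) - 1 / ((n : ℝ) + 1)) Filter.atTop (nhds 1) := by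
    simpa using tendsto_const_nhds.sub (tendsto_one_div_add_atTop_nhds_zero_nat (𝕜 := ℝ))
  have hr0 : ∀ n : ℕ, 0 ≤ (1 : ℝ) - 1 / ((n : ℝ) + 1) := fun n => by
    rw [sub_nonneg, div_le_one (by positivity)]; linarith [Nat.cast_nonneg (α := ℝ) n]
  have hr1 : ∀ n : ℕ, (1 : ℝ) - 1 / ((n : ℝ) + 1) < 1 := fun n => by
    have : (0 : ℝ) < 1 / ((n : ℝ) + 1) := by positivity
    linarith
  set r : ℕ → ℝ := fun n => (1 : ℝ) - 1 / ((n : ℝ) + 1) with hrdef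
  have hrc : Filter.Tendsto (fun n : ℕ => (r n : ℂ)) Filter.atTop (nhds 1) := by
    have := (Complex.continuous_ofReal.tendsto 1).comp hr
    simpa [Function.comp_def] using this
  have hnu : ∀ θ : ℝ, ‖Complex.exp (Complex.I * θ) * η‖ = 1 := fun θ => by
    rw [norm_mul, mul_comm Complex.I, Complex.norm_exp_ofReal_mul_I, one_mul]; exact hη
  have hae := ae_exp_mul_ne_one η
  have key : Filter.Tendsto (fun n : ℕ => ∫ θ in (0 : ℝ)..2 * π, wt θ *
      Real.log ‖1 - Complex.exp (Complex.I * θ) * (r n * η)‖) Filter.atTop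
      (nhds (∫ θ in (0 : ℝ)..2 * π, wt θ * Real.log ‖1 - Complex.exp (Complex.I * θ) * η‖)) := by
    refine tendsto_integral_filter_of_dominated_convergence
      (fun θ => 2 * (|Real.log ‖1 - Complex.exp (Complex.I * θ) * η‖| + Real.log 2))
      (Filter.Eventually.of_forall fun n => ?_) (Filter.Eventually.of_forall fun n => ?_) ?_ ?_
    · exact (intervalIntegrable_iff.1
        (intervalIntegrable_wt_mul_log_norm (r n * η))).aestronglyMeasurable
    · filter_upwards [hae] with θ hθ _
      rw [norm_mul, Real.norm_of_nonneg (wt_nonneg θ), Real.norm_eq_abs,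
        show Complex.exp (Complex.I * θ) * (r n * η) = r n * (Complex.exp (Complex.I * θ) * η) by
          ring]
      exact mul_le_mul (wt_le θ) (abs_log_norm_le (hnu θ) hθ (hr0 n) (hr1 n).le) (abs_nonneg _)
        (by norm_num)
    · exact ((intervalIntegrable_log_norm η).abs.add intervalIntegrable_const).const_mul 2
    · filter_upwards [hae] with θ hθ _
      have h1 : Filter.Tendsto (fun n => 1 - Complex.exp (Complex.I * θ) * (r n * η)) Filter.atTop
          (nhds (1 - Complex.exp (Complex.I * θ) * (1 * η))) :=
        tendsto_const_nhds.sub ((hrc.mul_const η).const_mul _)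
      rw [one_mul] at h1
      exact (h1.norm.log (norm_ne_zero_iff.2 (sub_ne_zero.2 hθ.symm))).const_mul _
  have h2 : ∀ n, ∫ θ in (0 : ℝ)..2 * π, wt θ *
      Real.log ‖1 - Complex.exp (Complex.I * θ) * (r n * η)‖ = 2 * π * (sumP (r n * η)).re :=
    fun n => integral_wt_mul_log_of_lt (by
      rw [norm_mul, hη, mul_one, Complex.norm_real, Real.norm_of_nonneg (hr0 n)]; exact hr1 n)
  simp_rw [h2] at key
  refine tendsto_nhds_unique key ?_
  have hc : Continuous fun z : ℂ => 2 * π * (sumP (z * η)).re := by unfold sumP; fun_prop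
  have := (hc.tendsto 1).comp hrc
  simpa [Function.comp_def] using this

/-- The weighted logarithmic average of `1 - z η` over the unit circle. -/
noncomputable def sumA (η : ℂ) : ℝ :=
  if ‖η‖ ≤ 1 then (sumP η).re else Real.log ‖η‖ / 2 + (sumP η⁻¹).re

lemma integral_wt_mul_log (η : ℂ) :
    ∫ θ in (0 : ℝ)..2 * π, wt θ * Real.log ‖1 - Complex.exp (Complex.I * θ) * η‖ =
      2 * π * sumA η := by
  rw [sumA]
  split_ifs with h
  · rcases h.lt_or_eq with h | h
    · exact integral_wt_mul_log_of_lt h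
    · exact integral_wt_mul_log_of_eq h
  · push Not at h
    have hη : η ≠ 0 := norm_pos_iff.1 (by linarith)
    have hlt : ‖(starRingEnd ℂ) η⁻¹‖ < 1 := by
      rw [RCLike.norm_conj, norm_inv]; exact inv_lt_one_of_one_lt₀ h
    have h0 : ∫ θ in (0 : ℝ)..2 * π, wt θ = 2 * π * (1 / 2) := by
      have := integral_wt_mul_exp 0
      simp only [wtCoeff, Nat.cast_zero, zero_mul, Complex.exp_zero, mul_one, if_true] at this
      rw [intervalIntegral.integral_ofReal] at this
      apply Complex.ofReal_injective
      rw [this]; push_cast; ring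
    have h1 : ∀ θ : ℝ, wt θ * Real.log ‖1 - Complex.exp (Complex.I * θ) * η‖ =
        wt θ * Real.log ‖η‖ +
        wt θ * Real.log ‖1 - Complex.exp (Complex.I * θ) * (starRingEnd ℂ) η⁻¹‖ := fun θ => by
      rw [log_norm_one_sub_inv hη, Real.log_mul (by positivity), mul_add]
      refine norm_ne_zero_iff.2 (sub_ne_zero.2 fun e => ?_)
      have := congrArg norm e
      rw [norm_mul, mul_comm Complex.I, Complex.norm_exp_ofReal_mul_I, one_mul, norm_one] at this
      linarith
    simp_rw [h1]
    rw [integral_add ((continuous_wt.intervalIntegrable _ _).mul_const _)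
      (intervalIntegrable_wt_mul_log_norm _), intervalIntegral.integral_mul_const, h0,
      integral_wt_mul_log_of_lt hlt]
    have h2 : (sumP ((starRingEnd ℂ) η⁻¹)).re = (sumP η⁻¹).re := by
      have : sumP ((starRingEnd ℂ) η⁻¹) = (starRingEnd ℂ) (sumP η⁻¹) := by
        simp [sumP, Complex.conj_ofNat]
      rw [this, Complex.conj_re]
    rw [h2]; ring

lemma sumA_one : sumA 1 = 1 / 24 := by norm_num [sumA, sumP]

lemma sumA_neg_one : sumA (-1) = 5 / 24 := by norm_num [sumA, sumP]

lemma integral_wt_mul_sum_log (R : Multiset ℂ) :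
    IntervalIntegrable (fun θ : ℝ => wt θ *
      (R.map fun η => Real.log ‖1 - Complex.exp (Complex.I * θ) * η‖).sum) volume 0 (2 * π) ∧
    ∫ θ in (0 : ℝ)..2 * π, wt θ *
      (R.map fun η => Real.log ‖1 - Complex.exp (Complex.I * θ) * η‖).sum =
      2 * π * (R.map sumA).sum := by
  induction R using Multiset.induction with
  | empty => simp
  | cons η R ih =>
    simp only [Multiset.map_cons, Multiset.sum_cons, mul_add]
    refine ⟨(intervalIntegrable_wt_mul_log_norm η).add ih.1, ?_⟩
    rw [integral_add (intervalIntegrable_wt_mul_log_norm η) ih.1, ih.2, integral_wt_mul_log]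

/-- A Jensen type inequality with trigonometric weight. -/
lemma le_sum_sumA {R : Multiset ℂ} {m : ℕ}
    (h : ∀ z : ℂ, ‖z‖ = 1 → z.im ≠ 0 →
      ‖1 - z ^ 2‖ ^ m ≤ (R.map fun η => ‖1 - z * η‖).prod) :
    (m : ℝ) / 4 ≤ (R.map sumA).sum := by
  have h1 := integral_wt_mul_sum_log (m • ({1, -1} : Multiset ℂ))
  have h2 := integral_wt_mul_sum_log R
  have key := integral_mono_ae (by positivity : (0 : ℝ) ≤ 2 * π) h1.1 h2.1 ?_
  · rw [h1.2, h2.2] at key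
    have h3 := le_of_mul_le_mul_left key (by positivity)
    rw [Multiset.map_nsmul, Multiset.sum_nsmul] at h3
    simp [sumA_one, sumA_neg_one] at h3
    linarith
  · filter_upwards [ae_exp_mul_ne_one 1, ae_exp_mul_ne_one (-1)] with θ ha hb
    refine mul_le_mul_of_nonneg_left ?_ (wt_nonneg θ)
    have hz : ‖Complex.exp (Complex.I * θ)‖ = 1 := by
      rw [mul_comm, Complex.norm_exp_ofReal_mul_I]
    set z := Complex.exp (Complex.I * θ)
    rw [mul_one] at ha
    have hb' : z ≠ -1 := fun e => hb (by rw [e]; ring)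
    have hne : 1 - z ^ 2 ≠ 0 := by
      rw [show 1 - z ^ 2 = (1 - z) * (1 + z) by ring]
      refine mul_ne_zero (sub_ne_zero.2 ha.symm) fun e => hb' ?_
      linear_combination e
    have him : z.im ≠ 0 := fun e => by
      have h4 := Complex.normSq_eq_norm_sq z
      rw [hz, Complex.normSq_apply, e] at h4
      apply hne
      have : z = (z.re : ℂ) := Complex.ext rfl (by simp [e])
      rw [this]
      have h5 : z.re ^ 2 = 1 := by nlinarith
      rw [← Complex.ofReal_pow, h5]; simp
    have hp := h z hz him
    have hpos : 0 < ‖1 - z ^ 2‖ ^ m := by positivity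
    have h6 := Real.log_le_log hpos hp
    rw [Multiset.map_nsmul, Multiset.sum_nsmul]
    have h7 : Real.log (R.map fun η => ‖1 - z * η‖).prod =
        (R.map fun η => Real.log ‖1 - z * η‖).sum := by
      have h8 : ∀ η ∈ R, ‖1 - z * η‖ ≠ 0 := fun η hη e =>
        (hpos.trans_le hp).ne' (Multiset.prod_eq_zero (Multiset.mem_map.2 ⟨η, hη, e⟩))
      clear hp h6 h1 h2 h
      induction R using Multiset.induction with
      | empty => simp
      | cons η R ih =>
        have h9 : ∀ η ∈ R, ‖1 - z * η‖ ≠ 0 := fun η hη => h8 η (Multiset.mem_cons_of_mem hη)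
        rw [Multiset.map_cons, Multiset.prod_cons, Real.log_mul (h8 η (Multiset.mem_cons_self _ _)),
          ih h9, Multiset.map_cons, Multiset.sum_cons]
        exact Multiset.prod_ne_zero fun e => by
          obtain ⟨η', h', e'⟩ := Multiset.mem_map.1 e
          exact h9 η' h' e'
    rw [h7, Real.log_pow] at h6
    refine le_trans (le_of_eq ?_) h6
    rw [show 1 - z ^ 2 = (1 - z) * (1 + z) by ring, norm_mul, Real.log_mul]
    · simp; ring
    · exact norm_ne_zero_iff.2 (sub_ne_zero.2 ha.symm)
    · exact norm_ne_zero_iff.2 fun e => hb' (by linear_combination e)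

end jensen

section scalar

lemma sinh_sum_rule_nonneg {t : ℝ} (ht : 0 ≤ t) :
    0 ≤ -(1 / 4) * Real.sinh (2 * t) + 1 / 4 * Real.sinh (4 * t) + 1 / 12 * Real.sinh (6 * t) - t -
      2 / 3 * (2 * Real.sinh t) ^ 3 := by
  set F : ℝ → ℝ := fun t => -(1 / 4) * Real.sinh (2 * t) + 1 / 4 * Real.sinh (4 * t) +
    1 / 12 * Real.sinh (6 * t) - t - 2 / 3 * (2 * Real.sinh t) ^ 3 with hF
  have hd : ∀ x : ℝ, HasDerivAt F
      (16 * Real.sinh x ^ 2 * (Real.cosh x ^ 4 - Real.cosh x)) x := fun x => by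
    have hs : ∀ a : ℝ, HasDerivAt (fun t => Real.sinh (a * t)) (Real.cosh (a * x) * a) x :=
      fun a => by
        simpa [Function.comp_def] using
          (Real.hasDerivAt_sinh (a * x)).comp x ((hasDerivAt_id x).const_mul a)
    have h := (((((hs 2).const_mul (-(1 / 4))).add ((hs 4).const_mul (1 / 4))).add
      ((hs 6).const_mul (1 / 12))).sub (hasDerivAt_id x)).sub
      ((((Real.hasDerivAt_sinh x).const_mul 2).pow 3).const_mul (2 / 3))
    refine HasDerivAt.congr_deriv (f := F) h ?_
    have e2 : Real.cosh (2 * x) = 2 * Real.cosh x ^ 2 - 1 := by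
      rw [Real.cosh_two_mul, Real.sinh_sq]; ring
    have e4 : Real.cosh (4 * x) = 2 * Real.cosh (2 * x) ^ 2 - 1 := by
      rw [show 4 * x = 2 * (2 * x) by ring, Real.cosh_two_mul, Real.sinh_sq]; ring
    have e6 : Real.cosh (6 * x) = 4 * Real.cosh (2 * x) ^ 3 - 3 * Real.cosh (2 * x) := by
      rw [show 6 * x = 3 * (2 * x) by ring, Real.cosh_three_mul]
    rw [e4, e6, e2]
    simp only [Real.sinh_sq]
    have := Real.sinh_sq x
    norm_num
    ring_nf
    simp only [Real.sinh_sq]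
    ring
  have hm : MonotoneOn F (Set.Ici 0) :=
    monotoneOn_of_hasDerivWithinAt_nonneg (convex_Ici 0)
      (fun x _ => (hd x).continuousAt.continuousWithinAt)
      (fun x _ => (hd x).hasDerivWithinAt) fun x _ => by
        have h1 := Real.one_le_cosh x
        have : Real.cosh x ≤ Real.cosh x ^ 4 := le_self_pow₀ h1 (by norm_num)
        have : 0 ≤ Real.cosh x ^ 4 - Real.cosh x := by linarith
        positivity
  have h0 : F 0 = 0 := by simp [hF]
  have := hm (Set.mem_Ici.2 le_rfl) (Set.mem_Ici.2 ht) ht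
  rwa [h0] at this

lemma rpow_le_sumP_sub_sumA {η : ℝ} (hη : 1 < η) :
    2 / 3 * (max (η + 1 / η - 2) 0) ^ (3 / 2 : ℝ) ≤ (sumP η).re - sumA η := by
  have hA : sumA η = Real.log η / 2 + (sumP (η⁻¹ : ℝ)).re := by
    have hn : ‖(η : ℂ)‖ = η := by rw [Complex.norm_real, Real.norm_of_nonneg (by linarith)]
    rw [sumA, hn, if_neg (not_le.2 hη), Complex.ofReal_inv]
  have hr : ∀ x : ℝ, (sumP x).re = -x / 8 + x ^ 2 / 8 + x ^ 3 / 24 := fun x => by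
    have : sumP x = ((-x / 8 + x ^ 2 / 8 + x ^ 3 / 24 : ℝ) : ℂ) := by
      rw [sumP]; push_cast; ring
    rw [this, Complex.ofReal_re]
  rw [hA, hr, hr, ← one_div]
  obtain ⟨t, rfl⟩ : ∃ t, η = Real.exp (2 * t) :=
    ⟨Real.log η / 2, by rw [mul_div_cancel₀ _ two_ne_zero, Real.exp_log (by linarith)]⟩
  have ht : 0 < t := by
    by_contra h
    have : Real.exp (2 * t) ≤ 1 := Real.exp_le_one_iff.2 (by linarith)
    linarith
  have h := sinh_sum_rule_nonneg ht.le
  have hi : 1 / Real.exp (2 * t) = Real.exp (-(2 * t)) := by rw [Real.exp_neg, one_div]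
  have hsq : Real.exp (2 * t) + 1 / Real.exp (2 * t) - 2 = (2 * Real.sinh t) ^ 2 := by
    rw [hi, Real.sinh_eq, show 2 * t = t + t by ring, Real.exp_add, neg_add, Real.exp_add]
    have : Real.exp t * Real.exp (-t) = 1 := by rw [← Real.exp_add]; simp
    linear_combination 2 * this
  have hs : 0 ≤ 2 * Real.sinh t := by
    have := Real.sinh_nonneg_iff.2 ht.le
    linarith
  rw [hsq, max_eq_left (sq_nonneg _), ← Real.rpow_natCast, ← Real.rpow_mul hs]
  rw [hi, Real.log_exp]
  have hk : ∀ k : ℕ, Real.exp (2 * t) ^ k - Real.exp (-(2 * t)) ^ k =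
      2 * Real.sinh (k * (2 * t)) := fun k => by
    rw [Real.sinh_eq, ← Real.exp_nat_mul, ← Real.exp_nat_mul, mul_neg]; ring
  have h1 := hk 1
  have h2 := hk 2
  have h3 := hk 3
  norm_num at h1 h2 h3
  rw [← mul_assoc] at h2 h3
  norm_num at h2 h3
  have : (2 * Real.sinh t) ^ (((2 : ℕ) : ℝ) * (3 / 2)) = (2 * Real.sinh t) ^ 3 := by
    rw [← Real.rpow_natCast]; norm_num
  rw [this]
  linarith

end scalar

section pencil

variable {ι : Type*} [Fintype ι] [DecidableEq ι] {L : ℕ}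

lemma quad_ten_endM (v : ι × Fin L → ℂ) :
    quad (ten ι (endM L)) v = ∑ x, endDeg L x.2 * Complex.normSq (v x) := by
  have : ten ι (endM L) = diagonal fun x : ι × Fin L => (endDeg L x.2 : ℂ) := by
    rw [endM, ten, ← diagonal_one, diagonal_kronecker_diagonal]
    simp
  rw [this, quad, dotProduct, Complex.re_sum]
  refine Finset.sum_congr rfl fun x _ => ?_
  rw [mulVec_diagonal, Pi.star_apply, mul_left_comm, Complex.re_ofReal_mul]
  simp [Complex.normSq_apply]

lemma endDeg_le (k : Fin L) : endDeg L k ≤ 1 := by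
  unfold endDeg; split_ifs <;> norm_num

lemma neg_one_le_endDeg (k : Fin L) : -1 ≤ endDeg L k := by
  unfold endDeg; split_ifs <;> norm_num

lemma quad_endM_le (v : ι × Fin L → ℂ) : quad (ten ι (endM L)) v ≤ nsq v := by
  rw [quad_ten_endM, nsq]
  exact Finset.sum_le_sum fun x _ =>
    mul_le_of_le_one_left (Complex.normSq_nonneg _) (endDeg_le _)

lemma neg_nsq_le_quad_endM (v : ι × Fin L → ℂ) : -nsq v ≤ quad (ten ι (endM L)) v := by
  rw [quad_ten_endM, nsq, ← Finset.sum_neg_distrib]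
  exact Finset.sum_le_sum fun x _ => by
    nlinarith [Complex.normSq_nonneg (v x), neg_one_le_endDeg x.2]

end pencil

section counting

variable {n m : Type*} [Fintype n] [DecidableEq n] [Fintype m] [DecidableEq m]

lemma exists_spectral_gap (f : n → ℝ) : ∃ ε > 0, ∀ i, f i ≠ 0 → ε < |f i| := by
  have h : ∀ᶠ ε : ℝ in nhdsWithin 0 (Set.Ioi 0), ∀ i, f i ≠ 0 → ε < |f i| := by
    rw [Filter.eventually_all]
    intro i
    by_cases hi : f i = 0
    · simp [hi]
    · filter_upwards [mem_nhdsWithin_of_mem_nhds (Iio_mem_nhds (abs_pos.2 hi))] with ε hε _ using hε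
  obtain ⟨ε, h1, h2⟩ := (h.and self_mem_nhdsWithin).exists
  exact ⟨ε, h2, h1⟩

lemma cnt_le_of_quad {A : Matrix n n ℂ} {B : Matrix m m ℂ} (hA : A.IsHermitian)
    (hB : B.IsHermitian) {s t : ℝ} (f : (n → ℂ) →ₗ[ℂ] (m → ℂ)) (hf : Function.Injective f)
    (h : ∀ v, s * nsq v ≤ quad A v → t * nsq (f v) ≤ quad B (f v)) : cnt A s ≤ cnt B t := by
  obtain ⟨W, hW, hq⟩ := exists_submodule_cnt hA s
  rw [← hW]
  exact finrank_le_cnt hB (f ∘ₗ W.subtype) (hf.comp W.injective_subtype) t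
    fun x => h _ (hq _ x.2)

lemma finrank_ker_mulVecLin {A : Matrix n n ℂ} (hA : A.IsHermitian) :
    Module.finrank ℂ (LinearMap.ker A.mulVecLin) =
      Fintype.card {i // hA.eigenvalues i = 0} := by
  have h1 := LinearMap.finrank_range_add_finrank_ker A.mulVecLin
  have h2 := hA.rank_eq_card_non_zero_eigs
  rw [Matrix.rank] at h2
  have h3 := Fintype.card_subtype_compl (fun i => hA.eigenvalues i = 0)
  have h4 := Fintype.card_subtype_le (fun i => hA.eigenvalues i = 0)
  simp only [Module.finrank_fintype_fun_eq_card] at h1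
  simp only [ne_eq] at h2
  omega

lemma exists_cnt_eq {A : Matrix n n ℂ} (hA : A.IsHermitian) : ∃ ε > 0,
    cnt A 0 = cnt A ε + Module.finrank ℂ (LinearMap.ker A.mulVecLin) ∧
    cnt A (-ε) = cnt A 0 := by
  obtain ⟨ε, hε, h⟩ := exists_spectral_gap hA.eigenvalues
  refine ⟨ε, hε, ?_, ?_⟩
  · rw [finrank_ker_mulVecLin hA, cnt_eq hA, cnt_eq hA, Fintype.card_subtype, Fintype.card_subtype,
      Fintype.card_subtype, ← Finset.card_union_of_disjoint]
    · congr 1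
      ext i
      simp only [Finset.mem_filter, Finset.mem_univ, true_and, Finset.mem_union]
      constructor
      · intro hi
        rcases hi.eq_or_lt with h0 | h0
        · exact Or.inr h0.symm
        · have := h i h0.ne'
          rw [abs_of_pos h0] at this
          exact Or.inl this.le
      · rintro (h0 | h0)
        · linarith
        · exact h0.ge
    · refine Finset.disjoint_filter.2 fun i _ h0 h1 => ?_
      linarith
  · rw [cnt_eq hA, cnt_eq hA]
    refine Fintype.card_congr (Equiv.subtypeEquivRight fun i => ⟨fun h0 => ?_, fun h0 => ?_⟩)
    · by_contra h1
      push Not at h1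
      have := h i h1.ne
      rw [abs_of_neg h1] at this
      linarith
    · linarith

lemma exists_quad_le {A : Matrix n n ℂ} (hA : A.IsHermitian) :
    ∃ Λ > 0, ∀ v, quad A v ≤ Λ * nsq v := by
  refine ⟨∑ i, |hA.eigenvalues i| + 1, by positivity, fun v => ?_⟩
  rw [quad_eigCoord hA, ← nsq_eigCoord hA, nsq, Finset.mul_sum]
  refine Finset.sum_le_sum fun i _ => mul_le_mul_of_nonneg_right ?_ (Complex.normSq_nonneg _)
  have := Finset.single_le_sum (f := fun i => |hA.eigenvalues i|) (fun i _ => abs_nonneg _)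
    (Finset.mem_univ i)
  have := le_abs_self (hA.eigenvalues i)
  linarith

end counting

section pencil

variable {ι : Type*} [Fintype ι] [DecidableEq ι] {L : ℕ}

lemma isHermitian_jacobi {b : Fin L → Matrix ι ι ℂ} (hb : ∀ i, (b i).IsHermitian) :
    (jacobi b).IsHermitian := (isHermitian_ten isHermitian_pathJ).add (isHermitian_blockDiagonal hb)

lemma isHermitian_endM : (endM L).IsHermitian := by
  rw [endM, IsHermitian, diagonal_conjTranspose]
  congr 1
  ext i
  simp

/-- The self-adjoint pencil `J - 1/z - z C`. -/
noncomputable def pencil (b : Fin L → Matrix ι ι ℂ) (z : ℝ) : Matrix (ι × Fin L) (ι × Fin L) ℂ :=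
  jacobi b - z⁻¹ • 1 - z • ten ι (endM L)

lemma isHermitian_pencil {b : Fin L → Matrix ι ι ℂ} (hb : ∀ i, (b i).IsHermitian) (z : ℝ) :
    (pencil b z).IsHermitian :=
  ((isHermitian_jacobi hb).sub (isHermitian_one.smul (IsSelfAdjoint.all _))).sub
    ((isHermitian_ten isHermitian_endM).smul (IsSelfAdjoint.all _))

lemma quad_pencil (b : Fin L → Matrix ι ι ℂ) (z : ℝ) (v : ι × Fin L → ℂ) :
    quad (pencil b z) v = quad (jacobi b) v - z⁻¹ * nsq v - z * quad (ten ι (endM L)) v := by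
  rw [pencil, quad_sub, quad_sub, quad_smul, quad_smul, quad_one]

lemma quad_pencil_sub_le (b : Fin L → Matrix ι ι ℂ) (z w : ℝ) (v : ι × Fin L → ℂ) :
    quad (pencil b z) v ≤ quad (pencil b w) v + (|z⁻¹ - w⁻¹| + |z - w|) * nsq v := by
  rw [quad_pencil, quad_pencil]
  have h1 := quad_endM_le v
  have h2 := neg_nsq_le_quad_endM v
  have h0 := nsq_nonneg v
  have h3 : |(z - w) * quad (ten ι (endM L)) v| ≤ |z - w| * nsq v := by
    rw [abs_mul]
    exact mul_le_mul_of_nonneg_left (abs_le.2 ⟨h2, h1⟩) (abs_nonneg _)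
  have h4 : -|z⁻¹ - w⁻¹| * nsq v ≤ (z⁻¹ - w⁻¹) * nsq v :=
    mul_le_mul_of_nonneg_right (neg_abs_le _) h0
  have h5 := neg_abs_le ((z - w) * quad (ten ι (endM L)) v)
  linarith

lemma cnt_pencil_near {b : Fin L → Matrix ι ι ℂ} (hb : ∀ i, (b i).IsHermitian) {z ε : ℝ}
    (hz : 0 < z) (hε : 0 < ε) : ∃ δ > 0, ∀ w, |w - z| < δ →
      cnt (pencil b z) ε ≤ cnt (pencil b w) 0 ∧ cnt (pencil b w) 0 ≤ cnt (pencil b z) (-ε) := by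
  have hc : ContinuousAt (fun w : ℝ => |z⁻¹ - w⁻¹| + |z - w|) z := by
    have := continuousAt_inv₀ hz.ne'
    fun_prop
  have h0 : ∀ᶠ w in nhds z, |z⁻¹ - w⁻¹| + |z - w| < ε :=
    hc.eventually_lt continuousAt_const (by simpa using hε)
  obtain ⟨δ, hδ, h⟩ := Metric.eventually_nhds_iff.1 h0
  refine ⟨δ, hδ, fun w hw => ?_⟩
  have hw := h (by rwa [Real.dist_eq])
  constructor
  · refine cnt_le_of_quad (isHermitian_pencil hb _) (isHermitian_pencil hb _) LinearMap.id
      Function.injective_id fun v hv => ?_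
    have := quad_pencil_sub_le b z w v
    have := mul_le_mul_of_nonneg_right hw.le (nsq_nonneg v)
    simp only [LinearMap.id_apply]
    linarith
  · refine cnt_le_of_quad (isHermitian_pencil hb _) (isHermitian_pencil hb _) LinearMap.id
      Function.injective_id fun v hv => ?_
    have := quad_pencil_sub_le b w z v
    rw [abs_sub_comm w⁻¹, abs_sub_comm w] at this
    have := mul_le_mul_of_nonneg_right hw.le (nsq_nonneg v)
    simp only [LinearMap.id_apply]
    linarith

lemma companion_mulVec_elim (b : Fin L → Matrix ι ι ℂ) (v w : ι × Fin L → ℂ) :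
    companion b *ᵥ Sum.elim v w =
      Sum.elim (jacobi b *ᵥ v - ten ι (endM L) *ᵥ w) v := by
  rw [companion, fromBlocks_mulVec]
  simp [sub_eq_add_neg, neg_mulVec]

lemma finrank_ker_pencil_le (b : Fin L → Matrix ι ι ℂ) {z : ℝ} (hz : 0 < z) :
    Module.finrank ℂ (LinearMap.ker (pencil b z).mulVecLin) ≤
      (companion b).charpoly.roots.count ((z⁻¹ : ℝ) : ℂ) := by
  have h := LinearMap.finrank_eigenspace_le (companion b).mulVecLin ((z⁻¹ : ℝ) : ℂ)
  rw [show (companion b).mulVecLin = Matrix.toLin' (companion b) from rfl,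
    Matrix.charpoly_toLin'] at h
  rw [Polynomial.count_roots]
  refine le_trans ?_ h
  let f : (ι × Fin L → ℂ) →ₗ[ℂ] ((ι × Fin L) ⊕ (ι × Fin L) → ℂ) :=
    { toFun := fun v => Sum.elim (((z⁻¹ : ℝ) : ℂ) • v) v
      map_add' := fun v w => by ext (i | i) <;> simp [mul_add]
      map_smul' := fun c v => by ext (i | i) <;> simp [mul_left_comm] }
  have hf : ∀ v ∈ LinearMap.ker (pencil b z).mulVecLin,
      f v ∈ Module.End.eigenspace (Matrix.toLin' (companion b)) ((z⁻¹ : ℝ) : ℂ) := fun v hv => by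
    rw [LinearMap.mem_ker, Matrix.mulVecLin_apply, pencil, sub_mulVec, sub_mulVec, smul_mulVec,
      smul_mulVec, one_mulVec, sub_eq_zero, sub_eq_iff_eq_add] at hv
    rw [Module.End.mem_eigenspace_iff, Matrix.toLin'_apply]
    change companion b *ᵥ Sum.elim _ _ = _ • Sum.elim _ _
    rw [companion_mulVec_elim, mulVec_smul, hv]
    have hz' : ((z⁻¹ : ℝ) : ℂ) * z = 1 := by
      rw [← Complex.ofReal_mul, inv_mul_cancel₀ hz.ne']; simp
    ext (i | i)
    · simp only [Sum.elim_inl, Pi.sub_apply, Pi.smul_apply, Pi.add_apply, smul_eq_mul,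
        Complex.real_smul]
      linear_combination (ten ι (endM L) *ᵥ v) i * hz'
    · simp
  exact LinearMap.finrank_le_finrank_of_injective (f := f.restrict hf) fun v w hvw => by
    have h1 := congrArg Subtype.val hvw
    ext i
    exact congrFun h1 (Sum.inr i)

lemma cnt_pencil_le {b : Fin L → Matrix ι ι ℂ} (hb : ∀ i, (b i).IsHermitian) {z : ℝ}
    (hz : 0 < z) : cnt (pencil b z) 0 ≤
      (companion b).charpoly.roots.countP (fun η => η.im = 0 ∧ z⁻¹ ≤ η.re) := by
  obtain ⟨Λ, hΛ, hJ⟩ := exists_quad_le (isHermitian_jacobi hb)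
  suffices H : ∀ k : ℕ, ∀ z : ℝ, 0 < z → cnt (pencil b z) 0 ≤ k → cnt (pencil b z) 0 ≤
      (companion b).charpoly.roots.countP (fun η => η.im = 0 ∧ z⁻¹ ≤ η.re) from H _ z hz le_rfl
  intro k
  induction k with
  | zero => intro z _ h; omega
  | succ k ih =>
    intro z hz hk
    rcases Nat.lt_or_ge (cnt (pencil b z) 0) (k + 1) with h | h
    · exact ih z hz (by omega)
    set S : Set ℝ := {w | 0 < w ∧ w ≤ z ∧ k + 1 ≤ cnt (pencil b w) 0} with hS
    have hne : S.Nonempty := ⟨z, hz, le_rfl, h⟩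
    have hlow : ∀ w ∈ S, 1 / (Λ + 1 + z) ≤ w := fun w hw => by
      by_contra hlt
      push Not at hlt
      have hw0 := hw.1
      rw [lt_one_div hw0 (by positivity), one_div] at hlt
      obtain ⟨W, hW, hq⟩ := exists_submodule_cnt (isHermitian_pencil hb w) 0
      have hpos : 0 < Module.finrank ℂ W := by rw [hW]; have := hw.2.2; omega
      obtain ⟨⟨v, hv⟩, hv0⟩ := Module.finrank_pos_iff_exists_ne_zero.1 hpos
      have h1 := hq v hv
      rw [quad_pencil] at h1
      have h2 := hJ v
      have h3 := neg_nsq_le_quad_endM v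
      have h4 : 0 < nsq v := lt_of_le_of_ne (nsq_nonneg v) fun e =>
        hv0 (Subtype.ext (nsq_eq_zero e.symm))
      have h5 := mul_lt_mul_of_pos_right hlt h4
      have h6 := mul_le_mul_of_nonneg_left h3 hw0.le
      have h7 := mul_le_mul_of_nonneg_right hw.2.1 h4.le
      linarith
    have hbdd : BddBelow S := ⟨_, hlow⟩
    set z' := sInf S with hz'
    have hz'0 : 0 < z' := lt_of_lt_of_le (by positivity) (le_csInf hne hlow)
    have hz'z : z' ≤ z := csInf_le hbdd ⟨hz, le_rfl, h⟩
    obtain ⟨ε, hε, h1, h2⟩ := exists_cnt_eq (isHermitian_pencil hb z')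
    obtain ⟨δ, hδ, h3⟩ := cnt_pencil_near hb hz'0 hε
    have h4 : k + 1 ≤ cnt (pencil b z') 0 := by
      obtain ⟨w, hw, hwz⟩ := exists_lt_of_csInf_lt hne (lt_add_of_pos_right z' hδ)
      have := (h3 w (by rw [abs_lt]; constructor <;> linarith [csInf_le hbdd hw])).2
      have := hw.2.2
      omega
    set w := max (z' / 2) (z' - δ / 2) with hw
    have hw0 : 0 < w := lt_max_of_lt_left (by positivity)
    have hwz : w < z' := max_lt (by linarith) (by linarith)
    have hwd : z' - δ / 2 ≤ w := le_max_right _ _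
    have h5 := (h3 w (by rw [abs_lt]; constructor <;> linarith)).1
    have h6 : cnt (pencil b w) 0 ≤ k := by
      by_contra hcon
      have : w ∈ S := ⟨hw0, by linarith, by omega⟩
      linarith [csInf_le hbdd this]
    have h7 := ih w hw0 h6
    have h8 := finrank_ker_pencil_le b hz'0
    have h9 : ∀ R : Multiset ℂ, R.countP (fun η => η.im = 0 ∧ w⁻¹ ≤ η.re) +
        R.count ((z'⁻¹ : ℝ) : ℂ) ≤ R.countP (fun η => η.im = 0 ∧ z⁻¹ ≤ η.re) := fun R => by
      have hi1 : z'⁻¹ < w⁻¹ := inv_strictAnti₀ hw0 hwz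
      have hi2 : z⁻¹ ≤ z'⁻¹ := inv_anti₀ hz'0 hz'z
      induction R using Multiset.induction with
      | empty => simp
      | cons η R ihR =>
        rw [Multiset.countP_cons, Multiset.countP_cons, Multiset.count_cons]
        by_cases e : ((z'⁻¹ : ℝ) : ℂ) = η
        · subst e
          simp only [Complex.ofReal_re, Complex.ofReal_im, true_and]
          rw [if_neg (not_le.2 hi1), if_pos trivial, if_pos hi2]
          omega
        · rw [if_neg e]
          by_cases e1 : η.im = 0 ∧ w⁻¹ ≤ η.re
          · rw [if_pos e1, if_pos ⟨e1.1, by linarith [e1.2]⟩]; omega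
          · rw [if_neg e1]; omega
    have h10 := h9 (companion b).charpoly.roots
    omega

end pencil

section threehalves

variable {ι : Type*} [Fintype ι] [DecidableEq ι] {L : ℕ}

lemma mul_shiftM_conjTranspose : (shiftM L * (shiftM L)ᴴ) =
    diagonal fun i : Fin L => if (i : ℕ) + 1 = L then 0 else 1 := by
  ext i j
  simp only [mul_apply, shiftM, conjTranspose_apply, of_apply, diagonal_apply]
  by_cases hi : (i : ℕ) + 1 = L
  · rw [Finset.sum_eq_zero]
    · simp [hi]
    · intro k _
      rw [if_neg (by omega), zero_mul]
  · rw [Finset.sum_eq_single ⟨i + 1, by omega⟩]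
    · by_cases hij : i = j
      · subst hij; simp [hi]
      · rw [if_neg (c := (j : ℕ) + 1 = _) (by simpa [eq_comm, Fin.ext_iff] using hij)]
        simp [hij]
    · intro k _ hk
      rw [if_neg (fun h => hk (Fin.ext h.symm)), zero_mul]
    · simp

lemma neg_le_quad_ten_pathJ (v : ι × Fin L → ℂ) :
    -(nsq v + quad (ten ι (endM L)) v) ≤ quad (ten ι (pathJ L)) v := by
  have h : (shiftM L + shiftM L * (shiftM L)ᴴ)ᴴ * (shiftM L + shiftM L * (shiftM L)ᴴ) =
      1 + endM L + pathJ L := by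
    have h3 : (shiftM L)ᴴ * (shiftM L * (shiftM L)ᴴ) = (shiftM L)ᴴ := by
      rw [← mul_assoc, shiftM_sq]
      ext i j
      rw [diagonal_mul]
      simp only [shiftM, conjTranspose_apply, of_apply]
      split_ifs <;> first | omega | simp
    have h3' : shiftM L * (shiftM L)ᴴ * shiftM L = shiftM L := by
      simpa [mul_assoc] using congrArg conjTranspose h3
    have h4 : shiftM L * (shiftM L)ᴴ * (shiftM L * (shiftM L)ᴴ) = shiftM L * (shiftM L)ᴴ := by
      rw [← mul_assoc, h3']
    have h5 : (shiftM L)ᴴ * shiftM L + shiftM L * (shiftM L)ᴴ = 1 + endM L := by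
      rw [shiftM_sq, mul_shiftM_conjTranspose, endM, ← diagonal_one, diagonal_add, diagonal_add]
      congr 1
      ext i
      rw [endDeg]
      split_ifs <;> norm_num
    rw [conjTranspose_add, conjTranspose_mul, conjTranspose_conjTranspose, add_mul, mul_add,
      mul_add, h3, h3', h4, ← h5, pathJ]
    abel
  have h2 := congrArg (fun X => quad (ten ι X) v) h
  simp only [ten_mul, ten_conjTranspose, ten_add, ten_one, quad_add, quad_one] at h2
  rw [← nsq_mulVec] at h2
  have := nsq_nonneg (((ten ι (shiftM L) + ten ι (shiftM L) * (ten ι (shiftM L))ᴴ)) *ᵥ v)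
  linarith

lemma blockDiagonal_posSemidef {b : Fin L → Matrix ι ι ℂ} (hb : ∀ k, (b k).PosSemidef) :
    (blockDiagonal b).PosSemidef := by
  choose B hB using fun k => exists_factor (hb k)
  have : blockDiagonal b = (blockDiagonal B)ᴴ * blockDiagonal B := by
    rw [blockDiagonal_conjTranspose, ← blockDiagonal_mul]
    congr 1
    ext1 k
    exact hB k
  rw [this]
  exact posSemidef_conjTranspose_mul_self _

lemma quad_blockDiagonal_nonneg {b : Fin L → Matrix ι ι ℂ} (hb : ∀ k, (b k).PosSemidef)
    (v : ι × Fin L → ℂ) : 0 ≤ quad (blockDiagonal b) v :=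
  PosSemidef_quad (blockDiagonal_posSemidef hb) v

lemma sum_map_sumP (R : Multiset ℂ) : (R.map fun η => (sumP η).re).sum =
    (-(R.map fun η => η ^ 1).sum / 8 + (R.map fun η => η ^ 2).sum / 8 +
      (R.map fun η => η ^ 3).sum / 24).re := by
  induction R using Multiset.induction with
  | empty => simp
  | cons η R ih =>
    simp only [Multiset.map_cons, Multiset.sum_cons]
    rw [ih, ← Complex.add_re, sumP]
    congr 1; ring

lemma norm_multiset_map_prod {α : Type*} (R : Multiset α) (f : α → ℂ) :
    ‖(R.map f).prod‖ = (R.map fun η => ‖f η‖).prod := by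
  induction R using Multiset.induction with
  | empty => simp
  | cons η R ih => simp [ih]

lemma root_companion_real {b : Fin L → Matrix ι ι ℂ} (hb : ∀ k, (b k).PosSemidef) {η : ℂ}
    (hη : η ∈ (companion b).charpoly.roots) (h1 : 1 < ‖η‖) : η.im = 0 ∧ 1 < η.re := by
  have hroot : (scalar _ η - companion b).det = 0 := by
    rw [← Matrix.eval_charpoly]
    exact (Polynomial.mem_roots'.1 hη).2
  obtain ⟨v, hv0, hv⟩ := exists_mulVec_eq_zero_iff.2 hroot
  rw [sub_mulVec, sub_eq_zero] at hv
  obtain ⟨v1, v2, rfl⟩ : ∃ v1 v2, v = Sum.elim v1 v2 :=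
    ⟨v ∘ Sum.inl, v ∘ Sum.inr, (Sum.elim_comp_inl_inr v).symm⟩
  rw [companion_mulVec_elim] at hv
  have e2 : v1 = η • v2 := by
    ext i
    simpa using (congrFun hv (Sum.inr i)).symm
  have e1 : η • v1 = jacobi b *ᵥ v1 - ten ι (endM L) *ᵥ v2 := by
    ext i
    simpa using congrFun hv (Sum.inl i)
  subst e2
  have hv2 : v2 ≠ 0 := by
    rintro rfl
    exact hv0 (by ext (i | i) <;> simp)
  have hJ := isHermitian_jacobi fun k => (hb k).1
  have hC := isHermitian_ten (ι := ι) (isHermitian_endM (L := L))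
  have e3 := congrArg (star v2 ⬝ᵥ ·) e1
  simp only [mulVec_smul, dotProduct_sub, dotProduct_smul, nsq_eq, smul_eq_mul] at e3
  have hj : star v2 ⬝ᵥ (jacobi b *ᵥ v2) = (quad (jacobi b) v2 : ℂ) :=
    Complex.ext rfl (by simpa using quad_im hJ v2)
  have hc : star v2 ⬝ᵥ (ten ι (endM L) *ᵥ v2) = (quad (ten ι (endM L)) v2 : ℂ) :=
    Complex.ext rfl (by simpa using quad_im hC v2)
  rw [hj, hc] at e3
  have hn : 0 < nsq v2 := lt_of_le_of_ne (nsq_nonneg _) fun e => hv2 (nsq_eq_zero e.symm)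
  have hc1 := quad_endM_le v2
  have hj1 : -(nsq v2 + quad (ten ι (endM L)) v2) ≤ quad (jacobi b) v2 := by
    rw [jacobi, quad_add]
    have := neg_le_quad_ten_pathJ v2
    have := quad_blockDiagonal_nonneg hb v2
    linarith
  generalize nsq v2 = n at *
  generalize quad (jacobi b) v2 = j at *
  generalize quad (ten ι (endM L)) v2 = c at *
  have hre := congrArg Complex.re e3
  have him := congrArg Complex.im e3
  simp at hre him
  have hnorm : 1 < η.re ^ 2 + η.im ^ 2 := by
    have h2 : (1 : ℝ) < ‖η‖ ^ 2 := by nlinarith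
    rw [← Complex.normSq_eq_norm_sq, Complex.normSq_apply] at h2
    nlinarith
  have hi : η.im = 0 := by
    by_contra hne
    have hj' : j = 2 * η.re * n := by
      apply mul_left_cancel₀ hne; linarith
    rw [hj'] at hre
    nlinarith
  refine ⟨hi, ?_⟩
  rw [hi] at hre hnorm
  by_contra hlt
  push Not at hlt
  have h3 : η.re < -1 := by
    by_contra h4
    push Not at h4
    nlinarith
  nlinarith [mul_pos (by linarith : 0 < -η.re - 1) hn]

/-- The sharp Lieb–Thirring inequality with exponent `3/2` on a path, up to a lower order term. -/
lemma trF_three_halves_chain_le (b : Fin (L + 1) → Matrix ι ι ℂ) (hb : ∀ k, (b k).PosSemidef) :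
    trF (fun x => (max x 0) ^ (3 / 2 : ℝ)) (chain b) ≤
      3 / 2 * ∑ k, ((b k * b k).trace.re / 8 + (b k * b k * b k).trace.re / 24) := by
  have hh : ∀ k, (b k).IsHermitian := fun k => (hb k).1
  set R := (companion b).charpoly.roots with hR
  have hsum : (Fintype.card ι : ℝ) / 4 ≤ (R.map sumA).sum := by
    refine le_sum_sumA fun z hz hi => ?_
    refine (norm_det_companion_ge hh hz hi).trans (le_of_eq ?_)
    rw [det_one_sub_smul, ← hR, norm_multiset_map_prod]
  have hP : (R.map fun η => (sumP η).re).sum = Fintype.card ι / 4 +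
      ∑ k, ((b k * b k).trace.re / 8 + (b k * b k * b k).trace.re / 24) := by
    have h1 := trace_pow_eq (companion b) 1
    have h2 := trace_pow_eq (companion b) 2
    have h3 := trace_pow_eq (companion b) 3
    rw [pow_one, trace_companion] at h1
    rw [trace_companion_sq b (Nat.succ_pos _)] at h2
    rw [trace_companion_cube] at h3
    rw [sum_map_sumP, hR, ← h1, ← h2, ← h3, Finset.sum_add_distrib, ← Finset.sum_div,
      ← Finset.sum_div, ← Complex.re_sum, ← Complex.re_sum]
    generalize (∑ k, (b k).trace) = x
    generalize (∑ k, (b k * b k).trace) = y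
    generalize (∑ k, (b k * b k * b k).trace) = w
    rw [show -x / 8 + (2 * (Fintype.card ι : ℂ) + y) / 8 + (3 * x + w) / 24 =
      (((Fintype.card ι : ℝ) / 4 : ℝ) : ℂ) + (((1 / 8 : ℝ) : ℂ) * y + ((1 / 24 : ℝ) : ℂ) * w) by
        push_cast; ring]
    rw [Complex.add_re, Complex.add_re, Complex.re_ofReal_mul, Complex.re_ofReal_mul,
      Complex.ofReal_re]
    ring
  have hcount : trF (fun x => (max x 0) ^ (3 / 2 : ℝ)) (chain b) ≤
      (((R.filter (fun η => 1 < ‖η‖)).map fun η => η.re + 1 / η.re - 2).map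
        fun x => (max x 0) ^ (3 / 2 : ℝ)).sum := by
    refine multiset_sum_le_of_count (monotone_posPow (by norm_num)) (posPow_of_nonpos (by norm_num))
      _ _ fun t ht => ?_
    have hz := jou_pos t
    have h1 : cnt (chain b) t ≤ cnt (pencil b (jou t)) 0 := by
      refine cnt_le_of_quad (isHermitian_chain hh) (isHermitian_pencil hh _) LinearMap.id
        Function.injective_id fun v hv => ?_
      have h2 : quad (chain b) v = quad (jacobi b) v - 2 * nsq v := by
        rw [chain, jacobi, quad_add, quad_add, ten_sub, quad_sub, ten_smul, quad_smul, ten_one,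
          quad_one]; ring
      have h3 := jou_add ht.le
      rw [h2] at hv
      rw [LinearMap.id_apply, quad_pencil, zero_mul, ← one_div]
      have := mul_le_mul_of_nonneg_left (quad_endM_le v) hz.le
      rw [← h3] at hv
      linarith
    have h2 := h1.trans (cnt_pencil_le hh hz)
    refine h2.trans ?_
    rw [← hR, ← Multiset.countP_eq_card_filter, Multiset.countP_map, Multiset.filter_filter,
      Multiset.countP_eq_card_filter]
    refine Multiset.card_le_card (Multiset.monotone_filter_right _ fun η hη => ?_)
    have hj1 : 1 < (jou t)⁻¹ := one_lt_inv₀ hz |>.2 (jou_lt_one ht)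
    have hre : 1 < η.re := hj1.trans_le hη.2
    refine ⟨?_, hre.trans_le (Complex.re_le_norm η)⟩
    have h3 := jou_add ht.le
    have h4 := hη.2
    rw [← one_div] at h4 hj1
    have h5 : 1 / η.re ≤ jou t := by
      rw [div_le_comm₀ (by linarith) hz]; exact h4
    have h6 : jou t = 1 / (1 / jou t) := by rw [one_div_one_div]
    have h7 : jou t * (1 / jou t) = 1 := by field_simp
    have h8 : η.re * (1 / η.re) = 1 := by field_simp
    generalize 1 / jou t = p at *
    generalize 1 / η.re = q at *
    generalize jou t = r at *
    nlinarith [mul_nonneg (sub_nonneg.2 h4) (sub_nonneg.2 (show q ≤ 1 by nlinarith))]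
  refine hcount.trans ?_
  have hfin : ((((R.filter (fun η => 1 < ‖η‖)).map fun η => η.re + 1 / η.re - 2).map
        fun x => (max x 0) ^ (3 / 2 : ℝ)).sum) ≤
      (R.map fun η => 3 / 2 * ((sumP η).re - sumA η)).sum := by
    rw [Multiset.map_map]
    have hroot : ∀ η ∈ R, 1 < ‖η‖ → η.im = 0 ∧ 1 < η.re := fun η hη h1 =>
      root_companion_real hb hη h1
    clear_value R
    clear hcount hP hsum hR
    induction R using Multiset.induction with
    | empty => simp
    | cons η R ih =>
      have ih := ih fun η' h' => hroot η' (Multiset.mem_cons_of_mem h')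
      rw [Multiset.map_cons, Multiset.sum_cons]
      by_cases h1 : 1 < ‖η‖
      · rw [Multiset.filter_cons_of_pos (p := fun η : ℂ => 1 < ‖η‖) R h1, Multiset.map_cons, Multiset.sum_cons]
        obtain ⟨hi, hre⟩ := hroot η (Multiset.mem_cons_self _ _) h1
        refine add_le_add ?_ ih
        have h2 : η = (η.re : ℂ) := Complex.ext rfl (by simp [hi])
        have h3 := rpow_le_sumP_sub_sumA hre
        rw [← h2] at h3
        simp only [Function.comp_apply]
        linarith
      · rw [Multiset.filter_cons_of_neg (p := fun η : ℂ => 1 < ‖η‖) R h1, sumA, if_pos (not_lt.1 h1), sub_self, mul_zero,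
          zero_add]
        exact ih
  refine hfin.trans ?_
  rw [Multiset.sum_map_mul_left, Multiset.sum_map_sub, hP]
  linarith

end threehalves

section aizenmanLieb

variable {n : Type*} [Fintype n] [DecidableEq n]

lemma exists_posPart {A : Matrix n n ℂ} (hA : A.IsHermitian) : ∃ P : Matrix n n ℂ,
    P.PosSemidef ∧ (∀ v, quad A v ≤ quad P v) ∧
    P.trace.re = trF (fun x => max x 0) A ∧
    (P * P).trace.re = trF (fun x => (max x 0) ^ 2) A ∧
    (P * P * P).trace.re = trF (fun x => (max x 0) ^ 3) A := by
  set U := (hA.eigenvectorUnitary : Matrix n n ℂ)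
  set D : Matrix n n ℂ := diagonal fun i => ((max (hA.eigenvalues i) 0 : ℝ) : ℂ)
  have hU : Uᴴ * U = 1 := star_mul_unitary hA
  have hD : D.PosSemidef := PosSemidef.diagonal fun i => by
    simp only [Pi.zero_apply]
    exact_mod_cast le_max_right _ _
  have htr : ∀ X : Matrix n n ℂ, (U * X * Uᴴ).trace = X.trace := fun X => by
    rw [trace_mul_comm, ← mul_assoc, hU, one_mul]
  have hmul : ∀ X Y : Matrix n n ℂ, (U * X * Uᴴ) * (U * Y * Uᴴ) = U * (X * Y) * Uᴴ := fun X Y => by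
    calc _ = U * X * (Uᴴ * U) * Y * Uᴴ := by simp only [mul_assoc]
      _ = _ := by rw [hU, mul_one]; simp only [mul_assoc]
  have hP : (U * D * Uᴴ).PosSemidef := hD.mul_mul_conjTranspose_same _
  refine ⟨U * D * Uᴴ, hP, fun v => ?_, ?_, ?_, ?_⟩
  · have hd : (D - diagonal fun i => (hA.eigenvalues i : ℂ)).PosSemidef := by
      rw [diagonal_sub]
      refine PosSemidef.diagonal fun i => ?_
      simp only [Pi.zero_apply]
      rw [← Complex.ofReal_sub]
      exact_mod_cast sub_nonneg.2 (le_max_left _ _)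
    have := PosSemidef_quad (hd.mul_mul_conjTranspose_same U) v
    rw [mul_sub, sub_mul, ← spectral_mul hA, quad_sub] at this
    linarith
  · rw [htr, trF_eq hA, trace_diagonal, ← Complex.ofReal_sum, Complex.ofReal_re]
  · rw [hmul, htr, diagonal_mul_diagonal, trF_eq hA, trace_diagonal]
    simp only [← Complex.ofReal_mul]
    rw [← Complex.ofReal_sum, Complex.ofReal_re]
    exact Finset.sum_congr rfl fun i _ => by ring
  · rw [hmul, hmul, htr, diagonal_mul_diagonal, diagonal_mul_diagonal, trF_eq hA, trace_diagonal]
    simp only [← Complex.ofReal_mul]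
    rw [← Complex.ofReal_sum, Complex.ofReal_re]
    exact Finset.sum_congr rfl fun i _ => by ring

/-- Riesz means of the spectrum above zero. -/
noncomputable def rm (γ : ℝ) (A : Matrix n n ℂ) : ℝ := trF (fun x => (max x 0) ^ γ) A

lemma rm_nonneg {γ : ℝ} {A : Matrix n n ℂ} (hA : A.IsHermitian) : 0 ≤ rm γ A := by
  rw [rm, trF_eq hA]
  exact Finset.sum_nonneg fun i _ => Real.rpow_nonneg (le_max_right _ _) _

lemma rm_sub_smul_one {γ : ℝ} (hγ : 0 < γ) {A : Matrix n n ℂ} (hA : A.IsHermitian) (τ : ℝ) :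
    rm γ (A - τ • 1) = ∑ i, (max (hA.eigenvalues i - τ) 0) ^ γ := by
  have hB : (A - τ • (1 : Matrix n n ℂ)).IsHermitian :=
    hA.sub (isHermitian_one.smul (IsSelfAdjoint.all _))
  have hq : ∀ v, quad (A - τ • (1 : Matrix n n ℂ)) v = quad A v - τ * nsq v := fun v => by
    rw [quad_sub, quad_smul, quad_one]
  have hc : ∀ t, cnt (A - τ • (1 : Matrix n n ℂ)) t =
      (((specR A).map (· - τ)).filter (t ≤ ·)).card := fun t => by
    have h1 : cnt (A - τ • (1 : Matrix n n ℂ)) t = cnt A (t + τ) := by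
      apply le_antisymm
      · refine cnt_le_of_quad hB hA LinearMap.id Function.injective_id fun v hv => ?_
        rw [hq] at hv
        simp only [LinearMap.id_apply]
        linarith
      · refine cnt_le_of_quad hA hB LinearMap.id Function.injective_id fun v hv => ?_
        simp only [LinearMap.id_apply, hq]
        linarith
    rw [h1, cnt, ← Multiset.countP_eq_card_filter, ← Multiset.countP_eq_card_filter,
      Multiset.countP_map, ← Multiset.countP_eq_card_filter]
    refine Multiset.countP_congr rfl fun x _ => ?_
    rw [le_sub_iff_add_le]
  have key : rm γ (A - τ • 1) = (((specR A).map (· - τ)).map fun x => (max x 0) ^ γ).sum :=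
    le_antisymm
      (multiset_sum_le_of_count (monotone_posPow hγ.le) (posPow_of_nonpos hγ) _ _
        fun t _ => (hc t).le)
      (multiset_sum_le_of_count (monotone_posPow hγ.le) (posPow_of_nonpos hγ) _ _
        fun t _ => (hc t).ge)
  rw [key, specR_eq hA, Multiset.map_map, Multiset.map_map]
  rfl

variable {ι : Type*} [Fintype ι] [DecidableEq ι] {L : ℕ}

lemma quad_blockDiagonal (b : Fin L → Matrix ι ι ℂ) (v : ι × Fin L → ℂ) :
    quad (blockDiagonal b) v = ∑ k, quad (b k) fun i => v (i, k) := by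
  simp only [quad, dotProduct, mulVec, ← Complex.re_sum]
  congr 1
  rw [Fintype.sum_prod_type, Finset.sum_comm]
  refine Finset.sum_congr rfl fun k _ => Finset.sum_congr rfl fun i _ => ?_
  congr 1
  rw [Fintype.sum_prod_type]
  refine Finset.sum_congr rfl fun j _ => ?_
  rw [Finset.sum_eq_single k]
  · rw [blockDiagonal_apply, if_pos rfl]
  · intro l _ hl
    rw [blockDiagonal_apply, if_neg (Ne.symm hl), zero_mul]
  · simp

lemma quad_chain_mono {b c : Fin L → Matrix ι ι ℂ} (h : ∀ k v, quad (b k) v ≤ quad (c k) v)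
    (v : ι × Fin L → ℂ) : quad (chain b) v ≤ quad (chain c) v := by
  rw [chain, chain, quad_add, quad_add, quad_blockDiagonal, quad_blockDiagonal]
  exact add_le_add_right (Finset.sum_le_sum fun k _ => h k _) _

lemma eigenvalues_le_of_quad {A : Matrix n n ℂ} (hA : A.IsHermitian) {M : ℝ}
    (h : ∀ v, quad A v ≤ M * nsq v) (i : n) : hA.eigenvalues i ≤ M := by
  by_contra hlt
  push Not at hlt
  have h1 : 0 < cnt A (hA.eigenvalues i) := by
    rw [cnt_eq hA]
    exact Fintype.card_pos_iff.2 ⟨⟨i, le_rfl⟩⟩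
  obtain ⟨W, hW, hq⟩ := exists_submodule_cnt hA (hA.eigenvalues i)
  rw [← hW] at h1
  obtain ⟨⟨v, hv⟩, hv0⟩ := Module.finrank_pos_iff_exists_ne_zero.1 h1
  have h2 := hq v hv
  have h4 : 0 < nsq v := lt_of_le_of_ne (nsq_nonneg v) fun e =>
    hv0 (Subtype.ext (nsq_eq_zero e.symm))
  nlinarith [h v]

lemma rm_half_chain_le {b : Fin L → Matrix ι ι ℂ} (hb : ∀ k, (b k).IsHermitian) :
    rm (1 / 2) (chain b) ≤ 1 / 2 * ∑ k, rm (1 / 2 + 1 / 2) (b k) := by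
  choose P hP hq h1 _ _ using fun k => exists_posPart (hb k)
  have h := trF_half_chain_le P hP
  simp only [h1] at h
  refine (trF_mono (monotone_posPow (by norm_num)) (posPow_of_nonpos (by norm_num))
    (isHermitian_chain hb) (isHermitian_chain fun k => (hP k).1)
    (quad_chain_mono hq)).trans (h.trans (le_of_eq ?_))
  norm_num [rm]

lemma rm_three_halves_chain_le {b : Fin (L + 1) → Matrix ι ι ℂ} (hb : ∀ k, (b k).IsHermitian)
    {M : ℝ} (hM : ∀ k v, quad (b k) v ≤ M * nsq v) (hM0 : 0 ≤ M) :
    rm (3 / 2) (chain b) ≤ 3 / 16 * (1 + M / 3) * ∑ k, rm (3 / 2 + 1 / 2) (b k) := by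
  choose P hP hq h1 h2 h3 using fun k => exists_posPart (hb k)
  have h := trF_three_halves_chain_le P hP
  simp only [h2, h3] at h
  refine (trF_mono (monotone_posPow (by norm_num)) (posPow_of_nonpos (by norm_num))
    (isHermitian_chain hb) (isHermitian_chain fun k => (hP k).1)
    (quad_chain_mono hq)).trans (h.trans ?_)
  rw [Finset.mul_sum, Finset.mul_sum]
  refine Finset.sum_le_sum fun k _ => ?_
  have h4 : trF (fun x => (max x 0) ^ 3) (b k) ≤ M * trF (fun x => (max x 0) ^ 2) (b k) := by
    rw [trF_eq (hb k), trF_eq (hb k), Finset.mul_sum]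
    refine Finset.sum_le_sum fun i _ => ?_
    rw [pow_succ' _ 2]
    exact mul_le_mul_of_nonneg_right
      (max_le (eigenvalues_le_of_quad (hb k) (hM k) i) hM0) (sq_nonneg _)
  have h5 : rm (3 / 2 + 1 / 2) (b k) = trF (fun x => (max x 0) ^ 2) (b k) := by
    rw [rm]; norm_num
  rw [h5]
  linarith

end aizenmanLieb

section betaLift

lemma intervalIntegrable_rpow_mul_posPow {a g : ℝ} (ha : 0 < a) (hg : 0 ≤ g) (x S T : ℝ) :
    IntervalIntegrable (fun t : ℝ => t ^ (a - 1) * (max (x - t) 0) ^ g) volume S T :=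
  (intervalIntegral.intervalIntegrable_rpow' (by linarith)).mul_continuousOn
    (Continuous.continuousOn (by
      refine Continuous.rpow_const (by fun_prop) fun t => Or.inr hg))

lemma integral_rpow_mul_posPow {a g : ℝ} (ha : 0 < a) (hg : 0 < g) {x T : ℝ} (hx : x ≤ T)
    (hT : 0 ≤ T) :
    ∫ t in (0 : ℝ)..T, t ^ (a - 1) * (max (x - t) 0) ^ g =
      ProbabilityTheory.beta a (g + 1) * (max x 0) ^ (g + a) := by
  have hzero : ∀ S, 0 ≤ S → x ≤ S → S ≤ T →
      ∫ t in S..T, t ^ (a - 1) * (max (x - t) 0) ^ g = 0 := fun S hS0 hS hST => by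
    refine (intervalIntegral.integral_congr (g := fun _ => (0 : ℝ)) fun t ht => ?_).trans
      intervalIntegral.integral_zero
    rw [Set.uIcc_of_le hST] at ht
    beta_reduce
    rw [max_eq_right (by linarith [ht.1]), Real.zero_rpow hg.ne', mul_zero]
  rcases le_or_gt x 0 with hx0 | hx0
  · rw [hzero 0 le_rfl hx0 hT, max_eq_right hx0, Real.zero_rpow (by linarith), mul_zero]
  · rw [← intervalIntegral.integral_add_adjacent_intervals
      (intervalIntegrable_rpow_mul_posPow ha hg.le x 0 x)
      (intervalIntegrable_rpow_mul_posPow ha hg.le x x T), hzero x hx0.le le_rfl hx, add_zero,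
      max_eq_left hx0.le, ProbabilityTheory.beta_eq_betaIntegralReal _ _ ha (by linarith)]
    have h := Complex.betaIntegral_scaled a ((g + 1 : ℝ) : ℂ) hx0
    have h2 : ∫ t in (0 : ℝ)..x, (t : ℂ) ^ ((a : ℂ) - 1) *
        ((x : ℂ) - t) ^ (((g + 1 : ℝ) : ℂ) - 1) =
        ((∫ t in (0 : ℝ)..x, t ^ (a - 1) * (max (x - t) 0) ^ g : ℝ) : ℂ) := by
      rw [← intervalIntegral.integral_ofReal]
      refine intervalIntegral.integral_congr fun t ht => ?_
      rw [Set.uIcc_of_le hx0.le] at ht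
      rw [max_eq_left (by linarith [ht.2]), Complex.ofReal_mul, Complex.ofReal_cpow ht.1,
        Complex.ofReal_cpow (by linarith [ht.2])]
      push_cast
      ring_nf
    rw [h2, show (a : ℂ) + ((g + 1 : ℝ) : ℂ) - 1 = ((g + a : ℝ) : ℂ) by push_cast; ring,
      ← Complex.ofReal_cpow hx0.le] at h
    have h3 := congrArg Complex.re h
    rw [Complex.ofReal_re, Complex.re_ofReal_mul] at h3
    rw [h3, mul_comm]

/-- The Aizenman–Lieb monotonicity argument for finite families. -/
lemma sum_posPow_lift {I J : Type*} [Fintype I] [Fintype J] {g g' C a : ℝ} (hg : 0 < g)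
    (hg' : 0 < g') (ha : 0 < a) (x : I → ℝ) (y : J → ℝ)
    (h : ∀ t, 0 ≤ t → ∑ i, (max (x i - t) 0) ^ g ≤ C * ∑ j, (max (y j - t) 0) ^ g') :
    ProbabilityTheory.beta a (g + 1) * ∑ i, (max (x i) 0) ^ (g + a) ≤
      ProbabilityTheory.beta a (g' + 1) * (C * ∑ j, (max (y j) 0) ^ (g' + a)) := by
  obtain ⟨T, hT0, hTx, hTy⟩ : ∃ T, 0 ≤ T ∧ (∀ i, x i ≤ T) ∧ ∀ j, y j ≤ T := by
    refine ⟨∑ i, |x i| + ∑ j, |y j|, by positivity, fun i => ?_, fun j => ?_⟩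
    · have := Finset.single_le_sum (f := fun i => |x i|) (fun i _ => abs_nonneg _)
        (Finset.mem_univ i)
      have h2 : 0 ≤ ∑ j, |y j| := by positivity
      linarith [le_abs_self (x i)]
    · have := Finset.single_le_sum (f := fun i => |y i|) (fun i _ => abs_nonneg _)
        (Finset.mem_univ j)
      have h2 : 0 ≤ ∑ j, |x j| := by positivity
      linarith [le_abs_self (y j)]
  have e1 : ∫ t in (0 : ℝ)..T, ∑ i, t ^ (a - 1) * (max (x i - t) 0) ^ g =
      ProbabilityTheory.beta a (g + 1) * ∑ i, (max (x i) 0) ^ (g + a) := by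
    rw [intervalIntegral.integral_finset_sum fun i _ =>
      intervalIntegrable_rpow_mul_posPow ha hg.le _ _ _, Finset.mul_sum]
    exact Finset.sum_congr rfl fun i _ => integral_rpow_mul_posPow ha hg (hTx i) hT0
  have e2 : ∫ t in (0 : ℝ)..T, C * ∑ j, t ^ (a - 1) * (max (y j - t) 0) ^ g' =
      ProbabilityTheory.beta a (g' + 1) * (C * ∑ j, (max (y j) 0) ^ (g' + a)) := by
    rw [intervalIntegral.integral_const_mul, intervalIntegral.integral_finset_sum fun i _ =>
      intervalIntegrable_rpow_mul_posPow ha hg'.le _ _ _, Finset.sum_congr rfl fun i _ =>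
      integral_rpow_mul_posPow ha hg' (hTy i) hT0, ← Finset.mul_sum]
    ring
  rw [← e1, ← e2]
  refine intervalIntegral.integral_mono_on hT0 ?_ ?_ fun t ht => ?_
  · have := IntervalIntegrable.sum Finset.univ (f := fun i t => t ^ (a - 1) * (max (x i - t) 0) ^ g)
      (μ := volume) (a := 0) (b := T)
      fun i _ => intervalIntegrable_rpow_mul_posPow ha hg.le (x i) 0 T
    simpa only [Finset.sum_fn] using this
  · have := IntervalIntegrable.sum Finset.univ
      (f := fun i t => t ^ (a - 1) * (max (y i - t) 0) ^ g') (μ := volume) (a := 0) (b := T)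
      fun i _ => intervalIntegrable_rpow_mul_posPow ha hg'.le (y i) 0 T
    simpa only [Finset.sum_fn] using this.const_mul C
  · rw [← Finset.mul_sum, ← Finset.mul_sum, mul_left_comm]
    exact mul_le_mul_of_nonneg_left (h t ht.1) (Real.rpow_nonneg ht.1 _)

variable {ι : Type*} [Fintype ι] [DecidableEq ι] {L : ℕ}

lemma chain_sub_smul_one (b : Fin L → Matrix ι ι ℂ) (t : ℝ) :
    chain b - t • 1 = chain fun k => b k - t • 1 := by
  rw [chain, chain, add_sub_assoc]
  congr 1
  have : (fun k => b k - t • (1 : Matrix ι ι ℂ)) = b - t • (1 : Fin L → Matrix ι ι ℂ) := rfl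
  rw [this, blockDiagonal_sub, blockDiagonal_smul, blockDiagonal_one]

lemma rm_chain_lift {b : Fin L → Matrix ι ι ℂ} (hb : ∀ k, (b k).IsHermitian) {g a C : ℝ}
    (hg : 0 < g) (ha : 0 < a)
    (h : ∀ t : ℝ, 0 ≤ t → rm g (chain fun k => b k - t • 1) ≤
      C * ∑ k, rm (g + 1 / 2) (b k - t • 1)) :
    ProbabilityTheory.beta a (g + 1) * rm (g + a) (chain b) ≤
      ProbabilityTheory.beta a (g + 1 / 2 + 1) * (C * ∑ k, rm (g + a + 1 / 2) (b k)) := by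
  have e : ∀ F : Fin L → ι → ℝ, ∑ p : Fin L × ι, F p.1 p.2 = ∑ k, ∑ i, F k i :=
    Fintype.sum_prod_type'
  have key := sum_posPow_lift (C := C) hg (g' := g + 1 / 2) (by linarith) ha
    (isHermitian_chain hb).eigenvalues
    (fun p : Fin L × ι => (hb p.1).eigenvalues p.2) (fun t ht => by
      have := h t ht
      rw [← chain_sub_smul_one, rm_sub_smul_one hg (isHermitian_chain hb)] at this
      simp only [rm_sub_smul_one (by linarith : 0 < g + 1 / 2) (hb _)] at this
      rw [e fun k i => (max ((hb k).eigenvalues i - t) 0) ^ (g + 1 / 2)]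
      exact this)
  rw [e fun k i => (max ((hb k).eigenvalues i) 0) ^ (g + 1 / 2 + a)] at key
  simp only [rm, trF_eq (isHermitian_chain hb), trF_eq (hb _)]
  rw [add_right_comm g a]
  exact key

lemma isHermitian_sub_smul_one {A : Matrix ι ι ℂ} (hA : A.IsHermitian) (t : ℝ) :
    (A - t • (1 : Matrix ι ι ℂ)).IsHermitian :=
  hA.sub (isHermitian_one.smul (IsSelfAdjoint.all _))

lemma Lcl_pos {γ : ℝ} (hγ : 0 ≤ γ) (d : ℕ) : 0 < Lcl γ d := by
  have h1 := Real.Gamma_pos_of_pos (show 0 < γ + 1 by linarith)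
  have h2 := Real.Gamma_pos_of_pos (show 0 < γ + d / 2 + 1 by positivity)
  rw [Lcl]
  positivity

lemma Lcl_half : Lcl (1 / 2) 1 = 1 / 4 := by
  have h : Real.Gamma (1 / 2 + 1) = 1 / 2 * √Real.pi := by
    rw [Real.Gamma_add_one (by norm_num), Real.Gamma_one_half_eq]
  rw [Lcl, h, show (1 / 2 + ((1 : ℕ) : ℝ) / 2 + 1 : ℝ) = ((1 : ℕ) : ℝ) + 1 by norm_num,
    Real.Gamma_nat_eq_factorial, show ((1 : ℕ) : ℝ) / 2 = 1 / 2 by norm_num,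
    ← Real.sqrt_eq_rpow]
  have := Real.sqrt_pos.2 Real.pi_pos
  field_simp
  norm_num

lemma Lcl_three_halves : Lcl (3 / 2) 1 = 3 / 16 := by
  have h : Real.Gamma (3 / 2 + 1) = 3 / 2 * (1 / 2 * √Real.pi) := by
    rw [Real.Gamma_add_one (by norm_num), show (3 / 2 : ℝ) = 1 / 2 + 1 by norm_num,
      Real.Gamma_add_one (by norm_num), Real.Gamma_one_half_eq]
  rw [Lcl, h, show (3 / 2 + ((1 : ℕ) : ℝ) / 2 + 1 : ℝ) = ((2 : ℕ) : ℝ) + 1 by norm_num,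
    Real.Gamma_nat_eq_factorial, show ((1 : ℕ) : ℝ) / 2 = 1 / 2 by norm_num,
    ← Real.sqrt_eq_rpow]
  have := Real.sqrt_pos.2 Real.pi_pos
  field_simp
  norm_num [Nat.factorial]

lemma beta_ratio {g a : ℝ} (hg : 0 < g) (ha : 0 < a) :
    ProbabilityTheory.beta a (g + 1 / 2 + 1) * Lcl g 1 =
      ProbabilityTheory.beta a (g + 1) * Lcl (g + a) 1 := by
  rw [ProbabilityTheory.beta, ProbabilityTheory.beta, Lcl, Lcl,
    show a + (g + 1 / 2 + 1) = g + a + ((1 : ℕ) : ℝ) / 2 + 1 by push_cast; ring,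
    show a + (g + 1) = g + a + 1 by ring,
    show g + 1 / 2 + 1 = g + ((1 : ℕ) : ℝ) / 2 + 1 by push_cast; ring]
  have h1 := Real.Gamma_pos_of_pos (show 0 < g + a + 1 by positivity)
  have h2 := Real.Gamma_pos_of_pos (show 0 < g + a + ((1 : ℕ) : ℝ) / 2 + 1 by positivity)
  have h3 := Real.Gamma_pos_of_pos (show 0 < g + ((1 : ℕ) : ℝ) / 2 + 1 by positivity)
  have h4 : 0 < Real.pi ^ (((1 : ℕ) : ℝ) / 2) := by positivity
  field_simp

/-- One-dimensional lattice Lieb–Thirring inequality with twice the classical constant. -/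
lemma rm_chain_le_two {b : Fin L → Matrix ι ι ℂ} (hb : ∀ k, (b k).IsHermitian) {γ : ℝ}
    (hγ : 1 / 2 ≤ γ) :
    rm γ (chain b) ≤ 2 * Lcl γ 1 * ∑ k, rm (γ + 1 / 2) (b k) := by
  rcases hγ.eq_or_lt with rfl | hlt
  · rw [Lcl_half]
    convert rm_half_chain_le hb using 2
    norm_num
  · obtain ⟨a, ha, rfl⟩ : ∃ a, 0 < a ∧ γ = 1 / 2 + a := ⟨γ - 1 / 2, by linarith, by ring⟩
    have key := rm_chain_lift (C := 2 * Lcl (1 / 2) 1) hb (g := 1 / 2) (by norm_num) ha fun t _ => by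
      rw [Lcl_half]
      convert rm_half_chain_le fun k => isHermitian_sub_smul_one (hb k) t using 2
      norm_num
    have hβ := ProbabilityTheory.beta_pos ha (show (0 : ℝ) < 1 / 2 + 1 by norm_num)
    refine le_of_mul_le_mul_left (key.trans (le_of_eq ?_)) hβ
    have := beta_ratio (g := 1 / 2) (by norm_num) ha
    linear_combination (2 * ∑ k, rm (1 / 2 + a + 1 / 2) (b k)) * this

/-- One-dimensional lattice Lieb–Thirring inequality with almost sharp constant. -/
lemma rm_chain_le_one {b : Fin (L + 1) → Matrix ι ι ℂ} (hb : ∀ k, (b k).IsHermitian) {M : ℝ}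
    (hM : ∀ k v, quad (b k) v ≤ M * nsq v) (hM0 : 0 ≤ M) {γ : ℝ} (hγ : 3 / 2 ≤ γ) :
    rm γ (chain b) ≤ Lcl γ 1 * (1 + M / 3) * ∑ k, rm (γ + 1 / 2) (b k) := by
  rcases hγ.eq_or_lt with rfl | hlt
  · rw [Lcl_three_halves]
    exact rm_three_halves_chain_le hb hM hM0
  · obtain ⟨a, ha, rfl⟩ : ∃ a, 0 < a ∧ γ = 3 / 2 + a := ⟨γ - 3 / 2, by linarith, by ring⟩
    have key := rm_chain_lift (C := Lcl (3 / 2) 1 * (1 + M / 3)) hb (g := 3 / 2) (by norm_num) ha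
      fun t ht => by
        rw [Lcl_three_halves]
        refine rm_three_halves_chain_le (fun k => isHermitian_sub_smul_one (hb k) t)
          (fun k v => ?_) hM0
        rw [quad_sub, quad_smul, quad_one]
        nlinarith [hM k v, nsq_nonneg v]
    have hβ := ProbabilityTheory.beta_pos ha (show (0 : ℝ) < 3 / 2 + 1 by norm_num)
    refine le_of_mul_le_mul_left (key.trans (le_of_eq ?_)) hβ
    have := beta_ratio (g := 3 / 2) (by norm_num) ha
    linear_combination ((1 + M / 3) * ∑ k, rm (3 / 2 + a + 1 / 2) (b k)) * this

end betaLift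

section lattice

variable {ι : Type*} [Fintype ι] [DecidableEq ι] {L : ℕ}

/-- Splitting off the first lattice coordinate. -/
def splitIdx (ι : Type*) (d L : ℕ) :
    ι × (Fin (d + 1) → Fin L) ≃ (ι × (Fin d → Fin L)) × Fin L :=
  ((Equiv.refl ι).prodCongr ((Fin.consEquiv fun _ => Fin L).symm.trans
    (Equiv.prodComm _ _))).trans (Equiv.prodAssoc _ _ _).symm

/-- The discrete Schrödinger operator (with the sign changed) on the box `Fin d → Fin L` with
Dirichlet boundary conditions and matrix potential. -/
noncomputable def latH : (d : ℕ) → ((Fin d → Fin L) → Matrix ι ι ℂ) →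
    Matrix (ι × (Fin d → Fin L)) (ι × (Fin d → Fin L)) ℂ
  | 0, b => (b Fin.elim0).submatrix (Equiv.prodUnique ι (Fin 0 → Fin L))
      (Equiv.prodUnique ι (Fin 0 → Fin L))
  | d + 1, b => (chain fun k => latH d fun x => b (Fin.cons k x)).submatrix
      (splitIdx ι d L) (splitIdx ι d L)

lemma isHermitian_latH : ∀ {d : ℕ} {b : (Fin d → Fin L) → Matrix ι ι ℂ},
    (∀ x, (b x).IsHermitian) → (latH d b).IsHermitian
  | 0, _, hb => (hb _).submatrix _
  | _ + 1, _, hb => (isHermitian_chain fun _ => isHermitian_latH fun _ => hb _).submatrix _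

variable {m n : Type*} [Fintype m] [Fintype n]

lemma quad_submatrix (A : Matrix n n ℂ) (e : m ≃ n) (v : m → ℂ) :
    quad (A.submatrix e e) v = quad A (v ∘ e.symm) := by
  rw [quad, quad, submatrix_mulVec_equiv]
  congr 1
  simp only [dotProduct, Function.comp_apply]
  exact Fintype.sum_equiv e _ _ fun i => by simp

lemma nsq_comp (e : m ≃ n) (v : m → ℂ) : nsq (v ∘ e.symm) = nsq v :=
  Fintype.sum_equiv e.symm _ _ fun _ => rfl

lemma quad_ten_tri_nonpos (v : ι × Fin L → ℂ) :
    quad (ten ι (pathJ L - (2 : ℝ) • 1)) v ≤ 0 := by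
  have h := quad_ten_pathJ_le (z := 1) v
  have h2 := nsq_nonneg (ten ι (1 - (1 : ℝ) • shiftM L) *ᵥ v)
  rw [ten_sub, ten_smul, ten_one, quad_sub, quad_smul, quad_one]
  linarith

lemma quad_latH_le : ∀ {d : ℕ} {b : (Fin d → Fin L) → Matrix ι ι ℂ} {M : ℝ},
    (∀ x v, quad (b x) v ≤ M * nsq v) → ∀ v, quad (latH d b) v ≤ M * nsq v
  | 0, b, M, h, v => by
      rw [latH, quad_submatrix, ← nsq_comp (Equiv.prodUnique ι (Fin 0 → Fin L)) v]
      exact h _ _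
  | d + 1, b, M, h, v => by
      rw [latH, quad_submatrix, ← nsq_comp (splitIdx ι d L) v, chain, quad_add,
        quad_blockDiagonal]
      generalize v ∘ (splitIdx ι d L).symm = w
      have h1 : ∑ k, quad (latH d fun x => b (Fin.cons k x)) (fun i => w (i, k)) ≤
          ∑ k, M * nsq fun i => w (i, k) :=
        Finset.sum_le_sum fun k _ => quad_latH_le (fun x v => h _ v) _
      have h2 : ∑ k, M * nsq (fun i => w (i, k)) = M * nsq w := by
        rw [← Finset.mul_sum]
        simp only [nsq]
        rw [Fintype.sum_prod_type, Finset.sum_comm]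
      linarith [quad_ten_tri_nonpos w]

lemma rm_submatrix [DecidableEq m] [DecidableEq n] (γ : ℝ) (A : Matrix n n ℂ) (e : m ≃ n) :
    rm γ (A.submatrix e e) = rm γ A := trF_submatrix _ _ _

lemma Lcl_zero {γ : ℝ} (hγ : 0 ≤ γ) : Lcl γ 0 = 1 := by
  have h1 := Real.Gamma_pos_of_pos (show 0 < γ + 1 by linarith)
  rw [Lcl]
  simp [h1.ne']

lemma Lcl_succ {γ : ℝ} (hγ : 0 ≤ γ) (d : ℕ) : Lcl γ (d + 1) = Lcl γ 1 * Lcl (γ + 1 / 2) d := by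
  have h1 := Real.Gamma_pos_of_pos (show 0 < γ + 1 / 2 + 1 by positivity)
  have h2 := Real.Gamma_pos_of_pos (show 0 < γ + 1 / 2 + (d : ℝ) / 2 + 1 by positivity)
  rw [Lcl, Lcl, Lcl, show γ + ((d + 1 : ℕ) : ℝ) / 2 + 1 = γ + 1 / 2 + (d : ℝ) / 2 + 1 by
    push_cast; ring, show γ + ((1 : ℕ) : ℝ) / 2 + 1 = γ + 1 / 2 + 1 by push_cast; ring,
    show ((d + 1 : ℕ) : ℝ) / 2 = ((1 : ℕ) : ℝ) / 2 + (d : ℝ) / 2 by push_cast; ring,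
    Real.rpow_add Real.pi_pos, pow_add]
  field_simp

lemma sum_cons {d : ℕ} (F : (Fin (d + 1) → Fin L) → ℝ) :
    ∑ k, ∑ x : Fin d → Fin L, F (Fin.cons k x) = ∑ x, F x := by
  rw [← Fintype.sum_prod_type']
  exact Fintype.sum_equiv (Fin.consEquiv fun _ => Fin L) _ _ fun _ => rfl

lemma rm_latH_le_one {M : ℝ} (hM0 : 0 ≤ M) : ∀ {d : ℕ}
    {b : (Fin d → Fin (L + 1)) → Matrix ι ι ℂ}, (∀ x, (b x).IsHermitian) →
    (∀ x v, quad (b x) v ≤ M * nsq v) → ∀ {γ : ℝ}, 3 / 2 ≤ γ →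
    rm γ (latH d b) ≤ Lcl γ d * (1 + M / 3) ^ d * ∑ x, rm (γ + d / 2) (b x)
  | 0, b, hb, h, γ, hγ => by
      rw [latH, rm_submatrix, Lcl_zero (by linarith), Fintype.sum_unique]
      simp only [pow_zero, mul_one, one_mul, Nat.cast_zero, zero_div, add_zero]
      exact le_of_eq (congrArg _ (congrArg b (Subsingleton.elim _ _)))
  | d + 1, b, hb, h, γ, hγ => by
      rw [latH, rm_submatrix]
      refine (rm_chain_le_one (fun k => isHermitian_latH fun x => hb _)
        (fun k v => quad_latH_le (fun x v => h _ v) v) hM0 hγ).trans ?_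
      have hL := Lcl_pos (show 0 ≤ γ by linarith) 1
      have hk : ∑ k, rm (γ + 1 / 2) (latH d fun x => b (Fin.cons k x)) ≤
          ∑ k, Lcl (γ + 1 / 2) d * (1 + M / 3) ^ d *
            ∑ x : Fin d → Fin (L + 1), rm (γ + 1 / 2 + d / 2) (b (Fin.cons k x)) :=
        Finset.sum_le_sum fun k _ => rm_latH_le_one hM0 (fun x => hb _) (fun x => h _)
          (by linarith)
      refine (mul_le_mul_of_nonneg_left hk (by positivity)).trans (le_of_eq ?_)
      rw [← Finset.mul_sum, sum_cons fun x => rm (γ + 1 / 2 + d / 2) (b x),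
        Lcl_succ (by linarith) d, pow_succ,
        show γ + ((d + 1 : ℕ) : ℝ) / 2 = γ + 1 / 2 + (d : ℝ) / 2 by push_cast; ring]
      ring

/-- The lattice Lieb–Thirring inequality. -/
lemma rm_latH_le_four {M : ℝ} (hM0 : 0 ≤ M) {d : ℕ}
    {b : (Fin (d + 2) → Fin (L + 1)) → Matrix ι ι ℂ} (hb : ∀ x, (b x).IsHermitian)
    (h : ∀ x v, quad (b x) v ≤ M * nsq v) {γ : ℝ} (hγ : 1 / 2 ≤ γ) :
    rm γ (latH (d + 2) b) ≤
      4 * Lcl γ (d + 2) * (1 + M / 3) ^ d * ∑ x, rm (γ + (d + 2 : ℕ) / 2) (b x) := by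
  have step : ∀ {e : ℕ} {c : (Fin (e + 1) → Fin (L + 1)) → Matrix ι ι ℂ} {g C q : ℝ},
      (∀ x, (c x).IsHermitian) → 1 / 2 ≤ g →
      (∀ k, rm (g + 1 / 2) (latH e fun x => c (Fin.cons k x)) ≤
        C * ∑ x, rm q (c (Fin.cons k x))) →
      rm g (latH (e + 1) c) ≤ 2 * Lcl g 1 * (C * ∑ x, rm q (c x)) := by
    intro e c g C q hc hg hk
    rw [latH, rm_submatrix]
    refine (rm_chain_le_two (fun k => isHermitian_latH fun x => hc _) hg).trans ?_
    have hL := Lcl_pos (show 0 ≤ g by linarith) 1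
    refine mul_le_mul_of_nonneg_left ((Finset.sum_le_sum fun k _ => hk k).trans (le_of_eq ?_))
      (by positivity)
    rw [← Finset.mul_sum, sum_cons fun x => rm q (c x)]
  refine (step (C := 2 * Lcl (γ + 1 / 2) 1 * (Lcl (γ + 1 / 2 + 1 / 2) d * (1 + M / 3) ^ d))
    (q := γ + 1 / 2 + 1 / 2 + d / 2) hb hγ fun k => ?_).trans (le_of_eq ?_)
  · rw [mul_assoc (2 * Lcl (γ + 1 / 2) 1)]
    exact step (fun x => hb _) (by linarith) fun l =>
      rm_latH_le_one hM0 (fun x => hb _) (fun x => h _) (by linarith)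
  · rw [Lcl_succ (by linarith) (d + 1), Lcl_succ (by linarith) d,
      show γ + ((d + 2 : ℕ) : ℝ) / 2 = γ + 1 / 2 + 1 / 2 + (d : ℝ) / 2 by push_cast; ring]
    ring

end lattice

section latticeForm

variable {ι : Type*} [Fintype ι] [DecidableEq ι] {L d : ℕ}

/-- The box `Fin d → Fin L` as a subset of `ℤ^d`. -/
def emb (x : Fin d → Fin L) : Fin d → ℤ := fun j => ((x j : ℕ) : ℤ)

/-- The discrete Laplacian on `ℤ^d`. -/
noncomputable def dlap (f : (Fin d → ℤ) → ι → ℂ) (x : Fin d → ℤ) : ι → ℂ :=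
  ∑ j, (f (x + Pi.single j 1) + f (x - Pi.single j 1) - (2 : ℂ) • f x)

lemma sum_ite_eq_of_vanish {F : ℤ → ℂ} (hF : ∀ z, z < 0 ∨ (L : ℤ) ≤ z → F z = 0) (z : ℤ) :
    ∑ l : Fin L, (if ((l : ℕ) : ℤ) = z then F ((l : ℕ) : ℤ) else 0) = F z := by
  by_cases h : z < 0 ∨ (L : ℤ) ≤ z
  · rw [hF z h]
    refine Finset.sum_eq_zero fun l _ => if_neg fun e => ?_
    have := l.2
    omega
  · push Not at h
    have hz : z.toNat < L := by omega
    rw [Finset.sum_eq_single (⟨z.toNat, hz⟩ : Fin L)]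
    · have e : (((⟨z.toNat, hz⟩ : Fin L) : ℕ) : ℤ) = z := by simp [h.1]
      rw [if_pos e, e]
    · intro l _ hl
      refine if_neg fun e => hl (Fin.ext ?_)
      simp only
      omega
    · simp

lemma quad_ten_tri {F : ℤ → ι → ℂ} (hF : ∀ z, z < 0 ∨ (L : ℤ) ≤ z → F z = 0) :
    quad (ten ι (pathJ L - (2 : ℝ) • 1)) (fun p => F ((p.2 : ℕ) : ℤ) p.1) =
      ∑ k : Fin L, (star (F ((k : ℕ) : ℤ)) ⬝ᵥ
        (F (((k : ℕ) : ℤ) + 1) + F (((k : ℕ) : ℤ) - 1) - (2 : ℂ) • F ((k : ℕ) : ℤ))).re := by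
  have h1 : ∀ i (k : Fin L), (ten ι (pathJ L - (2 : ℝ) • 1) *ᵥ
      fun p => F ((p.2 : ℕ) : ℤ) p.1) (i, k) =
      (F (((k : ℕ) : ℤ) + 1) + F (((k : ℕ) : ℤ) - 1) - (2 : ℂ) • F ((k : ℕ) : ℤ)) i := by
    intro i k
    have hFi : ∀ z, z < 0 ∨ (L : ℤ) ≤ z → F z i = 0 := fun z hz => by rw [hF z hz]; rfl
    simp only [mulVec, dotProduct, ten, Fintype.sum_prod_type]
    rw [Finset.sum_eq_single i]
    · simp only [Pi.sub_apply, Pi.add_apply, Pi.smul_apply]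
      rw [← sum_ite_eq_of_vanish hFi (((k : ℕ) : ℤ) + 1),
        ← sum_ite_eq_of_vanish hFi (((k : ℕ) : ℤ) - 1), ← sum_ite_eq_of_vanish hFi ((k : ℕ) : ℤ),
        Finset.smul_sum, ← Finset.sum_add_distrib, ← Finset.sum_sub_distrib]
      refine Finset.sum_congr rfl fun l _ => ?_
      simp only [Matrix.kroneckerMap_apply, one_apply_eq, one_mul, Matrix.sub_apply, pathJ,
        Matrix.add_apply, shiftM, conjTranspose_apply, of_apply, Matrix.smul_apply, one_apply]
      have c1 : ((l : ℕ) : ℤ) = ((k : ℕ) : ℤ) + 1 ↔ (k : ℕ) + 1 = l := by omega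
      have c2 : ((l : ℕ) : ℤ) = ((k : ℕ) : ℤ) - 1 ↔ (l : ℕ) + 1 = k := by omega
      have c3 : ((l : ℕ) : ℤ) = ((k : ℕ) : ℤ) ↔ k = l := by rw [Fin.ext_iff]; omega
      simp only [c1, c2, c3]
      split_ifs <;> simp <;> ring
    · intro j _ hj
      refine Finset.sum_eq_zero fun l _ => ?_
      simp [one_apply_ne hj.symm]
    · simp
  simp only [quad, dotProduct]
  rw [Fintype.sum_prod_type, Finset.sum_comm, Complex.re_sum]
  refine Finset.sum_congr rfl fun k _ => ?_
  congr 1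
  refine Finset.sum_congr rfl fun i _ => ?_
  rw [h1 i k]
  rfl

lemma emb_cons (k : Fin L) (x : Fin d → Fin L) :
    emb (Fin.cons k x : Fin (d + 1) → Fin L) = Fin.cons ((k : ℕ) : ℤ) (emb x) := by
  funext j
  refine Fin.cases ?_ (fun j => ?_) j <;> simp [emb]

lemma cons_add_single_zero (z w : ℤ) (y : Fin d → ℤ) :
    (Fin.cons z y + Pi.single 0 w : Fin (d + 1) → ℤ) = Fin.cons (z + w) y := by
  funext j
  refine Fin.cases ?_ (fun j => ?_) j <;> simp

lemma cons_add_single_succ (z w : ℤ) (y : Fin d → ℤ) (k : Fin d) :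
    (Fin.cons z y + Pi.single k.succ w : Fin (d + 1) → ℤ) = Fin.cons z (y + Pi.single k w) := by
  funext j
  refine Fin.cases ?_ (fun j => ?_) j
  · simp [Pi.single_apply, (Fin.succ_ne_zero k).symm]
  · simp [Pi.single_apply]

lemma dlap_cons (f : (Fin (d + 1) → ℤ) → ι → ℂ) (z : ℤ) (y : Fin d → ℤ) :
    dlap f (Fin.cons z y) = (f (Fin.cons (z + 1) y) + f (Fin.cons (z - 1) y) -
      (2 : ℂ) • f (Fin.cons z y)) + dlap (fun y => f (Fin.cons z y)) y := by
  simp only [dlap, Fin.sum_univ_succ, sub_eq_add_neg _ (Pi.single _ _), ← Pi.single_neg,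
    cons_add_single_zero, cons_add_single_succ]
  rfl

lemma quad_latH : ∀ {d : ℕ} (b : (Fin d → Fin L) → Matrix ι ι ℂ) (f : (Fin d → ℤ) → ι → ℂ),
    (∀ x, (∃ j, x j < 0 ∨ (L : ℤ) ≤ x j) → f x = 0) →
    quad (latH d b) (fun p => f (emb p.2) p.1) =
      ∑ x, ((star (f (emb x)) ⬝ᵥ dlap f (emb x)).re + quad (b x) (f (emb x)))
  | 0, b, f, hf => by
      rw [latH, quad_submatrix, Fintype.sum_unique]
      simp only [dlap, Finset.univ_eq_empty, Finset.sum_empty, dotProduct_zero, Complex.zero_re,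
        zero_add]
      congr 1
  | d + 1, b, f, hf => by
      rw [latH, quad_submatrix, chain, quad_add, quad_blockDiagonal,
        ← sum_cons fun x => (star (f (emb x)) ⬝ᵥ dlap f (emb x)).re + quad (b x) (f (emb x))]
      have h1 : ∀ p, ((fun p : ι × (Fin (d + 1) → Fin L) => f (emb p.2) p.1) ∘
          (splitIdx ι d L).symm) p = f (Fin.cons ((p.2 : ℕ) : ℤ) (emb p.1.2)) p.1.1 := by
        intro p
        rw [← emb_cons]
        rfl
      simp only [h1]
      have h2 := quad_ten_tri (ι := ι × (Fin d → Fin L)) (L := L)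
        (F := fun z q => f (Fin.cons z (emb q.2)) q.1) fun z hz => by
          funext q
          rw [hf _ ⟨0, by simpa using hz⟩]
          rfl
      rw [funext h1, h2, ← Finset.sum_add_distrib]
      refine Finset.sum_congr rfl fun k _ => ?_
      rw [quad_latH (fun x => b (Fin.cons k x)) (fun y => f (Fin.cons ((k : ℕ) : ℤ) y))
        fun x hx => hf _ (by obtain ⟨j, hj⟩ := hx; exact ⟨j.succ, by simpa using hj⟩)]
      have h3 : ∀ G H : ι × (Fin d → Fin L) → ℂ, (star G ⬝ᵥ H).re =
          ∑ x : Fin d → Fin L, (star (fun i => G (i, x)) ⬝ᵥ fun i => H (i, x)).re := by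
        intro G H
        simp only [dotProduct, ← Complex.re_sum]
        rw [Fintype.sum_prod_type, Finset.sum_comm]
        rfl
      rw [h3, ← Finset.sum_add_distrib]
      refine Finset.sum_congr rfl fun x _ => ?_
      rw [emb_cons, dlap_cons, dotProduct_add, Complex.add_re, ← add_assoc]
      rfl

end latticeForm

section localization

variable {ι : Type*} [Fintype ι] [DecidableEq ι] {L d : ℕ}

lemma emb_injective : Function.Injective (emb : (Fin d → Fin L) → Fin d → ℤ) := fun x y h => by
  funext j
  have := congrFun h j
  simp only [emb, Nat.cast_inj] at this
  exact Fin.ext this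

lemma mem_range_emb {z : Fin d → ℤ} (h : ∀ i, 0 ≤ z i ∧ z i < L) :
    z ∈ Set.range (emb : (Fin d → Fin L) → Fin d → ℤ) := by
  refine ⟨fun i => ⟨(z i).toNat, by have := h i; omega⟩, ?_⟩
  funext i
  simp [emb, (h i).1]

lemma sum_emb_eq_tsum {G : (Fin d → ℤ) → ℝ} (hG : ∀ z, G z ≠ 0 → ∀ i, 0 ≤ z i ∧ z i < L) :
    ∑ x : Fin d → Fin L, G (emb x) = ∑' z, G z := by
  rw [← tsum_fintype (L := .unconditional _), emb_injective.tsum_eq]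
  exact fun z hz => mem_range_emb (hG z hz)

lemma sum_emb_shift {G : (Fin d → ℤ) → ℝ} (hG : ∀ z, G z ≠ 0 → ∀ i, 0 ≤ z i ∧ z i + 1 < L)
    (j : Fin d) :
    ∑ x : Fin d → Fin L, G (emb x - Pi.single j 1) = ∑ x : Fin d → Fin L, G (emb x) := by
  refine (sum_emb_eq_tsum (G := fun z => G (z - Pi.single j 1)) fun z hz i => ?_).trans
    (((Equiv.subRight (Pi.single j (1 : ℤ))).tsum_eq G).trans
      (sum_emb_eq_tsum fun z hz i => ⟨(hG z hz i).1, by linarith [(hG z hz i).2]⟩).symm)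
  have h := hG _ hz i
  simp only [Pi.sub_apply, Pi.single_apply] at h
  split_ifs at h <;> omega

lemma re_dotProduct_comm (a b : ι → ℂ) : (star a ⬝ᵥ b).re = (star b ⬝ᵥ a).re := by
  simp only [dotProduct, Complex.re_sum]
  refine Finset.sum_congr rfl fun i _ => ?_
  simp only [Pi.star_apply, RCLike.star_def, Complex.mul_re, Complex.conj_re, Complex.conj_im]
  ring

lemma two_re_dotProduct_le_nsq (a b : ι → ℂ) : 2 * (star a ⬝ᵥ b).re ≤ nsq a + nsq b := by
  simp only [dotProduct, Complex.re_sum, nsq, Finset.mul_sum, ← Finset.sum_add_distrib]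
  refine Finset.sum_le_sum fun i _ => ?_
  simp only [Pi.star_apply, RCLike.star_def, Complex.mul_re, Complex.conj_re, Complex.conj_im,
    Complex.normSq_apply]
  nlinarith [sq_nonneg ((a i).re - (b i).re), sq_nonneg ((a i).im - (b i).im)]

lemma re_star_smul_dotProduct (r s : ℝ) (a b : ι → ℂ) :
    (star ((r : ℂ) • a) ⬝ᵥ ((s : ℂ) • b)).re = r * s * (star a ⬝ᵥ b).re := by
  rw [star_smul, smul_dotProduct, dotProduct_smul, smul_eq_mul, smul_eq_mul, RCLike.star_def,
    Complex.conj_ofReal, Complex.re_ofReal_mul, Complex.re_ofReal_mul]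
  ring

/-- The discrete IMS localization formula. -/
lemma localization_le {φ : (Fin d → ℤ) → ι → ℂ} {χ : (Fin d → ℤ) → ℝ} {δ : ℝ}
    (hχ : ∀ x, χ x ≠ 0 → ∀ i, 1 ≤ x i ∧ x i + 2 ≤ L)
    (hδ : ∀ x j, |χ (x + Pi.single j 1) - χ x| ≤ δ) :
    (∑ x : Fin d → Fin L, χ (emb x) ^ 2 * (star (φ (emb x)) ⬝ᵥ dlap φ (emb x)).re) -
        d * δ ^ 2 * ∑ x : Fin d → Fin L, nsq (φ (emb x)) ≤
      ∑ x : Fin d → Fin L, (star ((χ (emb x) : ℂ) • φ (emb x)) ⬝ᵥ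
        dlap (fun z => (χ z : ℂ) • φ z) (emb x)).re := by
  set r : Fin d → (Fin d → ℤ) → ℝ := fun j x =>
    (star (φ x) ⬝ᵥ φ (x + Pi.single j 1)).re with hr
  have hr' : ∀ j x, (star (φ x) ⬝ᵥ φ (x - Pi.single j 1)).re = r j (x - Pi.single j 1) :=
    fun j x => by simp only [hr]; rw [re_dotProduct_comm, sub_add_cancel]
  have hn : ∀ x, (star (φ x) ⬝ᵥ φ x).re = nsq (φ x) := fun x => by
    rw [nsq_eq, Complex.ofReal_re]
  have e1 : ∀ x, (star (φ x) ⬝ᵥ dlap φ x).re =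
      ∑ j, (r j x + r j (x - Pi.single j 1) - 2 * nsq (φ x)) := fun x => by
    rw [dlap, dotProduct_sum, Complex.re_sum]
    refine Finset.sum_congr rfl fun j _ => ?_
    rw [dotProduct_sub, dotProduct_add, dotProduct_smul, Complex.sub_re, Complex.add_re, hr',
      smul_eq_mul, ← hn, show (2 : ℂ) = ((2 : ℝ) : ℂ) by norm_num, Complex.re_ofReal_mul]
  have e2 : ∀ x, (star ((χ x : ℂ) • φ x) ⬝ᵥ dlap (fun z => (χ z : ℂ) • φ z) x).re =
      ∑ j, (χ x * χ (x + Pi.single j 1) * r j x +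
        χ x * χ (x - Pi.single j 1) * r j (x - Pi.single j 1) - 2 * χ x ^ 2 * nsq (φ x)) :=
    fun x => by
    rw [dlap, dotProduct_sum, Complex.re_sum]
    refine Finset.sum_congr rfl fun j _ => ?_
    rw [dotProduct_sub, dotProduct_add, Complex.sub_re, Complex.add_re,
      re_star_smul_dotProduct, re_star_smul_dotProduct, hr', dotProduct_smul,
      smul_eq_mul, show (2 : ℂ) = ((2 : ℝ) : ℂ) by norm_num, Complex.re_ofReal_mul,
      re_star_smul_dotProduct, hn]
    ring
  simp only [e1, e2, Finset.mul_sum]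
  rw [Finset.sum_comm (s := (Finset.univ : Finset (Fin d → Fin L)))
      (t := (Finset.univ : Finset (Fin d))),
    Finset.sum_comm (s := (Finset.univ : Finset (Fin d → Fin L)))
      (t := (Finset.univ : Finset (Fin d))), sub_le_iff_le_add]
  have hd : ∑ x : Fin d → Fin L, ↑d * δ ^ 2 * nsq (φ (emb x)) =
      ∑ _j : Fin d, ∑ x : Fin d → Fin L, δ ^ 2 * nsq (φ (emb x)) := by
    rw [Finset.sum_const, Finset.card_univ, Fintype.card_fin, nsmul_eq_mul, Finset.mul_sum]
    exact Finset.sum_congr rfl fun x _ => by ring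
  rw [hd, ← Finset.sum_add_distrib]
  refine Finset.sum_le_sum fun j _ => ?_
  have hbox : ∀ z : Fin d → ℤ, (χ z ≠ 0 ∨ χ (z + Pi.single j 1) ≠ 0) →
      ∀ i, 0 ≤ z i ∧ z i + 1 < L := by
    rintro z (h | h) i
    · have := hχ z h i
      omega
    · have := hχ _ h i
      simp only [Pi.add_apply, Pi.single_apply] at this
      split_ifs at this <;> omega
  have s1 := sum_emb_shift (L := L) (G := fun z => (χ (z + Pi.single j 1) ^ 2 -
    χ (z + Pi.single j 1) * χ z) * r j z) (fun z hz => hbox z (Or.inr fun h => hz (by simp [h]))) j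
  have s2 := sum_emb_shift (L := L) (G := fun z => (χ (z + Pi.single j 1) - χ z) ^ 2 *
    nsq (φ (z + Pi.single j 1))) (fun z hz => hbox z (by
      by_contra! h
      exact hz (by simp [h.1, h.2]))) j
  simp only [sub_add_cancel] at s1 s2
  have s3 : ∑ x : Fin d → Fin L, (χ (emb x + Pi.single j 1) - χ (emb x)) ^ 2 * r j (emb x) ≤
      ∑ x : Fin d → Fin L, 1 / 2 * ((χ (emb x + Pi.single j 1) - χ (emb x)) ^ 2 * nsq (φ (emb x)))
       + ∑ x : Fin d → Fin L, 1 / 2 * ((χ (emb x + Pi.single j 1) - χ (emb x)) ^ 2 *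
        nsq (φ (emb x + Pi.single j 1))) := by
    rw [← Finset.sum_add_distrib]
    refine Finset.sum_le_sum fun x _ => ?_
    nlinarith [two_re_dotProduct_le_nsq (φ (emb x)) (φ (emb x + Pi.single j 1)),
      sq_nonneg (χ (emb x + Pi.single j 1) - χ (emb x))]
  rw [← Finset.mul_sum, ← Finset.mul_sum, ← s2] at s3
  have hsq : ∀ z, (χ (z + Pi.single j 1) - χ z) ^ 2 ≤ δ ^ 2 := fun z => by
    rw [← sq_abs]
    exact pow_le_pow_left₀ (abs_nonneg _) (hδ z j) 2
  have s4 : ∑ x : Fin d → Fin L, (χ (emb x + Pi.single j 1) - χ (emb x)) ^ 2 * nsq (φ (emb x)) ≤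
      ∑ x : Fin d → Fin L, δ ^ 2 * nsq (φ (emb x)) :=
    Finset.sum_le_sum fun x _ => mul_le_mul_of_nonneg_right (hsq _) (nsq_nonneg _)
  have s5 : ∑ x : Fin d → Fin L, (χ (emb x) - χ (emb x - Pi.single j 1)) ^ 2 * nsq (φ (emb x)) ≤
      ∑ x : Fin d → Fin L, δ ^ 2 * nsq (φ (emb x)) :=
    Finset.sum_le_sum fun x _ => mul_le_mul_of_nonneg_right (by
      have := hsq (emb x - Pi.single j 1)
      rwa [sub_add_cancel] at this) (nsq_nonneg _)
  have s6 : ∑ x : Fin d → Fin L, χ (emb x) ^ 2 *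
        (r j (emb x) + r j (emb x - Pi.single j 1) - 2 * nsq (φ (emb x))) =
      ∑ x : Fin d → Fin L, (χ (emb x) * χ (emb x + Pi.single j 1) * r j (emb x) +
        χ (emb x) * χ (emb x - Pi.single j 1) * r j (emb x - Pi.single j 1) -
        2 * χ (emb x) ^ 2 * nsq (φ (emb x))) +
      ∑ x : Fin d → Fin L, (χ (emb x + Pi.single j 1) - χ (emb x)) ^ 2 * r j (emb x) := by
    have : ∑ x : Fin d → Fin L, (χ (emb x + Pi.single j 1) - χ (emb x)) ^ 2 * r j (emb x) =
        ∑ x : Fin d → Fin L, ((χ (emb x) ^ 2 - χ (emb x) * χ (emb x + Pi.single j 1)) *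
          r j (emb x) + (χ (emb x) ^ 2 - χ (emb x) * χ (emb x - Pi.single j 1)) *
            r j (emb x - Pi.single j 1)) := by
      rw [Finset.sum_add_distrib, s1, ← Finset.sum_add_distrib]
      exact Finset.sum_congr rfl fun x _ => by ring
    rw [this, ← Finset.sum_add_distrib]
    exact Finset.sum_congr rfl fun x _ => by ring
  linarith

end localization

section perturbation

variable {n : Type*} [Fintype n] [DecidableEq n]

lemma quad_le_sum_norm (A : Matrix n n ℂ) (v : n → ℂ) :
    quad A v ≤ (∑ i, ∑ j, ‖A i j‖) * nsq v := by
  have h : ∀ i, ‖v i‖ ^ 2 ≤ nsq v := fun i => by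
    rw [← Complex.normSq_eq_norm_sq]
    exact Finset.single_le_sum (f := fun i => Complex.normSq (v i))
      (fun _ _ => Complex.normSq_nonneg _) (Finset.mem_univ i)
  simp only [quad, dotProduct, mulVec, Finset.mul_sum, Complex.re_sum, Finset.sum_mul]
  refine Finset.sum_le_sum fun i _ => Finset.sum_le_sum fun j _ => ?_
  refine (Complex.re_le_norm _).trans ?_
  rw [norm_mul, norm_mul, Pi.star_apply, norm_star]
  have h1 : ‖v i‖ * ‖v j‖ ≤ nsq v := by
    nlinarith [h i, h j, sq_nonneg (‖v i‖ - ‖v j‖)]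
  calc ‖v i‖ * (‖A i j‖ * ‖v j‖) = ‖A i j‖ * (‖v i‖ * ‖v j‖) := by ring
    _ ≤ _ := mul_le_mul_of_nonneg_left h1 (norm_nonneg _)

lemma rm_eq_of_posSemidef {A : Matrix n n ℂ} (hA : A.PosSemidef) (p : ℝ) :
    rm p A = ∑ i, hA.1.eigenvalues i ^ p := by
  rw [rm, trF_eq hA.1]
  exact Finset.sum_congr rfl fun i _ => by rw [max_eq_left (hA.eigenvalues_nonneg i)]

lemma rm_mono {p : ℝ} (hp : 0 < p) {A B : Matrix n n ℂ} (hA : A.IsHermitian)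
    (hB : B.IsHermitian) (h : ∀ v, quad A v ≤ quad B v) : rm p A ≤ rm p B :=
  trF_mono (monotone_posPow hp.le) (posPow_of_nonpos hp) hA hB h

lemma continuous_rm {X : Type*} [TopologicalSpace X] {p : ℝ} (hp : 0 < p) {A : X → Matrix n n ℂ}
    (hA : ∀ x, (A x).IsHermitian) (hc : Continuous A) : Continuous fun x => rm p (A x) := by
  rw [continuous_iff_continuousAt]
  intro x₀
  set η : X → ℝ := fun x => ∑ i, ∑ j, ‖A x i j - A x₀ i j‖
  have hη : Continuous η := by
    refine continuous_finset_sum _ fun i _ => continuous_finset_sum _ fun j _ => ?_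
    exact ((hc.matrix_elem i j).sub continuous_const).norm
  have hη0 : η x₀ = 0 := by simp [η]
  have hF : ∀ s : ℝ, Continuous fun x => rm p (A x₀ - (s * η x) • 1) := fun s => by
    simp only [rm_sub_smul_one hp (hA x₀)]
    refine continuous_finset_sum _ fun i _ => Continuous.rpow_const ?_ fun _ => Or.inr hp.le
    fun_prop
  have hlim : ∀ s : ℝ, Filter.Tendsto (fun x => rm p (A x₀ - (s * η x) • 1)) (nhds x₀)
      (nhds (rm p (A x₀))) := fun s => by
    have := (hF s).tendsto x₀
    rwa [hη0, mul_zero, zero_smul, sub_zero] at this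
  refine tendsto_of_tendsto_of_tendsto_of_le_of_le (hlim 1) (hlim (-1)) (fun x => ?_) fun x => ?_
  · refine rm_mono hp (isHermitian_sub_smul_one (hA _) _) (hA _) fun v => ?_
    rw [quad_sub, quad_smul, quad_one]
    have := quad_le_sum_norm (A x₀ - A x) v
    rw [quad_sub] at this
    simp only [Matrix.sub_apply, norm_sub_rev (A x₀ _ _)] at this
    change _ ≤ η x * _ at this
    linarith
  · refine rm_mono hp (hA _) (isHermitian_sub_smul_one (hA _) _) fun v => ?_
    rw [quad_sub, quad_smul, quad_one]
    have := quad_le_sum_norm (A x - A x₀) v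
    rw [quad_sub] at this
    simp only [Matrix.sub_apply] at this
    change _ ≤ η x * _ at this
    linarith

lemma rm_smul {p r : ℝ} (hp : 0 < p) (hr : 0 < r) {A : Matrix n n ℂ} (hA : A.IsHermitian) :
    rm p (r • A) = r ^ p * rm p A := by
  have hB : (r • A).IsHermitian := hA.smul (IsSelfAdjoint.all _)
  have hc : ∀ t, cnt (r • A) t = (((specR A).map (r * ·)).filter (t ≤ ·)).card := fun t => by
    have h1 : cnt (r • A) t = cnt A (t / r) := by
      apply le_antisymm
      · refine cnt_le_of_quad hB hA LinearMap.id Function.injective_id fun v hv => ?_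
        rw [quad_smul] at hv
        rw [LinearMap.id_apply, div_mul_eq_mul_div, div_le_iff₀' hr]
        exact hv
      · refine cnt_le_of_quad hA hB LinearMap.id Function.injective_id fun v hv => ?_
        rw [div_mul_eq_mul_div, div_le_iff₀' hr] at hv
        rw [LinearMap.id_apply, quad_smul]
        exact hv
    rw [h1, cnt, ← Multiset.countP_eq_card_filter, ← Multiset.countP_eq_card_filter,
      Multiset.countP_map, ← Multiset.countP_eq_card_filter]
    refine Multiset.countP_congr rfl fun x _ => ?_
    rw [div_le_iff₀' hr]
  have key : rm p (r • A) = (((specR A).map (r * ·)).map fun x => (max x 0) ^ p).sum :=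
    le_antisymm
      (multiset_sum_le_of_count (monotone_posPow hp.le) (posPow_of_nonpos hp) _ _
        fun t _ => (hc t).le)
      (multiset_sum_le_of_count (monotone_posPow hp.le) (posPow_of_nonpos hp) _ _
        fun t _ => (hc t).ge)
  rw [key, rm, trF_eq hA, specR_eq hA, Multiset.map_map, Multiset.map_map, Finset.mul_sum]
  change ∑ i, (max (r * hA.eigenvalues i) 0) ^ p = _
  refine Finset.sum_congr rfl fun i _ => ?_
  rw [← Real.mul_rpow hr.le (le_max_right _ _), mul_max_of_nonneg _ _ hr.le, mul_zero]

/-- Variational lower bound for Riesz means from a trial space. -/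
lemma sum_posPow_le_rm {N : ℕ} {A : Matrix n n ℂ} (hA : A.IsHermitian)
    (f : (Fin N → ℂ) →ₗ[ℂ] (n → ℂ)) {E : Fin N → ℝ} {a s ε γ : ℝ} (ha : 0 < a) (hs : 0 < s)
    (hε0 : 0 < ε) (hε1 : ε < 1) (hγ : 0 < γ) (h1 : ∀ c, a * ((1 - ε) * nsq c) ≤ nsq (f c))
    (h2 : ∀ c, nsq (f c) ≤ a * ((1 + ε) * nsq c))
    (h3 : ∀ c, a * s * (∑ j, E j * Complex.normSq (c j) - ε * nsq c) ≤ quad A (f c)) :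
    s ^ γ * ∑ j, (max ((E j - ε) / (1 + ε)) 0) ^ γ ≤ rm γ A := by
  have key : ((Finset.univ.val.map fun j => s * ((E j - ε) / (1 + ε))).map
      fun x => (max x 0) ^ γ).sum ≤ rm γ A := by
    refine multiset_sum_le_of_count (monotone_posPow hγ.le) (posPow_of_nonpos hγ) _ _
      fun t ht => ?_
    rw [← Multiset.countP_eq_card_filter, Multiset.countP_map]
    set P : Fin N → Prop := fun j => t ≤ s * ((E j - ε) / (1 + ε))
    set g : ({j // P j} → ℂ) →ₗ[ℂ] (Fin N → ℂ) := LinearMap.funLeft ℂ ℂ id ∘ₗ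
      { toFun := fun c j => if h : P j then c ⟨j, h⟩ else 0
        map_add' := fun c c' => by
          funext j
          by_cases h : P j <;> simp [h]
        map_smul' := fun r c => by
          funext j
          by_cases h : P j <;> simp [h] } with hg
    have hgP : ∀ c j, ¬ P j → g c j = 0 := fun c j h => by simp [hg, LinearMap.funLeft, h]
    have hginj : Function.Injective g := fun c c' h => by
      funext ⟨j, hj⟩
      have := congrFun h j
      simpa [hg, LinearMap.funLeft, hj] using this
    have hf : Function.Injective f := by
      rw [injective_iff_map_eq_zero]
      intro c hc
      have := h1 c
      rw [hc] at this
      have h0 : nsq (0 : n → ℂ) = 0 := by simp [nsq]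
      refine nsq_eq_zero (le_antisymm ?_ (nsq_nonneg c))
      by_contra hlt
      push Not at hlt
      have : 0 < a * ((1 - ε) * nsq c) := mul_pos ha (mul_pos (by linarith) hlt)
      linarith
    have := finrank_le_cnt hA (f ∘ₗ g) (hf.comp hginj) t fun c => by
      rw [LinearMap.comp_apply]
      refine le_trans ?_ (h3 (g c))
      have h4 : t * (1 + ε) * nsq (g c) ≤
          s * (∑ j, E j * Complex.normSq (g c j) - ε * nsq (g c)) := by
        rw [nsq, Finset.mul_sum, Finset.mul_sum, ← Finset.sum_sub_distrib, Finset.mul_sum]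
        refine Finset.sum_le_sum fun j _ => ?_
        by_cases hj : P j
        · have h5 : t * (1 + ε) ≤ s * (E j - ε) := by
            have : t ≤ s * ((E j - ε) / (1 + ε)) := hj
            rwa [← mul_div_assoc, le_div_iff₀ (by linarith)] at this
          nlinarith [Complex.normSq_nonneg (g c j)]
        · rw [hgP c j hj]
          simp
      calc t * nsq (f (g c)) ≤ t * (a * ((1 + ε) * nsq (g c))) :=
            mul_le_mul_of_nonneg_left (h2 _) ht.le
        _ = a * (t * (1 + ε) * nsq (g c)) := by ring
        _ ≤ a * (s * (∑ j, E j * Complex.normSq (g c j) - ε * nsq (g c))) :=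
            mul_le_mul_of_nonneg_left h4 ha.le
        _ = _ := by ring
    rw [Module.finrank_fintype_fun_eq_card, Fintype.card_subtype] at this
    exact this
  refine le_trans (le_of_eq ?_) key
  rw [Multiset.map_map, Finset.mul_sum]
  change _ = ∑ j, (max (s * ((E j - ε) / (1 + ε))) 0) ^ γ
  refine Finset.sum_congr rfl fun j _ => ?_
  rw [← Real.mul_rpow hs.le (le_max_right _ _), mul_max_of_nonneg _ _ hs.le, mul_zero]

end perturbation

section riemann

open Filter Topology

variable {d : ℕ}

/-- The point of `K⁻¹ ℤ^d` with integer coordinates `z`, translated so that `0` goes to the corner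
of the cube `[-ρ, ρ]^d`. -/
noncomputable def meshPt (ρ K : ℕ) (z : Fin d → ℤ) : EuclideanSpace ℝ (Fin d) :=
  WithLp.toLp 2 fun i => (z i : ℝ) / K - ρ

/-- The cube `[-ρ, ρ]^d`. -/
def cube (d ρ : ℕ) : Set (EuclideanSpace ℝ (Fin d)) := {x | ∀ i, |x i| ≤ ρ}

lemma meshPt_apply (ρ K : ℕ) (z : Fin d → ℤ) (i : Fin d) :
    meshPt ρ K z i = (z i : ℝ) / K - ρ := rfl

lemma cube_eq_preimage (ρ : ℕ) : cube d ρ =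
    WithLp.ofLp ⁻¹' (Set.Icc (fun _ => -(ρ : ℝ)) (fun _ => (ρ : ℝ)) : Set (Fin d → ℝ)) := by
  ext x
  simp only [cube, Set.mem_setOf_eq, Set.mem_preimage, Set.mem_Icc, Pi.le_def, abs_le]
  exact ⟨fun h => ⟨fun i => (h i).1, fun i => (h i).2⟩, fun h i => ⟨h.1 i, h.2 i⟩⟩

lemma isCompact_cube (ρ : ℕ) : IsCompact (cube d ρ) := by
  rw [cube_eq_preimage]
  exact (PiLp.homeomorph 2 (fun _ : Fin d => ℝ)).isCompact_preimage.2 isCompact_Icc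

lemma meshPt_emb_mem_cube {ρ K : ℕ} (hK : 0 < K) (p : Fin d → Fin (2 * ρ * K + 1)) :
    meshPt ρ K (emb p) ∈ cube d ρ := fun i => by
  have hK' : (0 : ℝ) < K := by exact_mod_cast hK
  have h1 : ((p i : ℕ) : ℝ) ≤ 2 * ρ * K := by exact_mod_cast Nat.lt_succ_iff.1 (p i).2
  have h2 : ((p i : ℕ) : ℝ) / K ≤ 2 * ρ := by rwa [div_le_iff₀ hK']
  have h3 : 0 ≤ ((p i : ℕ) : ℝ) / K := by positivity
  rw [meshPt_apply, abs_le]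
  simp only [emb, Int.cast_natCast]
  constructor <;> linarith

open scoped Pointwise in
lemma tendsto_riemann_sum (ρ : ℕ) {F : EuclideanSpace ℝ (Fin d) → ℝ} (hF : Continuous F) :
    Tendsto (fun K : ℕ => (∑ p : Fin d → Fin (2 * ρ * K + 1), F (meshPt ρ K (emb p))) / K ^ d)
      atTop (𝓝 (∫ x in cube d ρ, F x)) := by
  set s : Set (Fin d → ℝ) := Set.Icc (fun _ => -(ρ : ℝ)) (fun _ => (ρ : ℝ)) with hs
  have hG : Continuous fun y : Fin d → ℝ => F (WithLp.toLp 2 y) :=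
    hF.comp (PiLp.continuous_toLp 2 _)
  have key := tendsto_tsum_div_pow_atTop_integral s _ hG (Metric.isBounded_Icc _ _) measurableSet_Icc
    ((convex_Icc _ _).addHaar_frontier _)
  have hint : ∫ x in cube d ρ, F x = ∫ y in s, F (WithLp.toLp 2 y) := by
    rw [cube_eq_preimage, ← (EuclideanSpace.volume_preserving_symm_measurableEquiv_toLp
      (Fin d)).setIntegral_preimage_emb
      (MeasurableEquiv.toLp 2 (Fin d → ℝ)).symm.measurableEmbedding]
    rfl
  rw [hint]
  refine key.congr' ?_
  filter_upwards [eventually_gt_atTop 0] with K hK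
  have hK' : (0 : ℝ) < K := by exact_mod_cast hK
  haveI : NeZero K := ⟨hK.ne'⟩
  rw [Fintype.card_fin]
  congr 1
  set L : Set (Fin d → ℝ) := (K : ℝ)⁻¹ • (Submodule.span ℤ (Set.range (Pi.basisFun ℝ (Fin d))) :
    Set (Fin d → ℝ)) with hL
  have hmem : ∀ v, v ∈ L ↔ ∀ i, (K : ℝ) * v i ∈ Set.range (algebraMap ℤ ℝ) := fun v =>
    BoxIntegral.unitPartition.mem_smul_span_iff
  let f : (Fin d → Fin (2 * ρ * K + 1)) → ↑(s ∩ L) := fun p =>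
    ⟨WithLp.ofLp (meshPt ρ K (emb p)), by
      refine ⟨?_, (hmem _).2 fun i => ⟨(emb p) i - ρ * K, ?_⟩⟩
      · have := meshPt_emb_mem_cube hK p
        rw [cube_eq_preimage] at this
        exact this
      · simp only [eq_intCast, Int.cast_sub, Int.cast_mul, Int.cast_natCast, meshPt]
        field_simp⟩
  have hf : Function.Bijective f := by
    constructor
    · intro p q h
      refine emb_injective (funext fun i => ?_)
      have := congrFun (congrArg Subtype.val h) i
      simp only [f, meshPt, sub_left_inj] at this
      rw [div_left_inj' hK'.ne'] at this
      exact_mod_cast this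
    · rintro ⟨y, hy, hy'⟩
      choose w hw using (hmem y).1 hy'
      have hy1 : ∀ i, y i = (w i : ℝ) / K := fun i => by
        rw [eq_div_iff hK'.ne', mul_comm, ← hw i, eq_intCast]
      obtain ⟨p, hp⟩ : (fun i => w i + ρ * K) ∈
          Set.range (emb : (Fin d → Fin (2 * ρ * K + 1)) → Fin d → ℤ) := by
        refine mem_range_emb fun i => ?_
        have h1 := hy.1 i
        have h2 := hy.2 i
        simp only [hy1] at h1 h2
        rw [le_div_iff₀ hK'] at h1
        rw [div_le_iff₀ hK'] at h2
        have h1' : -(ρ : ℤ) * K ≤ w i := by exact_mod_cast h1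
        have h2' : w i ≤ (ρ : ℤ) * K := by exact_mod_cast h2
        push_cast
        constructor <;> linarith
      refine ⟨p, Subtype.ext (funext fun i => ?_)⟩
      simp only [f, meshPt, hp, hy1]
      push_cast
      field_simp
      ring
  rw [← (Equiv.ofBijective f hf).tsum_eq, tsum_fintype]
  rfl

end riemann

section secondDifference

open Filter Topology

variable {X : Type*} [NormedAddCommGroup X] [NormedSpace ℝ X]

lemma hasDerivAt_comp_line {g : X → ℂ} (hg : Differentiable ℝ g) (x e : X) (r s : ℝ) :
    HasDerivAt (fun s : ℝ => g (x + (r * s) • e)) ((r : ℂ) * fderiv ℝ g (x + (r * s) • e) e) s := by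
  have h1 : HasDerivAt (fun s : ℝ => x + (r * s) • e) (r • e) s := by
    simpa using (((hasDerivAt_id s).const_mul r).smul_const e).const_add x
  have := (hg (x + (r * s) • e)).hasFDerivAt.comp_hasDerivAt s h1
  rw [map_smul, Complex.real_smul] at this
  exact this

/-- Second difference quotients converge uniformly on compact sets. -/
lemma eventually_norm_second_difference_le {g : X → ℂ} (hg : ContDiff ℝ 2 g) (e : X) {S : Set X}
    (hS : IsCompact S) {ε : ℝ} (hε : 0 < ε) :
    ∀ᶠ t : ℝ in 𝓝[>] 0, ∀ x ∈ S, ‖g (x + t • e) + g (x - t • e) - 2 * g x -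
      (t : ℂ) ^ 2 * fderiv ℝ (fun y => fderiv ℝ g y e) x e‖ ≤ ε * t ^ 2 := by
  have hg1 : ContDiff ℝ 1 fun y => fderiv ℝ g y e :=
    (hg.fderiv_right (m := 1) (by norm_num)).clm_apply contDiff_const
  set D : X → ℂ := fun x => fderiv ℝ (fun y => fderiv ℝ g y e) x e with hD
  have hDc : Continuous D := (hg1.continuous_fderiv one_ne_zero).clm_apply continuous_const
  have hd0 : Differentiable ℝ g := hg.differentiable two_ne_zero
  have hd1 : Differentiable ℝ fun y => fderiv ℝ g y e := hg1.differentiable one_ne_zero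
  have hunif : ∀ᶠ s : ℝ in 𝓝 0, ∀ x ∈ S, ‖D (x + s • e) - D x‖ < ε / 2 := by
    refine hS.eventually_forall_of_forall_eventually fun x _ => ?_
    have hc : Continuous fun z : ℝ × X => ‖D (z.2 + z.1 • e) - D z.2‖ := by fun_prop
    refine hc.continuousAt.eventually_lt continuousAt_const ?_
    simpa using hε
  obtain ⟨δ, hδ, hδ'⟩ := Metric.eventually_nhds_iff.1 hunif
  filter_upwards [Ioo_mem_nhdsGT hδ] with t ht x hx
  have hDs : ∀ s ∈ Set.Icc 0 t, ∀ r : ℝ, |r| = 1 → ‖D (x + (r * s) • e) - D x‖ ≤ ε / 2 := by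
    intro s hs r hr
    refine (hδ' (y := r * s) ?_ x hx).le
    rw [Real.dist_eq, sub_zero, abs_mul, hr, one_mul, abs_of_nonneg hs.1]
    exact hs.2.trans_lt ht.2
  set h1 : ℝ → ℂ := fun s => (1 : ℝ) * fderiv ℝ g (x + (1 * s) • e) e +
    (-1 : ℝ) * fderiv ℝ g (x + (-1 * s) • e) e - 2 * s * D x with hh1
  have hder1 : ∀ s : ℝ, HasDerivAt h1 ((1 : ℝ) * ((1 : ℝ) * D (x + (1 * s) • e)) +
      (-1 : ℝ) * ((-1 : ℝ) * D (x + (-1 * s) • e)) - 2 * D x) s := fun s => by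
    have e3 : HasDerivAt (fun s : ℝ => 2 * (s : ℂ) * D x) (2 * D x) s := by
      simpa using ((Complex.ofRealCLM.hasDerivAt (x := s)).const_mul 2).mul_const (D x)
    exact (((hasDerivAt_comp_line hd1 x e 1 s).const_mul _).add
      ((hasDerivAt_comp_line hd1 x e (-1) s).const_mul _)).sub e3
  have hb1 : ∀ s ∈ Set.Icc 0 t, ‖h1 s‖ ≤ ε * t := by
    intro s hs
    have h0 : h1 0 = 0 := by simp [hh1]
    have := norm_image_sub_le_of_norm_deriv_le_segment' (a := 0) (b := t) (C := ε)
      (fun s _ => (hder1 s).hasDerivWithinAt) (fun s hs => ?_) s hs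
    · rw [h0, sub_zero, sub_zero] at this
      exact this.trans (mul_le_mul_of_nonneg_left hs.2 hε.le)
    · have a1 := hDs s ⟨hs.1, hs.2.le⟩ 1 (by norm_num)
      have a2 := hDs s ⟨hs.1, hs.2.le⟩ (-1) (by norm_num)
      refine le_trans (le_of_eq ?_) ((norm_add_le (D (x + (1 * s) • e) - D x)
        (D (x + (-1 * s) • e) - D x)).trans (by linarith [add_le_add a1 a2]))
      congr 1
      push_cast
      ring
  set h0 : ℝ → ℂ := fun s => g (x + (1 * s) • e) + g (x + (-1 * s) • e) - 2 * g x -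
    (s : ℂ) ^ 2 * D x with hh0
  have hder0 : ∀ s : ℝ, HasDerivAt h0 (h1 s) s := fun s => by
    have e3 : HasDerivAt (fun s : ℝ => (s : ℂ) ^ 2 * D x) (2 * s * D x) s := by
      simpa using ((Complex.ofRealCLM.hasDerivAt (x := s)).pow 2).mul_const (D x)
    exact (((hasDerivAt_comp_line hd0 x e 1 s).add
      (hasDerivAt_comp_line hd0 x e (-1) s)).sub_const _).sub e3
  have := norm_image_sub_le_of_norm_deriv_le_segment' (a := 0) (b := t) (C := ε * t)
    (fun s _ => (hder0 s).hasDerivWithinAt) (fun s hs => hb1 s ⟨hs.1, hs.2.le⟩) t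
    ⟨ht.1.le, le_rfl⟩
  have hz : h0 0 = 0 := by simp [hh0]; ring
  rw [hz, sub_zero, sub_zero] at this
  have ht2 : h0 t = g (x + t • e) + g (x - t • e) - 2 * g x - (t : ℂ) ^ 2 * D x := by
    simp [hh0, sub_eq_add_neg]
  rw [ht2] at this
  linarith

end secondDifference

section cutoff

open Filter Topology

variable {X : Type*} [NormedAddCommGroup X]

/-- A Lipschitz cutoff equal to `1` on the ball of radius `m` and to `0` off the ball of radius
`2 * m`. -/
noncomputable def cutoff (m : ℕ) (x : X) : ℝ := max 0 (min 1 (2 - ‖x‖ / m))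

lemma continuous_cutoff (m : ℕ) : Continuous (cutoff m : X → ℝ) := by
  unfold cutoff
  fun_prop

lemma cutoff_nonneg (m : ℕ) (x : X) : 0 ≤ cutoff m x := le_max_left _ _

lemma cutoff_le_one (m : ℕ) (x : X) : cutoff m x ≤ 1 := max_le zero_le_one (min_le_left _ _)

lemma norm_lt_of_cutoff_ne_zero {m : ℕ} (hm : 0 < m) {x : X} (h : cutoff m x ≠ 0) :
    ‖x‖ < 2 * m := by
  have hm' : (0 : ℝ) < m := by exact_mod_cast hm
  by_contra! h'
  refine h (max_eq_left ((min_le_right _ _).trans ?_))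
  rw [sub_nonpos, le_div_iff₀ hm']
  exact h'

lemma cutoff_eq_one {m : ℕ} {x : X} (h : ‖x‖ ≤ m) : cutoff m x = 1 := by
  have : ‖x‖ / m ≤ 1 := div_le_one_of_le₀ h (Nat.cast_nonneg _)
  rw [cutoff, min_eq_left (by linarith), max_eq_right zero_le_one]

lemma abs_cutoff_sub_le (m : ℕ) (x y : X) : |cutoff m x - cutoff m y| ≤ ‖x - y‖ / m := by
  have h1 : |cutoff m x - cutoff m y| ≤ |(2 - ‖x‖ / m) - (2 - ‖y‖ / m)| := by
    unfold cutoff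
    rw [max_comm, max_comm (0 : ℝ) (min _ (2 - ‖y‖ / m))]
    refine (abs_max_sub_max_le_abs _ _ _).trans ((abs_min_sub_min_le_max _ _ _ _).trans ?_)
    simp
  refine h1.trans ?_
  rw [show (2 - ‖x‖ / m) - (2 - ‖y‖ / m) = (‖y‖ - ‖x‖) / m by ring, abs_div,
    abs_of_nonneg (Nat.cast_nonneg (α := ℝ) m), norm_sub_rev]
  exact div_le_div_of_nonneg_right (abs_norm_sub_norm_le y x) (Nat.cast_nonneg _)

end cutoff

section forms

open Filter Topology

variable {N : ℕ} {P ι : Type*} [Fintype P] [Fintype ι] [DecidableEq ι]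

/-- The averaged weighted Gram matrix of two families of vector-valued functions. -/
noncomputable def wgram (a : ℝ) (w : P → ℝ) (u v : Fin N → P → ι → ℂ) :
    Matrix (Fin N) (Fin N) ℂ :=
  fun j l => (∑ p, (w p : ℂ) * (star (u j p) ⬝ᵥ v l p)) / (a : ℂ)

lemma sum_re_dotProduct_eq_quad {a : ℝ} (ha : a ≠ 0) (w : P → ℝ) (u v : Fin N → P → ι → ℂ)
    (c : Fin N → ℂ) :
    ∑ p, w p * (star (∑ j, c j • u j p) ⬝ᵥ ∑ l, c l • v l p).re =
      a * quad (wgram a w u v) c := by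
  have h : (a : ℂ) * (star c ⬝ᵥ wgram a w u v *ᵥ c) =
      ∑ p, (w p : ℂ) * (star (∑ j, c j • u j p) ⬝ᵥ ∑ l, c l • v l p) := by
    have ha' : (a : ℂ) ≠ 0 := by exact_mod_cast ha
    have e : ∀ p, (w p : ℂ) * (star (∑ j, c j • u j p) ⬝ᵥ ∑ l, c l • v l p) =
        ∑ j, ∑ l, star (c j) * c l * ((w p : ℂ) * (star (u j p) ⬝ᵥ v l p)) := fun p => by
      rw [star_sum, sum_dotProduct, Finset.mul_sum]
      refine Finset.sum_congr rfl fun j _ => ?_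
      rw [dotProduct_sum, Finset.mul_sum]
      refine Finset.sum_congr rfl fun l _ => ?_
      rw [star_smul, smul_dotProduct, dotProduct_smul, smul_eq_mul, smul_eq_mul]
      ring
    simp_rw [e]
    rw [Finset.sum_comm]
    simp only [dotProduct, mulVec, wgram, Finset.mul_sum, Pi.star_apply]
    refine Finset.sum_congr rfl fun j _ => ?_
    rw [Finset.sum_comm]
    refine Finset.sum_congr rfl fun l _ => ?_
    simp only [Finset.sum_div, Finset.sum_mul, Finset.mul_sum]
    refine Finset.sum_congr rfl fun p _ => Finset.sum_congr rfl fun i _ => ?_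
    field_simp
  have h2 := congrArg Complex.re h
  rw [Complex.re_ofReal_mul, Complex.re_sum] at h2
  simp only [Complex.re_ofReal_mul] at h2
  exact h2.symm

lemma eventually_abs_quad_sub_le {κ : Type*} {F : Filter κ} {a : κ → Matrix (Fin N) (Fin N) ℂ}
    {A : Matrix (Fin N) (Fin N) ℂ} (h : Tendsto a F (𝓝 A)) {ε : ℝ} (hε : 0 < ε) :
    ∀ᶠ k in F, ∀ c, |quad (a k) c - quad A c| ≤ ε * nsq c := by
  have hc : Continuous fun B : Matrix (Fin N) (Fin N) ℂ => ∑ i, ∑ j, ‖(B - A) i j‖ := by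
    simp only [Matrix.sub_apply]
    fun_prop
  have h0 := ((hc.tendsto A).comp h).eventually_lt_const (u := ε) (by simpa using hε)
  filter_upwards [h0] with k hk c
  simp only [Function.comp_apply] at hk
  have h1 := quad_le_sum_norm (a k - A) c
  have h2 := quad_le_sum_norm (A - a k) c
  rw [quad_sub] at h1 h2
  simp only [Matrix.sub_apply] at h1 h2 hk
  have hk' : ∑ i, ∑ j, ‖A i j - a k i j‖ < ε := by
    simpa only [norm_sub_rev] using hk
  rw [abs_le]
  constructor <;> nlinarith [nsq_nonneg c]

lemma quad_diagonal (E : Fin N → ℝ) (c : Fin N → ℂ) :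
    quad (Matrix.diagonal fun j => (E j : ℂ)) c = ∑ j, E j * Complex.normSq (c j) := by
  simp only [quad, dotProduct, mulVec_diagonal, Complex.re_sum]
  refine Finset.sum_congr rfl fun j _ => ?_
  simp only [Pi.star_apply, RCLike.star_def, Complex.mul_re, Complex.conj_re, Complex.conj_im,
    Complex.normSq_apply, Complex.ofReal_re, Complex.ofReal_im, Complex.mul_im]
  ring

end forms

section limits

open Filter Topology

variable {d : ℕ}

lemma tendsto_riemann_sum_complex (ρ : ℕ) {F : EuclideanSpace ℝ (Fin d) → ℂ}
    (hF : Continuous F) :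
    Tendsto (fun K : ℕ => (∑ p : Fin d → Fin (2 * ρ * K + 1), F (meshPt ρ K (emb p))) /
      (((K : ℝ) ^ d : ℝ) : ℂ)) atTop (𝓝 (∫ x in cube d ρ, F x)) := by
  have h1 := tendsto_riemann_sum ρ (Complex.continuous_re.comp hF)
  have h2 := tendsto_riemann_sum ρ (Complex.continuous_im.comp hF)
  have hi : IntegrableOn F (cube d ρ) := hF.continuousOn.integrableOn_compact (isCompact_cube ρ)
  rw [← integral_re_add_im hi]
  have h3 := ((Complex.continuous_ofReal.tendsto _).comp h1).add
    (((Complex.continuous_ofReal.tendsto _).comp h2).mul_const Complex.I)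
  refine h3.congr fun K => ?_
  simp only [Function.comp_apply]
  rw [← Complex.re_add_im (((∑ p : Fin d → Fin (2 * ρ * K + 1), F (meshPt ρ K (emb p)))) /
    (((K : ℝ) ^ d : ℝ) : ℂ)), Complex.div_ofReal_re, Complex.div_ofReal_im, Complex.re_sum,
    Complex.im_sum]

lemma tendsto_setIntegral_cube {F : EuclideanSpace ℝ (Fin d) → ℂ} (hF : Integrable F)
    {w : ℕ → EuclideanSpace ℝ (Fin d) → ℝ} (hwc : ∀ m, Continuous (w m))
    (hw0 : ∀ m x, 0 ≤ w m x) (hw1 : ∀ m x, w m x ≤ 1) (hw : ∀ (m : ℕ) x, ‖x‖ ≤ m → w m x = 1) :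
    Tendsto (fun m : ℕ => ∫ x in cube d (2 * m + 1), (w m x : ℂ) * F x) atTop
      (𝓝 (∫ x, F x)) := by
  simp_rw [← integral_indicator (isCompact_cube _).measurableSet]
  refine tendsto_integral_of_dominated_convergence (fun x => ‖F x‖) (fun m => ?_) hF.norm
    (fun m => Eventually.of_forall fun x => ?_) (Eventually.of_forall fun x => ?_)
  · refine AEStronglyMeasurable.indicator ?_ (isCompact_cube _).measurableSet
    exact (Complex.continuous_ofReal.comp (hwc m)).aestronglyMeasurable.mul hF.1
  · refine (norm_indicator_le_norm_self _ _).trans ?_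
    rw [norm_mul, Complex.norm_real, Real.norm_of_nonneg (hw0 m x)]
    exact mul_le_of_le_one_left (norm_nonneg _) (hw1 m x)
  · refine tendsto_const_nhds.congr' ?_
    filter_upwards [eventually_ge_atTop ⌈‖x‖⌉₊] with m hm
    have hm' : ‖x‖ ≤ m := (Nat.le_ceil _).trans (by exact_mod_cast hm)
    rw [Set.indicator_of_mem, hw m x hm', Complex.ofReal_one, one_mul]
    intro i
    have := (PiLp.norm_apply_le x i).trans hm'
    rw [Real.norm_eq_abs] at this
    push_cast
    linarith [norm_nonneg x]

end limits

section discreteLaplacian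

open Filter Topology

variable {d : ℕ} {ι : Type*} [Fintype ι] [DecidableEq ι]

lemma meshPt_add_single {ρ K : ℕ} (z : Fin d → ℤ) (j : Fin d) :
    meshPt ρ K (z + Pi.single j 1) =
      meshPt ρ K z + (K : ℝ)⁻¹ • EuclideanSpace.single j (1 : ℝ) := by
  ext i
  simp only [PiLp.add_apply, PiLp.smul_apply, meshPt_apply, Pi.add_apply, Pi.single_apply,
    PiLp.single_apply, smul_eq_mul]
  split_ifs <;> push_cast <;> ring

lemma meshPt_sub_single {ρ K : ℕ} (z : Fin d → ℤ) (j : Fin d) :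
    meshPt ρ K (z - Pi.single j 1) =
      meshPt ρ K z - (K : ℝ)⁻¹ • EuclideanSpace.single j (1 : ℝ) := by
  rw [eq_sub_iff_add_eq, ← meshPt_add_single, sub_add_cancel]

lemma tendsto_inv_natCast_nhdsGT : Tendsto (fun K : ℕ => (K : ℝ)⁻¹) atTop (𝓝[>] 0) :=
  tendsto_inv_atTop_nhdsGT_zero.comp tendsto_natCast_atTop_atTop

lemma eventually_norm_dlap_sub_lap_le {g : EuclideanSpace ℝ (Fin d) → ι → ℂ}
    (hg : ∀ i, ContDiff ℝ 2 fun x => g x i) (ρ : ℕ) {ε : ℝ} (hε : 0 < ε) :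
    ∀ᶠ K : ℕ in atTop, ∀ (p : Fin d → Fin (2 * ρ * K + 1)) (i : ι),
      ‖(K : ℂ) ^ 2 * dlap (fun z => g (meshPt ρ K z)) (emb p) i -
        lap (fun y => g y i) (meshPt ρ K (emb p))‖ ≤ ε := by
  have hd : (0 : ℝ) < d + 1 := by positivity
  have h : ∀ᶠ K : ℕ in atTop, ∀ (j : Fin d) (i : ι), ∀ x ∈ cube d ρ,
      ‖g (x + (K : ℝ)⁻¹ • EuclideanSpace.single j (1 : ℝ)) i +
        g (x - (K : ℝ)⁻¹ • EuclideanSpace.single j (1 : ℝ)) i - 2 * g x i -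
        (((K : ℝ)⁻¹ : ℝ) : ℂ) ^ 2 * fderiv ℝ (fun y => fderiv ℝ (fun x => g x i) y
          (EuclideanSpace.single j (1 : ℝ))) x (EuclideanSpace.single j (1 : ℝ))‖ ≤
        ε / (d + 1) * ((K : ℝ)⁻¹) ^ 2 := by
    simp only [eventually_all]
    intro j i
    exact tendsto_inv_natCast_nhdsGT.eventually (eventually_norm_second_difference_le (hg i)
      (EuclideanSpace.single j (1 : ℝ)) (isCompact_cube ρ) (div_pos hε hd))
  filter_upwards [h, eventually_gt_atTop 0] with K hK hK0 p i
  have hK' : (K : ℂ) ≠ 0 := by exact_mod_cast hK0.ne'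
  have hK'' : (K : ℝ) ≠ 0 := by exact_mod_cast hK0.ne'
  have hx := meshPt_emb_mem_cube (ρ := ρ) hK0 p
  set x := meshPt ρ K (emb p) with hxd
  have e : (K : ℂ) ^ 2 * dlap (fun z => g (meshPt ρ K z)) (emb p) i - lap (fun y => g y i) x =
      ∑ j, (K : ℂ) ^ 2 * (g (x + (K : ℝ)⁻¹ • EuclideanSpace.single j (1 : ℝ)) i +
        g (x - (K : ℝ)⁻¹ • EuclideanSpace.single j (1 : ℝ)) i - 2 * g x i -
        (((K : ℝ)⁻¹ : ℝ) : ℂ) ^ 2 * fderiv ℝ (fun y => fderiv ℝ (fun x => g x i) y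
          (EuclideanSpace.single j (1 : ℝ))) x (EuclideanSpace.single j (1 : ℝ))) := by
    rw [dlap, lap, Finset.sum_apply, Finset.mul_sum, ← Finset.sum_sub_distrib]
    refine Finset.sum_congr rfl fun j _ => ?_
    simp only [meshPt_add_single, meshPt_sub_single, Pi.sub_apply, Pi.add_apply, Pi.smul_apply,
      smul_eq_mul, ← hxd]
    push_cast
    field_simp
  rw [e]
  refine (norm_sum_le_of_le _ (f := _) (fun j _ => ?_ : ∀ j ∈ Finset.univ, _ ≤ ε / (d + 1))).trans
    ?_
  · rw [norm_mul, norm_pow, Complex.norm_natCast]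
    refine (mul_le_mul_of_nonneg_left (hK j i x hx) (by positivity)).trans (le_of_eq ?_)
    field_simp
  · rw [Finset.sum_const, Finset.card_univ, Fintype.card_fin, nsmul_eq_mul, mul_div_assoc',
      div_le_iff₀ hd]
    nlinarith

end discreteLaplacian

section continuumForms

open Filter Topology

variable {d n N : ℕ}

/-- The averaged Gram matrix of the functions `ψ j` sampled on the mesh. -/
noncomputable def meshGram (w : EuclideanSpace ℝ (Fin d) → ℝ)
    (ψ : Fin N → EuclideanSpace ℝ (Fin d) → Fin n → ℂ) (ρ K : ℕ) : Matrix (Fin N) (Fin N) ℂ :=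
  wgram ((K : ℝ) ^ d) (fun p : Fin d → Fin (2 * ρ * K + 1) => w (meshPt ρ K (emb p)))
    (fun j p => ψ j (meshPt ρ K (emb p))) (fun j p => ψ j (meshPt ρ K (emb p)))

/-- The finite difference approximation of the matrix of `Δ - V`. -/
noncomputable def meshHam (w : EuclideanSpace ℝ (Fin d) → ℝ)
    (V : EuclideanSpace ℝ (Fin d) → Matrix (Fin n) (Fin n) ℂ)
    (ψ : Fin N → EuclideanSpace ℝ (Fin d) → Fin n → ℂ) (ρ K : ℕ) : Matrix (Fin N) (Fin N) ℂ :=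
  wgram ((K : ℝ) ^ d) (fun p : Fin d → Fin (2 * ρ * K + 1) => w (meshPt ρ K (emb p)))
    (fun j p => ψ j (meshPt ρ K (emb p)))
    (fun l p => (K : ℂ) ^ 2 • dlap (fun z => ψ l (meshPt ρ K z)) (emb p) +
      (-(V (meshPt ρ K (emb p)))) *ᵥ ψ l (meshPt ρ K (emb p)))

/-- The weighted Gram matrix of the functions `ψ j` over a cube. -/
noncomputable def cubeGram (w : EuclideanSpace ℝ (Fin d) → ℝ)
    (ψ : Fin N → EuclideanSpace ℝ (Fin d) → Fin n → ℂ) (ρ : ℕ) : Matrix (Fin N) (Fin N) ℂ :=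
  fun j l => ∫ x in cube d ρ, (w x : ℂ) * (star (ψ j x) ⬝ᵥ ψ l x)

variable {V : EuclideanSpace ℝ (Fin d) → Matrix (Fin n) (Fin n) ℂ}
  {ψ : Fin N → EuclideanSpace ℝ (Fin d) → Fin n → ℂ} {E : Fin N → ℝ}
  {w : EuclideanSpace ℝ (Fin d) → ℝ}

lemma continuous_star_dotProduct (hψ : ∀ j, Continuous (ψ j)) (j l : Fin N) :
    Continuous fun x => star (ψ j x) ⬝ᵥ ψ l x :=
  (continuous_star.comp (hψ j)).dotProduct (hψ l)

lemma tendsto_meshGram (hw : Continuous w) (hψ : ∀ j, Continuous (ψ j)) (ρ : ℕ) :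
    Tendsto (meshGram w ψ ρ) atTop (𝓝 (cubeGram w ψ ρ)) := by
  refine tendsto_pi_nhds.2 fun j => tendsto_pi_nhds.2 fun l => ?_
  have hF : Continuous fun x => (w x : ℂ) * (star (ψ j x) ⬝ᵥ ψ l x) :=
    (Complex.continuous_ofReal.comp hw).mul (continuous_star_dotProduct hψ j l)
  exact (tendsto_riemann_sum_complex ρ hF).congr fun K => rfl

lemma tendsto_meshHam (hw : Continuous w) (hψ : ∀ j i, ContDiff ℝ 2 fun x => ψ j x i)
    (heq : ∀ j x i, -(lap (fun y => ψ j y i) x) + (V x *ᵥ ψ j x) i = -(E j : ℂ) * ψ j x i)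
    (ρ : ℕ) :
    Tendsto (meshHam w V ψ ρ) atTop (𝓝 fun j l => (E l : ℂ) * cubeGram w ψ ρ j l) := by
  have hψc : ∀ j, Continuous (ψ j) := fun j => continuous_pi fun i => (hψ j i).continuous
  refine tendsto_pi_nhds.2 fun j => tendsto_pi_nhds.2 fun l => ?_
  have hG := (tendsto_pi_nhds.1 (tendsto_pi_nhds.1 (tendsto_meshGram hw hψc ρ) j) l).const_mul
    (E l : ℂ)
  suffices h : Tendsto (fun K => meshHam w V ψ ρ K j l - (E l : ℂ) * meshGram w ψ ρ K j l) atTop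
      (𝓝 0) by
    simpa using h.add hG
  have hF : Continuous fun x => |w x| * ∑ i, ‖ψ j x i‖ := by
    have := fun i => (hψ j i).continuous
    fun_prop
  have hS := tendsto_riemann_sum ρ hF
  set I := ∫ x in cube d ρ, |w x| * ∑ i, ‖ψ j x i‖ with hI
  have hI0 : 0 ≤ I := integral_nonneg fun x => by positivity
  refine Metric.tendsto_nhds.2 fun ε hε => ?_
  filter_upwards [hS.eventually_lt_const (lt_add_one I), eventually_gt_atTop 0,
    eventually_norm_dlap_sub_lap_le (hψ l) ρ (ε := ε / (I + 2)) (by positivity)] with K h1 hK h2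
  have hK' : (0 : ℝ) < (K : ℝ) ^ d := by positivity
  have e : meshHam w V ψ ρ K j l - (E l : ℂ) * meshGram w ψ ρ K j l =
      (∑ p : Fin d → Fin (2 * ρ * K + 1), (w (meshPt ρ K (emb p)) : ℂ) *
        ∑ i, star (ψ j (meshPt ρ K (emb p)) i) *
          ((K : ℂ) ^ 2 * dlap (fun z => ψ l (meshPt ρ K z)) (emb p) i -
            lap (fun y => ψ l y i) (meshPt ρ K (emb p)))) / (((K : ℝ) ^ d : ℝ) : ℂ) := by
    rw [meshHam, meshGram, wgram, wgram, mul_div_assoc', ← sub_div, Finset.mul_sum,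
      ← Finset.sum_sub_distrib]
    congr 1
    refine Finset.sum_congr rfl fun p _ => ?_
    rw [mul_left_comm, ← mul_sub]
    congr 1
    simp only [dotProduct, Finset.mul_sum, ← Finset.sum_sub_distrib, Pi.star_apply, Pi.add_apply,
      Pi.smul_apply, smul_eq_mul, neg_mulVec, Pi.neg_apply]
    refine Finset.sum_congr rfl fun i _ => ?_
    linear_combination (-star (ψ j (meshPt ρ K (emb p)) i)) * heq l (meshPt ρ K (emb p)) i
  have hI2 : (I + 1) * (ε / (I + 2)) < ε := by
    rw [mul_div_assoc', div_lt_iff₀ (by positivity)]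
    nlinarith
  rw [dist_zero_right, e, norm_div, Complex.norm_real, Real.norm_of_nonneg hK'.le]
  refine lt_of_le_of_lt ?_ (lt_of_le_of_lt (mul_le_mul_of_nonneg_right h1.le (by positivity)) hI2)
  rw [div_mul_eq_mul_div]
  refine div_le_div_of_nonneg_right ?_ hK'.le
  rw [Finset.sum_mul]
  refine norm_sum_le_of_le _ fun p _ => ?_
  rw [norm_mul, Complex.norm_real, Real.norm_eq_abs, mul_assoc |_|, Finset.sum_mul]
  refine mul_le_mul_of_nonneg_left (norm_sum_le_of_le _ fun i _ => ?_) (abs_nonneg _)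
  rw [norm_mul, norm_star]
  exact mul_le_mul_of_nonneg_left (h2 p i) (norm_nonneg _)

lemma integrable_star_dotProduct (hψ : ∀ j, Continuous (ψ j))
    (hψL2 : ∀ j, Integrable fun x => ∑ i, Complex.normSq (ψ j x i)) (j l : Fin N) :
    Integrable fun x => star (ψ j x) ⬝ᵥ ψ l x := by
  refine ((hψL2 j).add (hψL2 l)).mono' (continuous_star_dotProduct hψ j l).aestronglyMeasurable
    (Eventually.of_forall fun x => ?_)
  rw [Pi.add_apply, ← Finset.sum_add_distrib]
  refine norm_sum_le_of_le _ fun i _ => ?_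
  rw [norm_mul, Pi.star_apply, norm_star, Complex.normSq_eq_norm_sq, Complex.normSq_eq_norm_sq]
  nlinarith [sq_nonneg (‖ψ j x i‖ - ‖ψ l x i‖), sq_nonneg (‖ψ j x i‖), sq_nonneg (‖ψ l x i‖)]

lemma tendsto_cubeGram (hψ : ∀ j, Continuous (ψ j))
    (hψL2 : ∀ j, Integrable fun x => ∑ i, Complex.normSq (ψ j x i))
    (horth : ∀ j l, (∫ x : EuclideanSpace ℝ (Fin d),
        ∑ i, (starRingEnd ℂ) (ψ j x i) * ψ l x i) = if j = l then 1 else 0)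
    {w : ℕ → EuclideanSpace ℝ (Fin d) → ℝ} (hwc : ∀ m, Continuous (w m))
    (hw0 : ∀ m x, 0 ≤ w m x) (hw1 : ∀ m x, w m x ≤ 1) (hw : ∀ (m : ℕ) x, ‖x‖ ≤ m → w m x = 1) :
    Tendsto (fun m => cubeGram (w m) ψ (2 * m + 1)) atTop (𝓝 1) := by
  refine tendsto_pi_nhds.2 fun j => tendsto_pi_nhds.2 fun l => ?_
  rw [Matrix.one_apply, ← horth j l]
  exact tendsto_setIntegral_cube (integrable_star_dotProduct hψ hψL2 j l) hwc hw0 hw1 hw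

/-- On a large cube and for a fine mesh the discretised forms are close to their limits. -/
lemma exists_eventually_mesh (hψ : ∀ j i, ContDiff ℝ 2 fun x => ψ j x i)
    (hψL2 : ∀ j, Integrable fun x => ∑ i, Complex.normSq (ψ j x i))
    (horth : ∀ j l, (∫ x : EuclideanSpace ℝ (Fin d),
        ∑ i, (starRingEnd ℂ) (ψ j x i) * ψ l x i) = if j = l then 1 else 0)
    (heq : ∀ j x i, -(lap (fun y => ψ j y i) x) + (V x *ᵥ ψ j x) i = -(E j : ℂ) * ψ j x i)
    {ε : ℝ} (hε : 0 < ε) :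
    ∃ m : ℕ, 0 < m ∧ ∀ᶠ K : ℕ in atTop, ∀ c : Fin N → ℂ,
      |quad (meshGram (fun x => cutoff m x ^ 2) ψ (2 * m + 1) K) c - nsq c| ≤ ε * nsq c ∧
      ∑ j, E j * Complex.normSq (c j) - ε * nsq c ≤
        quad (meshHam (fun x => cutoff m x ^ 2) V ψ (2 * m + 1) K) c -
          d * (1 / (m : ℝ)) ^ 2 * quad (meshGram (fun _ => 1) ψ (2 * m + 1) K) c := by
  have hψc : ∀ j, Continuous (ψ j) := fun j => continuous_pi fun i => (hψ j i).continuous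
  have hχc : ∀ m : ℕ, Continuous fun x : EuclideanSpace ℝ (Fin d) => cutoff m x ^ 2 :=
    fun m => (continuous_cutoff m).pow 2
  have h1 := tendsto_cubeGram hψc hψL2 horth hχc (fun m x => sq_nonneg _)
    (fun m x => pow_le_one₀ (cutoff_nonneg m x) (cutoff_le_one m x))
    (fun m x hx => by rw [cutoff_eq_one hx, one_pow])
  have h2 := tendsto_cubeGram hψc hψL2 horth (w := fun _ _ => 1) (fun _ => continuous_const)
    (fun _ _ => zero_le_one) (fun _ _ => le_rfl) (fun _ _ _ => rfl)
  have h3 : Tendsto (fun m : ℕ => (fun j l => (E l : ℂ) *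
      cubeGram (fun x => cutoff m x ^ 2) ψ (2 * m + 1) j l : Matrix (Fin N) (Fin N) ℂ)) atTop
      (𝓝 (Matrix.diagonal fun j => (E j : ℂ))) := by
    refine tendsto_pi_nhds.2 fun j => tendsto_pi_nhds.2 fun l => ?_
    have := (tendsto_pi_nhds.1 (tendsto_pi_nhds.1 h1 j) l).const_mul (E l : ℂ)
    convert this using 2
    rw [Matrix.one_apply, Matrix.diagonal_apply]
    split_ifs with h
    · rw [h, mul_one]
    · rw [mul_zero]
  have h4 : Tendsto (fun m : ℕ => (d : ℝ) * (1 / (m : ℝ)) ^ 2) atTop (𝓝 0) := by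
    simpa using (tendsto_one_div_atTop_nhds_zero_nat (𝕜 := ℝ)).pow 2 |>.const_mul (d : ℝ)
  obtain ⟨m, hm0, a1, a2, a3, a4⟩ := ((eventually_gt_atTop 0).and
    ((eventually_abs_quad_sub_le h1 (half_pos hε)).and
    ((eventually_abs_quad_sub_le h2 one_half_pos).and
    ((eventually_abs_quad_sub_le h3 (ε := ε / 4) (by positivity)).and
    (h4.eventually_lt_const (u := ε / 4) (by positivity)))))).exists
  refine ⟨m, hm0, ?_⟩
  filter_upwards [eventually_abs_quad_sub_le (tendsto_meshGram (hχc m) hψc (2 * m + 1))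
      (half_pos hε),
    eventually_abs_quad_sub_le (tendsto_meshGram (w := fun _ => 1) continuous_const hψc
      (2 * m + 1)) one_half_pos,
    eventually_abs_quad_sub_le (tendsto_meshHam (V := V) (hχc m) hψ heq (2 * m + 1))
      (ε := ε / 4) (by positivity)] with K b1 b2 b3 c
  have a1 := abs_le.1 (a1 c)
  have a2 := abs_le.1 (a2 c)
  have a3 := abs_le.1 (a3 c)
  have b1 := abs_le.1 (b1 c)
  have b2 := abs_le.1 (b2 c)
  have b3 := abs_le.1 (b3 c)
  rw [quad_one] at a1 a2
  rw [quad_diagonal] at a3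
  have hc := nsq_nonneg c
  constructor
  · rw [abs_le]
    constructor <;> linarith [a1.1, a1.2, b1.1, b1.2]
  · have hq : quad (meshGram (fun _ => 1) ψ (2 * m + 1) K) c ≤ 2 * nsq c := by
      linarith [a2.2, b2.2]
    have hd : 0 ≤ (d : ℝ) * (1 / (m : ℝ)) ^ 2 := by positivity
    have := (mul_le_mul_of_nonneg_left hq hd).trans
      (mul_le_mul_of_nonneg_right a4.le (by positivity))
    linarith [a3.1, b3.1]

end continuumForms

section trialSpace

open Filter Topology

variable {d n N : ℕ}

lemma dlap_sum_smul {ι : Type*} [Fintype ι] [DecidableEq ι] (c : Fin N → ℂ)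
    (g : Fin N → (Fin d → ℤ) → ι → ℂ) (z : Fin d → ℤ) :
    dlap (fun z => ∑ j, c j • g j z) z = ∑ j, c j • dlap (g j) z := by
  simp only [dlap, Finset.smul_sum]
  rw [Finset.sum_comm]
  refine Finset.sum_congr rfl fun k _ => ?_
  rw [← Finset.sum_add_distrib, ← Finset.sum_sub_distrib]
  exact Finset.sum_congr rfl fun j _ => by module

/-- The combination `∑ c_j ψ_j` sampled on the mesh. -/
noncomputable def meshComb (ψ : Fin N → EuclideanSpace ℝ (Fin d) → Fin n → ℂ) (ρ K : ℕ)
    (c : Fin N → ℂ) (z : Fin d → ℤ) : Fin n → ℂ := ∑ j, c j • ψ j (meshPt ρ K z)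

/-- The cut-off combination of the sampled functions `ψ_j`, as a linear map. -/
noncomputable def trial (ψ : Fin N → EuclideanSpace ℝ (Fin d) → Fin n → ℂ) (m K : ℕ) :
    (Fin N → ℂ) →ₗ[ℂ] (Fin n × (Fin d → Fin (2 * (2 * m + 1) * K + 1)) → ℂ) where
  toFun c q := ((cutoff m (meshPt (2 * m + 1) K (emb q.2)) : ℂ) •
    meshComb ψ (2 * m + 1) K c (emb q.2)) q.1
  map_add' c c' := by
    funext q
    simp only [meshComb, Pi.add_apply, add_smul, Finset.sum_add_distrib, smul_add]
  map_smul' r c := by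
    funext q
    simp only [meshComb, Pi.smul_apply, RingHom.id_apply, smul_eq_mul, mul_smul,
      ← Finset.smul_sum]
    ring

variable {V : EuclideanSpace ℝ (Fin d) → Matrix (Fin n) (Fin n) ℂ}
  {ψ : Fin N → EuclideanSpace ℝ (Fin d) → Fin n → ℂ}

lemma nsq_smul_real (r : ℝ) (v : Fin n → ℂ) : nsq ((r : ℂ) • v) = r ^ 2 * nsq v := by
  simp only [nsq, Pi.smul_apply, smul_eq_mul, Complex.normSq_mul, Complex.normSq_ofReal,
    Finset.mul_sum, sq]

lemma nsq_trial {m K : ℕ} (hK : 0 < K) (c : Fin N → ℂ) :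
    nsq (trial ψ m K c) =
      (K : ℝ) ^ d * quad (meshGram (fun x => cutoff m x ^ 2) ψ (2 * m + 1) K) c := by
  have hK' : (K : ℝ) ^ d ≠ 0 := by positivity
  rw [meshGram, ← sum_re_dotProduct_eq_quad hK', nsq, Fintype.sum_prod_type_right]
  refine Finset.sum_congr rfl fun p _ => ?_
  rw [nsq_eq, Complex.ofReal_re]
  exact nsq_smul_real (cutoff m (meshPt (2 * m + 1) K (emb p)))
    (meshComb ψ (2 * m + 1) K c (emb p))

lemma one_le_of_cutoff_meshPt_ne_zero {m K : ℕ} (hm : 0 < m) (hK : 0 < K) {z : Fin d → ℤ}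
    (h : cutoff m (meshPt (2 * m + 1) K z) ≠ 0) (i : Fin d) :
    1 ≤ z i ∧ z i + 2 ≤ (2 * (2 * m + 1) * K + 1 : ℕ) := by
  have hK' : (0 : ℝ) < K := by exact_mod_cast hK
  have h1 := (PiLp.norm_apply_le (meshPt (2 * m + 1) K z) i).trans_lt
    (norm_lt_of_cutoff_ne_zero hm h)
  rw [Real.norm_eq_abs, meshPt_apply, abs_lt] at h1
  push_cast at h1
  have h2 : (1 : ℝ) < (z i : ℝ) / K := by linarith [h1.1]
  have h3 : (z i : ℝ) / K < 4 * m + 1 := by linarith [h1.2]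
  rw [lt_div_iff₀ hK', one_mul] at h2
  rw [div_lt_iff₀ hK'] at h3
  have h2' : (K : ℤ) < z i := by exact_mod_cast h2
  have h3' : z i < (4 * m + 1) * (K : ℤ) := by exact_mod_cast h3
  have hK1 : (1 : ℤ) ≤ K := by exact_mod_cast hK
  push_cast
  constructor <;> nlinarith

lemma abs_cutoff_meshPt_sub_le (m K : ℕ) (z : Fin d → ℤ) (j : Fin d) :
    |cutoff m (meshPt (2 * m + 1) K (z + Pi.single j 1)) -
      cutoff m (meshPt (2 * m + 1) K z)| ≤ (K : ℝ)⁻¹ * (1 / m) := by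
  refine (abs_cutoff_sub_le m _ _).trans (le_of_eq ?_)
  rw [meshPt_add_single, add_sub_cancel_left, norm_smul, PiLp.norm_single, norm_one,
    mul_one, norm_inv, Real.norm_natCast, mul_one_div]

lemma quad_trial_ge {m K : ℕ} (hm : 0 < m) (hK : 0 < K) (c : Fin N → ℂ) :
    (K : ℝ) ^ d * ((K : ℝ) ^ 2)⁻¹ *
      (quad (meshHam (fun x => cutoff m x ^ 2) V ψ (2 * m + 1) K) c -
        d * (1 / (m : ℝ)) ^ 2 * quad (meshGram (fun _ => 1) ψ (2 * m + 1) K) c) ≤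
      quad (latH d fun p : Fin d → Fin (2 * (2 * m + 1) * K + 1) =>
        ((K : ℝ) ^ 2)⁻¹ • (-(V (meshPt (2 * m + 1) K (emb p))))) (trial ψ m K c) := by
  have hK' : (K : ℝ) ^ d ≠ 0 := by positivity
  have hKc : (K : ℂ) ≠ 0 := by exact_mod_cast hK.ne'
  have hKr : (K : ℝ) ≠ 0 := by exact_mod_cast hK.ne'
  set φ := meshComb ψ (2 * m + 1) K c with hφ
  set χ : (Fin d → ℤ) → ℝ := fun z => cutoff m (meshPt (2 * m + 1) K z) with hχ
  have hloc := localization_le (L := 2 * (2 * m + 1) * K + 1) (φ := φ) (χ := χ)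
    (fun z hz => one_le_of_cutoff_meshPt_ne_zero hm hK hz) (abs_cutoff_meshPt_sub_le m K)
  have hquad := quad_latH (fun p : Fin d → Fin (2 * (2 * m + 1) * K + 1) =>
    ((K : ℝ) ^ 2)⁻¹ • (-(V (meshPt (2 * m + 1) K (emb p))))) (fun z => (χ z : ℂ) • φ z) (by
      rintro z ⟨i, hi⟩
      have h0 : χ z = 0 := by
        by_contra h
        have := one_le_of_cutoff_meshPt_ne_zero hm hK h i
        omega
      rw [h0, Complex.ofReal_zero, zero_smul])
  have htr : trial ψ m K c = fun q => (fun z => (χ z : ℂ) • φ z) (emb q.2) q.1 := rfl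
  rw [htr, hquad, Finset.sum_add_distrib]
  have hG : ∑ p : Fin d → Fin (2 * (2 * m + 1) * K + 1), nsq (φ (emb p)) =
      (K : ℝ) ^ d * quad (meshGram (fun _ => 1) ψ (2 * m + 1) K) c := by
    rw [meshGram, ← sum_re_dotProduct_eq_quad hK']
    refine Finset.sum_congr rfl fun p _ => ?_
    rw [nsq_eq, Complex.ofReal_re, one_mul, hφ, meshComb]
  have hH : (∑ p : Fin d → Fin (2 * (2 * m + 1) * K + 1),
        χ (emb p) ^ 2 * (star (φ (emb p)) ⬝ᵥ dlap φ (emb p)).re) +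
      ∑ p : Fin d → Fin (2 * (2 * m + 1) * K + 1),
        quad (((K : ℝ) ^ 2)⁻¹ • (-(V (meshPt (2 * m + 1) K (emb p)))))
          ((χ (emb p) : ℂ) • φ (emb p)) =
      ((K : ℝ) ^ 2)⁻¹ * ((K : ℝ) ^ d *
        quad (meshHam (fun x => cutoff m x ^ 2) V ψ (2 * m + 1) K) c) := by
    rw [meshHam, ← sum_re_dotProduct_eq_quad hK', Finset.mul_sum, ← Finset.sum_add_distrib]
    refine Finset.sum_congr rfl fun p _ => ?_
    have hv : ∑ l, c l • ((K : ℂ) ^ 2 • dlap (fun z => ψ l (meshPt (2 * m + 1) K z)) (emb p) +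
        (-(V (meshPt (2 * m + 1) K (emb p)))) *ᵥ ψ l (meshPt (2 * m + 1) K (emb p))) =
        (((K : ℝ) ^ 2 : ℝ) : ℂ) • dlap φ (emb p) +
          (-(V (meshPt (2 * m + 1) K (emb p)))) *ᵥ φ (emb p) := by
      rw [hφ]
      simp only [smul_add, Finset.sum_add_distrib, ← mulVec_smul]
      rw [← mulVec_sum]
      congr 1
      have : meshComb ψ (2 * m + 1) K c = fun z => ∑ j, c j • ψ j (meshPt (2 * m + 1) K z) := rfl
      rw [this, dlap_sum_smul c (fun l z => ψ l (meshPt (2 * m + 1) K z)), Finset.smul_sum]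
      refine Finset.sum_congr rfl fun l _ => ?_
      rw [smul_comm]
      push_cast
      rfl
    rw [hv, dotProduct_add, Complex.add_re, quad_smul, quad, mulVec_smul, re_star_smul_dotProduct,
      dotProduct_smul, smul_eq_mul, Complex.re_ofReal_mul, hφ, meshComb]
    field_simp
    ring
  rw [hG] at hloc
  have e : (d : ℝ) * ((K : ℝ)⁻¹ * (1 / m)) ^ 2 *
      ((K : ℝ) ^ d * quad (meshGram (fun _ => 1) ψ (2 * m + 1) K) c) =
      (K : ℝ) ^ d * ((K : ℝ) ^ 2)⁻¹ *
        (d * (1 / (m : ℝ)) ^ 2 * quad (meshGram (fun _ => 1) ψ (2 * m + 1) K) c) := by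
    rw [mul_pow, inv_pow]
    ring
  rw [e] at hloc
  linarith

end trialSpace

section mainBound

open Filter Topology

variable {d n N : ℕ} {V : EuclideanSpace ℝ (Fin (d + 2)) → Matrix (Fin n) (Fin n) ℂ}
  {ψ : Fin N → EuclideanSpace ℝ (Fin (d + 2)) → Fin n → ℂ} {E : Fin N → ℝ}

lemma inv_sq_rpow_half (K : ℕ) (e : ℕ) :
    (((K : ℝ) ^ 2)⁻¹) ^ ((e : ℝ) / 2) = ((K : ℝ) ^ e)⁻¹ := by
  have h0 : (0 : ℝ) ≤ (K : ℝ) := Nat.cast_nonneg K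
  rw [Real.inv_rpow (by positivity), ← Real.rpow_natCast, ← Real.rpow_mul h0, ← Real.rpow_natCast]
  congr 2
  push_cast
  ring

lemma sum_posPow_le_mesh {γ ε M : ℝ} (hγ : 1 / 2 ≤ γ) (hε0 : 0 < ε) (hε1 : ε < 1) (hM : 0 ≤ M)
    {m K : ℕ} (hm : 0 < m) (hK : 0 < K) (hV : ∀ x, (V x).IsHermitian)
    (hVM : ∀ x ∈ cube (d + 2) (2 * m + 1), ∑ i, ∑ j, ‖(-(V x)) i j‖ ≤ M)
    (h : ∀ c : Fin N → ℂ,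
      |quad (meshGram (fun x => cutoff m x ^ 2) ψ (2 * m + 1) K) c - nsq c| ≤ ε * nsq c ∧
      ∑ j, E j * Complex.normSq (c j) - ε * nsq c ≤
        quad (meshHam (fun x => cutoff m x ^ 2) V ψ (2 * m + 1) K) c -
          (d + 2 : ℕ) * (1 / (m : ℝ)) ^ 2 *
            quad (meshGram (fun _ => 1) ψ (2 * m + 1) K) c) :
    ∑ j, (max ((E j - ε) / (1 + ε)) 0) ^ γ ≤
      4 * Lcl γ (d + 2) * (1 + ((K : ℝ) ^ 2)⁻¹ * M / 3) ^ d *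
        ((∑ p : Fin (d + 2) → Fin (2 * (2 * m + 1) * K + 1),
          rm (γ + (d + 2 : ℕ) / 2) (-(V (meshPt (2 * m + 1) K (emb p))))) / (K : ℝ) ^ (d + 2)) := by
  set s : ℝ := ((K : ℝ) ^ 2)⁻¹ with hs
  have hs0 : 0 < s := by positivity
  have ha : (0 : ℝ) < (K : ℝ) ^ (d + 2) := by positivity
  have hVh : ∀ x, (-(V x)).IsHermitian := fun x => (hV x).neg
  set b : (Fin (d + 2) → Fin (2 * (2 * m + 1) * K + 1)) → Matrix (Fin n) (Fin n) ℂ :=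
    fun p => s • (-(V (meshPt (2 * m + 1) K (emb p)))) with hb
  have hbh : ∀ p, (b p).IsHermitian := fun p => (hVh _).smul (IsSelfAdjoint.all _)
  have h1 := sum_posPow_le_rm (isHermitian_latH hbh) (trial ψ m K) (E := E) (γ := γ) ha hs0 hε0 hε1
    (by linarith)
    (fun c => by
      rw [nsq_trial hK]
      exact mul_le_mul_of_nonneg_left (by linarith [(abs_le.1 (h c).1).1]) ha.le)
    (fun c => by
      rw [nsq_trial hK]
      exact mul_le_mul_of_nonneg_left (by linarith [(abs_le.1 (h c).1).2]) ha.le)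
    (fun c => (mul_le_mul_of_nonneg_left (h c).2 (by positivity)).trans
      (quad_trial_ge (V := V) hm hK c))
  have h2 := rm_latH_le_four (M := s * M) (by positivity) hbh (fun p v => by
    rw [hb, quad_smul, mul_assoc s M]
    exact mul_le_mul_of_nonneg_left ((quad_le_sum_norm _ v).trans (mul_le_mul_of_nonneg_right
      (hVM _ (meshPt_emb_mem_cube hK p)) (nsq_nonneg v))) hs0.le) hγ
  have hp : 0 < γ + (d + 2 : ℕ) / 2 := by positivity
  have h3 : ∑ p, rm (γ + (d + 2 : ℕ) / 2) (b p) = s ^ γ *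
      ((∑ p : Fin (d + 2) → Fin (2 * (2 * m + 1) * K + 1),
        rm (γ + (d + 2 : ℕ) / 2) (-(V (meshPt (2 * m + 1) K (emb p))))) / (K : ℝ) ^ (d + 2)) := by
    rw [Finset.sum_div, Finset.mul_sum]
    refine Finset.sum_congr rfl fun p _ => ?_
    rw [hb, rm_smul hp hs0 (hVh _), Real.rpow_add hs0, hs, inv_sq_rpow_half]
    ring
  rw [h3] at h2
  have h4 := h1.trans h2
  rw [mul_left_comm] at h4
  exact le_of_mul_le_mul_left h4 (Real.rpow_pos_of_pos hs0 γ)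

/-- The Lieb–Thirring bound up to a small loss in the eigenvalues. -/
lemma sum_posPow_le_integral {γ ε : ℝ} (hγ : 1 / 2 ≤ γ) (hε0 : 0 < ε) (hε1 : ε < 1)
    (hVcont : Continuous V) (hV : ∀ x, (V x).IsHermitian)
    (hVint : Integrable fun x => rm (γ + (d + 2 : ℕ) / 2) (-(V x)))
    (hψ : ∀ j i, ContDiff ℝ 2 fun x => ψ j x i)
    (hψL2 : ∀ j, Integrable fun x => ∑ i, Complex.normSq (ψ j x i))
    (horth : ∀ j l, (∫ x : EuclideanSpace ℝ (Fin (d + 2)),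
        ∑ i, (starRingEnd ℂ) (ψ j x i) * ψ l x i) = if j = l then 1 else 0)
    (heq : ∀ j x i, -(lap (fun y => ψ j y i) x) + (V x *ᵥ ψ j x) i = -(E j : ℂ) * ψ j x i) :
    ∑ j, (max ((E j - ε) / (1 + ε)) 0) ^ γ ≤
      4 * Lcl γ (d + 2) * ∫ x, rm (γ + (d + 2 : ℕ) / 2) (-(V x)) := by
  have hVh : ∀ x, (-(V x)).IsHermitian := fun x => (hV x).neg
  have hp : 0 < γ + (d + 2 : ℕ) / 2 := by positivity
  obtain ⟨m, hm, h⟩ := exists_eventually_mesh hψ hψL2 horth heq hε0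
  have hc : Continuous fun x => ∑ i, ∑ j, ‖(-(V x)) i j‖ := by
    have := fun i j => (hVcont.neg).matrix_elem i j
    fun_prop
  obtain ⟨M, hM⟩ := (isCompact_cube (d := d + 2) (2 * m + 1)).exists_bound_of_continuousOn
    hc.continuousOn
  have hrm := continuous_rm hp hVh hVcont.neg
  have hlim : Tendsto (fun K : ℕ => 4 * Lcl γ (d + 2) * (1 + ((K : ℝ) ^ 2)⁻¹ * max M 0 / 3) ^ d *
        ((∑ p : Fin (d + 2) → Fin (2 * (2 * m + 1) * K + 1),
          rm (γ + (d + 2 : ℕ) / 2) (-(V (meshPt (2 * m + 1) K (emb p))))) / (K : ℝ) ^ (d + 2)))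
      atTop (𝓝 (4 * Lcl γ (d + 2) * (1 + 0 * max M 0 / 3) ^ d *
        ∫ x in cube (d + 2) (2 * m + 1), rm (γ + (d + 2 : ℕ) / 2) (-(V x)))) := by
    have h0 : Tendsto (fun K : ℕ => ((K : ℝ) ^ 2)⁻¹) atTop (𝓝 0) :=
      tendsto_inv_atTop_zero.comp
        ((tendsto_pow_atTop two_ne_zero).comp tendsto_natCast_atTop_atTop)
    have h1 : Tendsto (fun K : ℕ => 4 * Lcl γ (d + 2) *
        (1 + ((K : ℝ) ^ 2)⁻¹ * max M 0 / 3) ^ d) atTop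
        (𝓝 (4 * Lcl γ (d + 2) * (1 + 0 * max M 0 / 3) ^ d)) :=
      ((((h0.mul_const _).div_const _).const_add _).pow d).const_mul _
    have h2 := tendsto_riemann_sum (F := fun x => rm (γ + (d + 2 : ℕ) / 2) (-(V x)))
      (2 * m + 1) hrm
    exact h1.mul h2
  have hle := ge_of_tendsto hlim (by
    filter_upwards [h, eventually_gt_atTop 0] with K hK hK0
    refine sum_posPow_le_mesh hγ hε0 hε1 (le_max_right _ _) hm hK0 hV (fun x hx => ?_) hK
    exact (le_abs_self _).trans ((hM x hx).trans (le_max_left _ _)))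
  rw [zero_mul, zero_div, add_zero, one_pow, mul_one] at hle
  refine hle.trans (mul_le_mul_of_nonneg_left ?_ ?_)
  · exact setIntegral_le_integral hVint (Eventually.of_forall fun x => rm_nonneg (hVh x))
  · exact mul_nonneg (by norm_num) (Lcl_pos (by linarith) _).le

lemma sum_rpow_le_integral {γ : ℝ} (hγ : 1 / 2 ≤ γ) (hE : ∀ j, 0 < E j)
    (hVcont : Continuous V) (hV : ∀ x, (V x).IsHermitian)
    (hVint : Integrable fun x => rm (γ + (d + 2 : ℕ) / 2) (-(V x)))
    (hψ : ∀ j i, ContDiff ℝ 2 fun x => ψ j x i)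
    (hψL2 : ∀ j, Integrable fun x => ∑ i, Complex.normSq (ψ j x i))
    (horth : ∀ j l, (∫ x : EuclideanSpace ℝ (Fin (d + 2)),
        ∑ i, (starRingEnd ℂ) (ψ j x i) * ψ l x i) = if j = l then 1 else 0)
    (heq : ∀ j x i, -(lap (fun y => ψ j y i) x) + (V x *ᵥ ψ j x) i = -(E j : ℂ) * ψ j x i) :
    ∑ j, E j ^ γ ≤ 4 * Lcl γ (d + 2) * ∫ x, rm (γ + (d + 2 : ℕ) / 2) (-(V x)) := by
  have hlim : Tendsto (fun ε : ℝ => ∑ j, (max ((E j - ε) / (1 + ε)) 0) ^ γ) (𝓝[>] 0)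
      (𝓝 (∑ j, E j ^ γ)) := by
    refine tendsto_finsetSum _ fun j _ => Tendsto.rpow_const (tendsto_nhdsWithin_of_tendsto_nhds ?_)
      (Or.inr (by linarith))
    have : ContinuousAt (fun ε : ℝ => max ((E j - ε) / (1 + ε)) 0) 0 :=
      ((continuousAt_const.sub continuousAt_id).div (continuousAt_const.add continuousAt_id)
        (by simp)).max continuousAt_const
    simpa [ContinuousAt, (hE j).le] using this
  refine le_of_tendsto hlim ?_
  filter_upwards [Ioo_mem_nhdsGT one_pos] with ε hε
  exact sum_posPow_le_integral hγ hε.1 hε.2 hVcont hV hVint hψ hψL2 horth heq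

end mainBound

end LiebThirring

/-- **Lieb–Thirring bound `L_{γ,d} ≤ 4 L^cl_{γ,d}` for `1/2 ≤ γ < 1` and all `d ≥ 2`,
matrix potentials:** `∑ E_j^γ ≤ 4 L^cl_{γ,d} ∫ tr((-V)^{γ+d/2}) dx`. -/
theorem lieb_thirring_four_times_classical (d : ℕ) (hd : 2 ≤ d)
    (n : ℕ) (hn : 1 ≤ n)
    (γ : ℝ) (hγ1 : 1 / 2 ≤ γ) (hγ2 : γ < 1)
    (V : EuclideanSpace ℝ (Fin d) → Matrix (Fin n) (Fin n) ℂ)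
    (hVcont : Continuous V)
    (hV : ∀ x, (-(V x)).PosSemidef)
    (hVint : Integrable fun x => traceRpow (-(V x)) (hV x).1 (γ + d / 2))
    (N : ℕ) (ψ : Fin N → EuclideanSpace ℝ (Fin d) → Fin n → ℂ) (E : Fin N → ℝ)
    (hE : ∀ j, 0 < E j)
    (hψC2 : ∀ j i, ContDiff ℝ 2 fun x => ψ j x i)
    (hψL2 : ∀ j, Integrable fun x => ∑ i, Complex.normSq (ψ j x i))
    (horth : ∀ j l, (∫ x : EuclideanSpace ℝ (Fin d),
        ∑ i, (starRingEnd ℂ) (ψ j x i) * ψ l x i) = if j = l then 1 else 0)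
    (heq : ∀ j x i,
      -(lap (fun y => ψ j y i) x) + (V x *ᵥ ψ j x) i = -(E j : ℂ) * ψ j x i) :
    ∑ j, E j ^ γ ≤
      4 * Lcl γ d * ∫ x : EuclideanSpace ℝ (Fin d),
        traceRpow (-(V x)) (hV x).1 (γ + d / 2) := by
  obtain ⟨d, rfl⟩ := Nat.exists_eq_add_of_le' hd
  have hrm : ∀ x, traceRpow (-(V x)) (hV x).1 (γ + (d + 2 : ℕ) / 2) =
      LiebThirring.rm (γ + (d + 2 : ℕ) / 2) (-(V x)) := fun x =>
    (LiebThirring.rm_eq_of_posSemidef (hV x) _).symm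
  simp only [hrm] at hVint ⊢
  exact LiebThirring.sum_rpow_le_integral hγ1 hE hVcont
    (fun x => by simpa using (hV x).1.neg) hVint hψC2 hψL2 horth heq
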